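/- arXiv:1609.01083 — 2 statements merged into one kernel-verified Lean document; each statement's English description precedes it below -/
import Mathlib

section
/- Let s ∈ ℕ, let c ∈ ℝ ∖ {0}, and let ψ, φ : ℝ → ℂ be C^s functions with compact supports contained in (0,∞). There is a constant C = C(s, c, ψ, φ) with the following property: if m : (0,∞)² → ℂ admits partial derivatives ∂^γ m for every multi-index γ = (γ₁, γ₂) with γ₁ ≤ s and γ₂ ≤ s, and A ≥ 0 is such that |∂^γ m(λ₁,λ₂)| ≤ A · λ₁^{−γ₁} λ₂^{−γ₂} for all such γ and all λ ∈ (0,∞)², then for every k ∈ ℤ and every n = (n₁,n₂) ∈ ℤ², | ∫_{(0,∞)}∫_{(0,∞)} ψ(ξ₁) φ(ξ₂) m(2^k ξ₁, 2^k ξ₂) e^{i c (n₁ξ₁ + n₂ξ₂)} dξ₁ dξ₂ | ≤ C · A · (1 + |n₁| + |n₂|)^{−s}. -/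
open MeasureTheory Real
open scoped ENNReal NNReal

/-- First partial derivative of a function of two real variables. -/
noncomputable def pd1 (m : ℝ → ℝ → ℂ) : ℝ → ℝ → ℂ := fun x y => deriv (fun t => m t y) x

/-- Second partial derivative of a function of two real variables. -/
noncomputable def pd2 (m : ℝ → ℝ → ℂ) : ℝ → ℝ → ℂ := fun x y => deriv (fun t => m x t) y

/-- The mixed partial derivative `∂₁^a ∂₂^b m`. -/
noncomputable def mpd (a b : ℕ) (m : ℝ → ℝ → ℂ) : ℝ → ℝ → ℂ :=
  pd1^[a] (pd2^[b] m)

lemma mpd_zero_left (b : ℕ) (m : ℝ → ℝ → ℂ) (x : ℝ) : mpd 0 b m x = deriv^[b] (m x) := by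
  change (pd2^[b] m) x = _
  induction b with
  | zero => rfl
  | succ b ih =>
    rw [Function.iterate_succ_apply', Function.iterate_succ_apply', ← ih]
    rfl

lemma mpd_zero_right (a : ℕ) (m : ℝ → ℝ → ℂ) (y : ℝ) :
    (fun x => mpd a 0 m x y) = deriv^[a] (fun x => m x y) := by
  change (fun x => (pd1^[a] m) x y) = _
  induction a with
  | zero => rfl
  | succ a ih =>
    rw [Function.iterate_succ_apply', Function.iterate_succ_apply', ← ih]
    rfl

lemma iterate_deriv_comp_mul_left (b : ℕ) (f : ℝ → ℂ) (t : ℝ) :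
    deriv^[b] (fun y => f (t * y)) = fun y => (t : ℂ) ^ b * deriv^[b] f (t * y) := by
  induction b with
  | zero => simp
  | succ b ih =>
    rw [Function.iterate_succ_apply', ih, Function.iterate_succ_apply']
    ext y
    rw [deriv_const_mul_field, deriv_comp_mul_left, Complex.real_smul]
    ring

lemma hasDerivAt_mul_of_tsupport_subset {φ f : ℝ → ℂ} {U : Set ℝ} (hφ : Differentiable ℝ φ)
    (hU : tsupport φ ⊆ U) (hf : ∀ y ∈ U, DifferentiableAt ℝ f y) (y : ℝ) :
    HasDerivAt (fun y => φ y * f y) (deriv φ y * f y + φ y * deriv f y) y := by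
  by_cases hy : y ∈ U
  · exact (hφ y).hasDerivAt.mul (hf y hy).hasDerivAt
  · have hy' : y ∉ tsupport φ := fun h => hy (hU h)
    have h0 : φ =ᶠ[nhds y] 0 := notMem_tsupport_iff_eventuallyEq.mp hy'
    rw [h0.deriv_eq, h0.eq_of_nhds]
    have h1 : (fun y => φ y * f y) =ᶠ[nhds y] fun _ => 0 := by
      filter_upwards [h0] with z hz
      simp [hz]
    simpa using (hasDerivAt_const y (0 : ℂ)).congr_of_eventuallyEq h1

lemma norm_exp_ofReal_mul_I_mul (ω y : ℝ) : ‖Complex.exp (Complex.I * ω * y)‖ = 1 := by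
  rw [show Complex.I * ω * y = ((ω * y : ℝ) : ℂ) * Complex.I by push_cast; ring]
  exact Complex.norm_exp_ofReal_mul_I _

lemma hasDerivAt_exp_I_mul (ω y : ℝ) :
    HasDerivAt (fun y : ℝ => Complex.exp (Complex.I * ω * y))
      (Complex.I * ω * Complex.exp (Complex.I * ω * y)) y := by
  have h := ((Complex.ofRealCLM.hasDerivAt (x := y)).const_mul (Complex.I * ω)).cexp
  simpa [mul_comm] using h

lemma integrable_mul_mul_exp {φ f : ℝ → ℂ} (hφ : Continuous φ) (hφc : HasCompactSupport φ)
    (hm : AEStronglyMeasurable (fun y => φ y * f y)) {B : ℝ}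
    (hB : ∀ y ∈ tsupport φ, ‖f y‖ ≤ B) (ω : ℝ) :
    Integrable fun y : ℝ => φ y * f y * Complex.exp (Complex.I * ω * y) := by
  refine ((hφ.integrable_of_hasCompactSupport hφc).norm.mul_const B).mono'
    (hm.mul (by fun_prop)) (.of_forall fun y => ?_)
  rw [norm_mul, norm_mul, norm_exp_ofReal_mul_I_mul, mul_one]
  by_cases hy : y ∈ tsupport φ
  · gcongr
    exact hB y hy
  · simp [image_eq_zero_of_notMem_tsupport hy]

/-- Non-stationary phase: `s` integrations by parts against `exp (I * ω * y)`, for an amplitude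
with cut-off `φ` and `s` derivatives bounded on the support of the cut-off. -/
lemma exists_pow_mul_norm_integral_le {U : Set ℝ} (hU : IsOpen U) (s : ℕ) :
    ∀ φ : ℝ → ℂ, ContDiff ℝ s φ → HasCompactSupport φ → tsupport φ ⊆ U →
    ∃ C : ℝ, 0 ≤ C ∧ ∀ (f : ℝ → ℂ) (B : ℝ),
      (∀ b < s, ∀ y ∈ U, DifferentiableAt ℝ (deriv^[b] f) y) →
      (∀ b ≤ s, ∀ y ∈ tsupport φ, ‖deriv^[b] f y‖ ≤ B) →
      ∀ ω : ℝ, |ω| ^ s * ‖∫ y : ℝ, φ y * f y * Complex.exp (Complex.I * ω * y)‖ ≤ C * B := by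
  induction s with
  | zero =>
    intro φ hφ hφc hφU
    refine ⟨∫ y, ‖φ y‖, by positivity, fun f B _ hB ω => ?_⟩
    rw [pow_zero, one_mul, ← integral_mul_const]
    refine norm_integral_le_of_norm_le
      ((hφ.continuous.integrable_of_hasCompactSupport hφc).norm.mul_const B)
      (.of_forall fun y => ?_)
    rw [norm_mul, norm_mul, norm_exp_ofReal_mul_I_mul, mul_one]
    by_cases hy : y ∈ tsupport φ
    · gcongr
      exact hB 0 le_rfl y hy
    · simp [image_eq_zero_of_notMem_tsupport hy]
  | succ s ih =>
    intro φ hφ hφc hφU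
    have hφ' : ContDiff ℝ s (deriv φ) :=
      ((contDiff_succ_iff_deriv (n := (s : WithTop ℕ∞))).mp (by exact_mod_cast hφ)).2.2
    have hsub : tsupport (deriv φ) ⊆ tsupport φ := tsupport_deriv_subset
    obtain ⟨C₁, hC₁, h₁⟩ := ih (deriv φ) hφ' hφc.deriv (hsub.trans hφU)
    obtain ⟨C₂, hC₂, h₂⟩ := ih φ (hφ.of_le (by norm_cast; omega)) hφc hφU
    refine ⟨C₁ + C₂, by positivity, fun f B hd hB ω => ?_⟩
    have hd0 : ∀ y ∈ U, DifferentiableAt ℝ f y := hd 0 (by omega)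
    have hB0 : ∀ y ∈ tsupport φ, ‖f y‖ ≤ B := hB 0 (by omega)
    have hB1 : ∀ y ∈ tsupport φ, ‖deriv f y‖ ≤ B := hB 1 (by omega)
    specialize h₁ f B (fun b hb => hd b (by omega))
      (fun b hb y hy => hB b (by omega) y (hsub hy)) ω
    specialize h₂ (deriv f) B (fun b hb => hd (b + 1) (by omega))
      (fun b hb => hB (b + 1) (by omega)) ω
    have hfc : ContinuousOn f U := fun y hy => (hd0 y hy).continuousAt.continuousWithinAt
    have hφf : Continuous fun y => φ y * f y :=
      (hφ.continuous.continuousOn.mul hfc).continuous_of_tsupport_subset hU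
        ((tsupport_mul_subset_left).trans hφU)
    have hφ'f : Continuous fun y => deriv φ y * f y :=
      (hφ'.continuous.continuousOn.mul hfc).continuous_of_tsupport_subset hU
        ((tsupport_mul_subset_left).trans (hsub.trans hφU))
    have i0 := integrable_mul_mul_exp hφ.continuous hφc hφf.aestronglyMeasurable hB0 ω
    have i1 := integrable_mul_mul_exp hφ'.continuous hφc.deriv hφ'f.aestronglyMeasurable
      (fun y hy => hB0 y (hsub hy)) ω
    have i2 := integrable_mul_mul_exp hφ.continuous hφc
      (hφ.continuous.aestronglyMeasurable.mul (measurable_deriv f).aestronglyMeasurable) hB1 ω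
    have i12 : Integrable fun y : ℝ => (deriv φ y * f y + φ y * deriv f y) *
        Complex.exp (Complex.I * ω * y) := by
      simp only [add_mul]
      exact i1.add i2
    have parts := integral_mul_deriv_eq_deriv_mul_of_integrable
      (u := fun y => φ y * f y) (v := fun y : ℝ => Complex.exp (Complex.I * ω * y))
      (fun y _ => hasDerivAt_mul_of_tsupport_subset
        (hφ.differentiable (by norm_cast)) hφU hd0 y)
      (fun y _ => hasDerivAt_exp_I_mul ω y)
      (by
        have := i0.const_mul (Complex.I * ω)
        refine this.congr (.of_forall fun y => ?_)
        simp only [Pi.mul_apply]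
        ring)
      i12 i0
    have hl : ∫ y : ℝ, φ y * f y * (Complex.I * ω * Complex.exp (Complex.I * ω * y)) =
        Complex.I * ω * ∫ y : ℝ, φ y * f y * Complex.exp (Complex.I * ω * y) := by
      rw [← integral_const_mul]
      congr 1 with y
      ring
    simp only [add_mul] at parts
    rw [hl, integral_add i1 i2] at parts
    have hn := congrArg norm parts
    rw [norm_neg, norm_mul, norm_mul, Complex.norm_I, one_mul, Complex.norm_real,
      Real.norm_eq_abs] at hn
    rw [pow_succ, mul_assoc, hn]
    calc _ ≤ |ω| ^ s * (‖∫ y : ℝ, deriv φ y * f y * Complex.exp (Complex.I * ω * y)‖ +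
          ‖∫ y : ℝ, φ y * deriv f y * Complex.exp (Complex.I * ω * y)‖) := by
          gcongr
          exact norm_add_le _ _
      _ ≤ _ := by linarith

/-- Scale-invariant oscillatory integral bound for a one-dimensional Mikhlin multiplier. -/
lemma exists_pow_mul_norm_setIntegral_le (s : ℕ) {φ : ℝ → ℂ} (hφ : ContDiff ℝ s φ)
    (hφc : HasCompactSupport φ) (hφs : tsupport φ ⊆ Set.Ioi 0) :
    ∃ C : ℝ, 0 ≤ C ∧ ∀ (f : ℝ → ℂ) (A : ℝ), 0 ≤ A →
      (∀ b < s, ∀ y > 0, DifferentiableAt ℝ (deriv^[b] f) y) →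
      (∀ b ≤ s, ∀ y > 0, ‖deriv^[b] f y‖ ≤ A * y ^ (-(b : ℝ))) →
      ∀ t > 0, ∀ ω : ℝ, |ω| ^ s *
        ‖∫ y in Set.Ioi (0 : ℝ), φ y * f (t * y) * Complex.exp (Complex.I * ω * y)‖ ≤ C * A := by
  obtain ⟨C, hC, h⟩ := exists_pow_mul_norm_integral_le isOpen_Ioi s φ hφ hφc hφs
  obtain ⟨M, hM1, hM⟩ : ∃ M : ℝ, 1 ≤ M ∧ ∀ y ∈ tsupport φ, y⁻¹ ≤ M := by
    have hcont : ContinuousOn (fun y : ℝ => y⁻¹) (tsupport φ) :=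
      continuousOn_inv₀.mono fun y hy => (hφs hy).ne'
    obtain ⟨M, hM⟩ := hφc.isCompact.bddAbove_image hcont
    exact ⟨max 1 M, le_max_left _ _,
      fun y hy => (hM (Set.mem_image_of_mem _ hy)).trans (le_max_right _ _)⟩
  refine ⟨C * M ^ s, by positivity, fun f A hA hd hB t ht ω => ?_⟩
  have h_int : ∫ y in Set.Ioi (0 : ℝ), φ y * f (t * y) * Complex.exp (Complex.I * ω * y) =
      ∫ y : ℝ, φ y * f (t * y) * Complex.exp (Complex.I * ω * y) := by
    refine setIntegral_eq_integral_of_forall_compl_eq_zero fun y hy => ?_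
    simp [image_eq_zero_of_notMem_tsupport fun h => hy (hφs h)]
  rw [h_int, mul_assoc, mul_comm (M ^ s)]
  refine h (fun y => f (t * y)) (A * M ^ s) (fun b hb y hy => ?_) (fun b hb y hy => ?_) ω
  · rw [iterate_deriv_comp_mul_left]
    have hy : 0 < y := hy
    have h1 : DifferentiableAt ℝ (deriv^[b] f) (t * y) := hd b hb _ (mul_pos ht hy)
    have h2 : DifferentiableAt ℝ (fun y : ℝ => t * y) y := by fun_prop
    exact (h1.comp y h2).const_mul _
  · have hy0 : 0 < y := hφs hy
    have h1 := hB b hb (t * y) (mul_pos ht hy0)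
    rw [rpow_neg (by positivity), rpow_natCast, mul_pow] at h1
    rw [iterate_deriv_comp_mul_left, norm_mul, norm_pow, Complex.norm_real,
      Real.norm_of_nonneg ht.le]
    calc t ^ b * ‖deriv^[b] f (t * y)‖ ≤ t ^ b * (A * (t ^ b * y ^ b)⁻¹) := by gcongr
      _ = A * (y⁻¹) ^ b := by
        rw [inv_pow]
        field_simp
      _ ≤ A * M ^ b := by
        gcongr
        exact hM y hy
      _ ≤ A * M ^ s := by gcongr

/-- Oscillatory decay in the inner variable of an iterated integral. -/
lemma pow_mul_norm_integral_integral_le (s : ℕ) {ψ φ : ℝ → ℂ} (hψ : Integrable ψ)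
    {g : ℝ → ℝ → ℂ} {ω₁ ω₂ K : ℝ} (hK : 0 ≤ K)
    (h : ∀ x > 0, |ω₂| ^ s *
      ‖∫ y in Set.Ioi (0 : ℝ), φ y * g x y * Complex.exp (Complex.I * ω₂ * y)‖ ≤ K) :
    |ω₂| ^ s * ‖∫ x in Set.Ioi (0 : ℝ), ∫ y in Set.Ioi (0 : ℝ),
      ψ x * φ y * g x y * Complex.exp (Complex.I * (ω₁ * x + ω₂ * y))‖ ≤ (∫ x, ‖ψ x‖) * K := by
  have hfac : ∀ x : ℝ, ∫ y in Set.Ioi (0 : ℝ),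
      ψ x * φ y * g x y * Complex.exp (Complex.I * (ω₁ * x + ω₂ * y)) =
      ψ x * Complex.exp (Complex.I * ω₁ * x) *
        ∫ y in Set.Ioi (0 : ℝ), φ y * g x y * Complex.exp (Complex.I * ω₂ * y) := by
    intro x
    rw [← integral_const_mul]
    congr 1 with y
    rw [mul_add, Complex.exp_add, mul_assoc Complex.I, mul_assoc Complex.I]
    ring
  have hω : ‖((|ω₂| ^ s : ℝ) : ℂ)‖ = |ω₂| ^ s := by
    rw [Complex.norm_real, Real.norm_of_nonneg (by positivity)]
  simp only [hfac]
  rw [← hω, ← norm_mul, ← integral_const_mul]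
  refine (norm_integral_le_of_norm_le (hψ.norm.mul_const K).integrableOn
    (ae_restrict_of_forall_mem measurableSet_Ioi fun x hx => ?_)).trans ?_
  · rw [norm_mul, norm_mul, norm_mul, hω, norm_exp_ofReal_mul_I_mul, mul_one, mul_left_comm]
    gcongr
    exact h x hx
  · rw [integral_mul_const]
    refine mul_le_mul_of_nonneg_right ?_ hK
    exact setIntegral_le_integral hψ.norm (.of_forall fun _ => norm_nonneg _)

lemma integral_integral_swap_of_separately_continuousOn {ψ φ : ℝ → ℂ} (hψ : Continuous ψ)
    (hψc : HasCompactSupport ψ) (hψs : tsupport ψ ⊆ Set.Ioi 0) (hφ : Continuous φ)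
    (hφc : HasCompactSupport φ) (hφs : tsupport φ ⊆ Set.Ioi 0) {g : ℝ → ℝ → ℂ} {A : ℝ}
    (hg₁ : ∀ y > 0, ContinuousOn (fun x => g x y) (Set.Ioi 0))
    (hg₂ : ∀ x > 0, ContinuousOn (g x) (Set.Ioi 0))
    (hA : ∀ x > 0, ∀ y > 0, ‖g x y‖ ≤ A) (ω₁ ω₂ : ℝ) :
    ∫ x in Set.Ioi (0 : ℝ), ∫ y in Set.Ioi (0 : ℝ),
      ψ x * φ y * g x y * Complex.exp (Complex.I * (ω₁ * x + ω₂ * y)) =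
    ∫ y in Set.Ioi (0 : ℝ), ∫ x in Set.Ioi (0 : ℝ),
      φ y * ψ x * g x y * Complex.exp (Complex.I * (ω₂ * y + ω₁ * x)) := by
  have hψ0 : ∀ x, ¬ 0 < x → ψ x = 0 := fun x hx =>
    image_eq_zero_of_notMem_tsupport fun h => hx (hψs h)
  have hφ0 : ∀ y, ¬ 0 < y → φ y = 0 := fun y hy =>
    image_eq_zero_of_notMem_tsupport fun h => hy (hφs h)
  have hc₁ : ∀ y, Continuous fun x => ψ x * (φ y * g x y) := by
    intro y
    by_cases hy : 0 < y
    · exact (hψ.continuousOn.mul (continuousOn_const.mul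
        (hg₁ y hy))).continuous_of_tsupport_subset isOpen_Ioi (tsupport_mul_subset_left.trans hψs)
    · simpa [hφ0 y hy] using continuous_const
  have hc₂ : ∀ x, Continuous fun y => ψ x * (φ y * g x y) := by
    intro x
    by_cases hx : 0 < x
    · exact continuous_const.mul
        ((hφ.continuousOn.mul (hg₂ x hx)).continuous_of_tsupport_subset isOpen_Ioi
          (tsupport_mul_subset_left.trans hφs))
    · simpa [hψ0 x hx] using continuous_const
  have hmeas : StronglyMeasurable (Function.uncurry fun x y => ψ x * (φ y * g x y)) :=
    stronglyMeasurable_uncurry_of_continuous_of_stronglyMeasurable hc₁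
      fun x => (hc₂ x).stronglyMeasurable
  have hexp : Continuous fun p : ℝ × ℝ => Complex.exp (Complex.I * (ω₁ * p.1 + ω₂ * p.2)) := by
    fun_prop
  have h_int : Integrable (Function.uncurry fun x y : ℝ =>
      ψ x * φ y * g x y * Complex.exp (Complex.I * (ω₁ * x + ω₂ * y)))
      ((volume.restrict (Set.Ioi 0)).prod (volume.restrict (Set.Ioi 0))) := by
    refine Integrable.mono' (g := fun p => ‖ψ p.1‖ * ‖φ p.2‖ * A)
      (((hψ.integrable_of_hasCompactSupport hψc).norm.integrableOn.mul_prod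
        (hφ.integrable_of_hasCompactSupport hφc).norm.integrableOn).mul_const A) ?_
      (.of_forall fun p => ?_)
    · have := (hmeas.mul hexp.stronglyMeasurable).aestronglyMeasurable
        (μ := (volume.restrict (Set.Ioi (0 : ℝ))).prod (volume.restrict (Set.Ioi (0 : ℝ))))
      refine this.congr (.of_forall fun p => ?_)
      simp only [Function.uncurry, Pi.mul_apply]
      ring
    · obtain ⟨x, y⟩ := p
      have he : ‖Complex.exp (Complex.I * (ω₁ * x + ω₂ * y))‖ = 1 := by
        have := Complex.norm_exp_ofReal_mul_I (ω₁ * x + ω₂ * y)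
        rw [← this]
        push_cast
        rw [mul_comm]
      simp only [Function.uncurry, norm_mul, he, mul_one]
      by_cases hx : 0 < x
      · by_cases hy : 0 < y
        · gcongr
          exact hA x hx y hy
        · simp [hφ0 y hy]
      · simp [hψ0 x hx]
  rw [integral_integral_swap h_int]
  congr 1 with y
  congr 1 with x
  rw [mul_comm (ψ x), add_comm]

lemma one_add_add_pow_le {a b : ℝ} (ha : 0 ≤ a) (hb : 0 ≤ b) (s : ℕ) :
    (1 + a + b) ^ s ≤ 3 ^ s * (1 + a ^ s + b ^ s) := by
  have hmax : max 1 (max a b) ^ s ≤ 1 + a ^ s + b ^ s := by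
    have := pow_nonneg ha s
    have := pow_nonneg hb s
    rcases max_choice 1 (max a b) with h | h
    · rw [h, one_pow]
      linarith
    · rw [h]
      rcases max_choice a b with h | h <;> rw [h] <;> linarith
  calc (1 + a + b) ^ s ≤ (3 * max 1 (max a b)) ^ s := by
        gcongr
        have h1 := le_max_left 1 (max a b)
        have h2 := le_max_right 1 (max a b)
        have h3 := le_max_left a b
        have h4 := le_max_right a b
        linarith
    _ ≤ _ := by
      rw [mul_pow]
      gcongr

/-- **Uniform-in-`k` decay of the Fourier coefficients of the dyadic pieces of a bilinear
multiplier satisfying the Marcinkiewicz product condition.** Let `ψ, φ` be `C^s` functions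
with compact supports in `(0,∞)` and let `c ≠ 0`. If `m` admits partial derivatives
`∂^γ m` on `(0,∞)²` for all `γ` with `γ₁ ≤ s`, `γ₂ ≤ s` and
`|∂^γ m(λ)| ≤ A λ₁^{-γ₁} λ₂^{-γ₂}`, then
`|∫∫_{(0,∞)²} ψ(ξ₁) φ(ξ₂) m(2^k ξ₁, 2^k ξ₂) e^{i c (n₁ξ₁+n₂ξ₂)} dξ| ≤ C A (1+|n₁|+|n₂|)^{-s}`
uniformly in `k ∈ ℤ` and `n ∈ ℤ²`. -/
theorem stmt9 (s : ℕ) (c : ℝ) (hc : c ≠ 0) (ψ φ : ℝ → ℂ)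
    (hψ : ContDiff ℝ s ψ) (hψc : HasCompactSupport ψ) (hψs : tsupport ψ ⊆ Set.Ioi 0)
    (hφ : ContDiff ℝ s φ) (hφc : HasCompactSupport φ) (hφs : tsupport φ ⊆ Set.Ioi 0) :
    ∃ C : ℝ, 0 < C ∧
      ∀ (m : ℝ → ℝ → ℂ) (A : ℝ), 0 ≤ A →
        -- existence of the partial derivatives `∂₂^b m` (needed for each `b < s`)
        (∀ b : ℕ, b < s → ∀ x y : ℝ, 0 < x → 0 < y →
          DifferentiableAt ℝ (fun t => mpd 0 b m x t) y) →
        -- existence of the partial derivatives `∂₁^a ∂₂^b m` (for each `a < s`, `b ≤ s`)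
        (∀ a b : ℕ, a < s → b ≤ s → ∀ x y : ℝ, 0 < x → 0 < y →
          DifferentiableAt ℝ (fun t => mpd a b m t y) x) →
        -- the Marcinkiewicz product bound `|∂^γ m(λ)| ≤ A λ₁^{-γ₁} λ₂^{-γ₂}`
        (∀ a b : ℕ, a ≤ s → b ≤ s → ∀ x y : ℝ, 0 < x → 0 < y →
          ‖mpd a b m x y‖ ≤ A * x ^ (-(a : ℝ)) * y ^ (-(b : ℝ))) →
        ∀ (k : ℤ) (n₁ n₂ : ℤ),
          ‖∫ x in Set.Ioi (0 : ℝ), ∫ y in Set.Ioi (0 : ℝ),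
              ψ x * φ y * m ((2 : ℝ) ^ k * x) ((2 : ℝ) ^ k * y) *
                Complex.exp (Complex.I * (c : ℂ) * ((n₁ : ℂ) * (x : ℂ) + (n₂ : ℂ) * (y : ℂ)))‖
            ≤ C * A * ((1 + |(n₁ : ℝ)| + |(n₂ : ℝ)|) ^ s)⁻¹ := by
  obtain ⟨C₀, hC₀, h₀⟩ := exists_pow_mul_norm_setIntegral_le 0
    (hφ.of_le (by norm_cast; omega)) hφc hφs
  obtain ⟨C₁, hC₁, h₁⟩ := exists_pow_mul_norm_setIntegral_le s hψ hψc hψs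
  obtain ⟨C₂, hC₂, h₂⟩ := exists_pow_mul_norm_setIntegral_le s hφ hφc hφs
  have hψi := hψ.continuous.integrable_of_hasCompactSupport (μ := volume) hψc
  have hφi := hφ.continuous.integrable_of_hasCompactSupport (μ := volume) hφc
  set P := ∫ x, ‖ψ x‖
  set Q := ∫ y, ‖φ y‖
  have hP0 : 0 ≤ P := by positivity
  have hQ0 : 0 ≤ Q := by positivity
  have hc0 : 0 < |c| := abs_pos.mpr hc
  refine ⟨3 ^ s * (P * C₀ + (P * C₀ + Q * C₁) / |c| ^ s + P * C₂ / |c| ^ s) + 1, by positivity, ?_⟩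
  intro m A hA hd₂ hd₁ hB k n₁ n₂
  have ht : (0 : ℝ) < 2 ^ k := by positivity
  set t : ℝ := 2 ^ k
  have hd₂' : ∀ x > 0, ∀ b < s, ∀ y > 0, DifferentiableAt ℝ (deriv^[b] (m x)) y := by
    intro x hx b hb y hy
    rw [← mpd_zero_left]
    exact hd₂ b hb x y hx hy
  have hd₁' : ∀ y > 0, ∀ a < s, ∀ x > 0,
      DifferentiableAt ℝ (deriv^[a] (fun x => m x y)) x := by
    intro y hy a ha x hx
    rw [← mpd_zero_right]
    exact hd₁ a 0 ha (by omega) x y hx hy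
  have hB₂ : ∀ x > 0, ∀ b ≤ s, ∀ y > 0, ‖deriv^[b] (m x) y‖ ≤ A * y ^ (-(b : ℝ)) := by
    intro x hx b hb y hy
    rw [← mpd_zero_left]
    simpa using hB 0 b (by omega) hb x y hx hy
  have hB₁ : ∀ y > 0, ∀ a ≤ s, ∀ x > 0,
      ‖deriv^[a] (fun x => m x y) x‖ ≤ A * x ^ (-(a : ℝ)) := by
    intro y hy a ha x hx
    rw [← mpd_zero_right]
    simpa using hB a 0 ha (by omega) x y hx hy
  have hJ : ∀ x y : ℝ, Complex.I * (c : ℂ) * ((n₁ : ℂ) * (x : ℂ) + (n₂ : ℂ) * (y : ℂ)) =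
      Complex.I * (((c * n₁ : ℝ) : ℂ) * x + ((c * n₂ : ℝ) : ℂ) * y) := by
    intro x y
    push_cast
    ring
  simp only [hJ]
  set J := ∫ x in Set.Ioi (0 : ℝ), ∫ y in Set.Ioi (0 : ℝ), ψ x * φ y * m (t * x) (t * y) *
    Complex.exp (Complex.I * (((c * n₁ : ℝ) : ℂ) * x + ((c * n₂ : ℝ) : ℂ) * y)) with hJdef
  have e₀ : ‖J‖ ≤ P * (C₀ * A) := by
    have := pow_mul_norm_integral_integral_le 0 (φ := φ) (g := fun x y => m (t * x) (t * y))
      (ω₁ := c * n₁) (ω₂ := c * n₂) hψi (by positivity : 0 ≤ C₀ * A) fun x hx =>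
        h₀ (m (t * x)) A hA (fun b hb => by omega)
          (fun b hb => hB₂ _ (mul_pos ht hx) b (by omega)) t ht _
    rwa [pow_zero, one_mul] at this
  have e₂ : |c * n₂| ^ s * ‖J‖ ≤ P * (C₂ * A) :=
    pow_mul_norm_integral_integral_le s (g := fun x y => m (t * x) (t * y)) hψi
      (by positivity) fun x hx =>
        h₂ (m (t * x)) A hA (hd₂' _ (mul_pos ht hx)) (hB₂ _ (mul_pos ht hx)) t ht _
  have e₁ : |c * n₁| ^ s * ‖J‖ ≤ P * (C₀ * A) + Q * (C₁ * A) := by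
    rcases Nat.eq_zero_or_pos s with rfl | hs
    · rw [pow_zero, one_mul]
      exact e₀.trans (le_add_of_nonneg_right (by positivity))
    refine le_trans ?_ (le_add_of_nonneg_left (by positivity))
    rw [hJdef, integral_integral_swap_of_separately_continuousOn hψ.continuous hψc hψs
      hφ.continuous hφc hφs (g := fun x y => m (t * x) (t * y)) (A := A)]
    · exact pow_mul_norm_integral_integral_le s (g := fun y x => m (t * x) (t * y)) hφi
        (by positivity) fun y hy =>
          h₁ (fun x => m x (t * y)) A hA (hd₁' _ (mul_pos ht hy)) (hB₁ _ (mul_pos ht hy)) t ht _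
    · intro y hy x hx
      have h : DifferentiableAt ℝ (fun x => m x (t * y)) (t * x) :=
        hd₁' _ (mul_pos ht hy) 0 hs _ (mul_pos ht hx)
      exact (h.continuousAt.comp (f := fun x => t * x) (by fun_prop)).continuousWithinAt
    · intro x hx y hy
      have h : DifferentiableAt ℝ (m (t * x)) (t * y) :=
        hd₂' _ (mul_pos ht hx) 0 hs _ (mul_pos ht hy)
      exact (h.continuousAt.comp (f := fun y => t * y) (by fun_prop)).continuousWithinAt
    · intro x hx y hy
      simpa using hB₂ _ (mul_pos ht hx) 0 (by omega) _ (mul_pos ht hy)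
  rw [← div_eq_mul_inv, le_div_iff₀ (by positivity)]
  rw [abs_mul, mul_pow, mul_assoc, ← le_div_iff₀' (by positivity)] at e₁ e₂
  calc ‖J‖ * (1 + |(n₁ : ℝ)| + |(n₂ : ℝ)|) ^ s
      ≤ ‖J‖ * (3 ^ s * (1 + |(n₁ : ℝ)| ^ s + |(n₂ : ℝ)| ^ s)) := by
        gcongr
        exact one_add_add_pow_le (abs_nonneg _) (abs_nonneg _) s
    _ = 3 ^ s * (‖J‖ + |(n₁ : ℝ)| ^ s * ‖J‖ + |(n₂ : ℝ)| ^ s * ‖J‖) := by ring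
    _ ≤ 3 ^ s * (P * (C₀ * A) + (P * (C₀ * A) + Q * (C₁ * A)) / |c| ^ s + P * (C₂ * A) / |c| ^ s) := by gcongr
    _ = 3 ^ s * (P * C₀ + (P * C₀ + Q * C₁) / |c| ^ s + P * C₂ / |c| ^ s) * A := by ring
    _ ≤ _ := by
      gcongr
      linarith
end

section
/- Let d ≥ 1, set ρ := ⌊d/2⌋ + 1, let 0 < ε < 1, and let ψ : [0,∞) → ℂ be a C^ρ function with supp ψ ⊆ [ε, 1/ε]. For k ∈ ℤ and f ∈ ℓ¹(ℤ^d) define S_k f(n) := ∫_{𝕋^d} ψ(2^{-k} Sin(ξ)) 𝓕f(ξ) e^{−2π i n·ξ} dξ. Then for every 1 < p < ∞ there is a constant C = C(d,p,ψ) such that for all f ∈ ℓ¹(ℤ^d), ‖ ( ∑_{k∈ℤ} |S_k f|² )^{1/2} ‖_{ℓ^p(ℤ^d)} ≤ C ‖f‖_{ℓ^p(ℤ^d)}. -/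
open MeasureTheory Real
open scoped ENNReal NNReal

/-- The function `Sin(ξ) = (4 ∑_j sin²(π ξ_j))^{1/2}` on `ℝ^d`. -/
noncomputable def SinD (d : ℕ) (ξ : Fin d → ℝ) : ℝ :=
  Real.sqrt (4 * ∑ j, Real.sin (Real.pi * ξ j) ^ 2)

/-- The torus `𝕋^d = [-1/2, 1/2]^d`. -/
noncomputable def Td (d : ℕ) : Set (Fin d → ℝ) :=
  Set.univ.pi fun _ => Set.Icc (-(1 : ℝ) / 2) (1 / 2)

/-- The Fourier transform of `f ∈ ℓ¹(ℤ^d)`. -/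
noncomputable def Ftd (d : ℕ) (f : (Fin d → ℤ) → ℂ) (ξ : Fin d → ℝ) : ℂ :=
  ∑' n : Fin d → ℤ,
    f n * Complex.exp (2 * Real.pi * Complex.I * ∑ j, (n j : ℂ) * (ξ j : ℂ))

/-- The `ℓ^p(ℤ^d)` norm, valued in `ℝ≥0∞`. -/
noncomputable def lpN (d : ℕ) (p : ℝ) (f : (Fin d → ℤ) → ℂ) : ℝ≥0∞ :=
  (∑' n : Fin d → ℤ, (‖f n‖₊ : ℝ≥0∞) ^ p) ^ (1 / p)

/-- The Littlewood–Paley piece `S_k f(n) = ∫_{𝕋^d} ψ(2^{-k} Sin ξ) 𝓕f(ξ) e^{-2πi n·ξ} dξ`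
associated with the discrete Laplacian. -/
noncomputable def LPpieceZ (d : ℕ) (ψ : ℝ → ℂ) (k : ℤ) (f : (Fin d → ℤ) → ℂ)
    (n : Fin d → ℤ) : ℂ :=
  ∫ ξ in Td d,
    ψ ((2 : ℝ) ^ (-k) * SinD d ξ) * Ftd d f ξ *
      Complex.exp (-(2 * Real.pi * Complex.I) * ∑ j, (n j : ℂ) * (ξ j : ℂ))

section Cubes

variable {d : ℕ}

/-- The index of the dyadic cube of side `2 ^ j` containing `n`. -/
def dyadicKey (j : ℕ) (n : Fin d → ℤ) : Fin d → ℤ := fun i => n i / 2 ^ j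

/-- The dyadic cube of side `2 ^ j` with index `q`. -/
noncomputable def dyadicCube (j : ℕ) (q : Fin d → ℤ) : Finset (Fin d → ℤ) :=
  Fintype.piFinset fun i => Finset.Ico (2 ^ j * q i) (2 ^ j * q i + 2 ^ j)

/-- The threefold dilate of the dyadic cube of side `2 ^ j` with index `q`. -/
noncomputable def dyadicCubeStar (j : ℕ) (q : Fin d → ℤ) : Finset (Fin d → ℤ) :=
  Fintype.piFinset fun i => Finset.Ico (2 ^ j * q i - 2 ^ j) (2 ^ j * q i + 2 * 2 ^ j)

lemma mem_dyadicCube {j : ℕ} {q n : Fin d → ℤ} : n ∈ dyadicCube j q ↔ dyadicKey j n = q := by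
  simp only [dyadicCube, Fintype.mem_piFinset, Finset.mem_Ico, dyadicKey, funext_iff]
  refine forall_congr' fun i => ?_
  have h2 : (0 : ℤ) < 2 ^ j := by positivity
  rw [Int.ediv_eq_iff_of_pos h2]
  constructor <;> rintro ⟨h, h'⟩ <;> constructor <;> linarith

lemma card_dyadicCube (j : ℕ) (q : Fin d → ℤ) : (dyadicCube j q).card = (2 ^ j) ^ d := by
  have h : ((2 : ℤ) ^ j).toNat = 2 ^ j := by exact_mod_cast Int.toNat_natCast (2 ^ j)
  simp [dyadicCube, Fintype.card_piFinset, h]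

lemma card_dyadicCubeStar (j : ℕ) (q : Fin d → ℤ) :
    (dyadicCubeStar j q).card = 3 ^ d * (2 ^ j) ^ d := by
  have h (i : Fin d) : (Finset.Ico (2 ^ j * q i - 2 ^ j) (2 ^ j * q i + 2 * 2 ^ j)).card
      = 3 * 2 ^ j := by
    rw [Int.card_Ico]
    have : 2 ^ j * q i + 2 * 2 ^ j - (2 ^ j * q i - 2 ^ j) = ((3 * 2 ^ j : ℕ) : ℤ) := by
      push_cast; ring
    rw [this, Int.toNat_natCast]
  simp [dyadicCubeStar, Fintype.card_piFinset, h, mul_pow]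

lemma dyadicKey_zero (n : Fin d → ℤ) : dyadicKey 0 n = n := by
  funext i; simp [dyadicKey]

lemma dyadicKey_dyadicKey (i j : ℕ) (n : Fin d → ℤ) :
    dyadicKey i (dyadicKey j n) = dyadicKey (j + i) n := by
  funext l
  simp [dyadicKey, Int.ediv_ediv_of_nonneg (show (0 : ℤ) ≤ 2 ^ j by positivity), pow_add]

lemma dyadicKey_eq_of_le {i j : ℕ} (hij : i ≤ j) {m n : Fin d → ℤ}
    (h : dyadicKey i m = dyadicKey i n) : dyadicKey j m = dyadicKey j n := by
  obtain ⟨k, rfl⟩ := Nat.exists_eq_add_of_le hij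
  rw [← dyadicKey_dyadicKey, ← dyadicKey_dyadicKey, h]

lemma abs_sub_lt_of_mem_dyadicCube {j : ℕ} {q m n : Fin d → ℤ} (hm : m ∈ dyadicCube j q)
    (hn : n ∈ dyadicCube j q) (i : Fin d) : |m i - n i| < 2 ^ j := by
  simp only [dyadicCube, Fintype.mem_piFinset, Finset.mem_Ico] at hm hn
  have := hm i; have := hn i
  rw [abs_lt]; constructor <;> linarith

lemma exists_lt_abs_sub_of_notMem_dyadicCubeStar {j : ℕ} {q m n : Fin d → ℤ}
    (hm : m ∈ dyadicCube j q) (hn : n ∉ dyadicCubeStar j q) : ∃ i, 2 ^ j < |n i - m i| := by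
  simp only [dyadicCube, dyadicCubeStar, Fintype.mem_piFinset, Finset.mem_Ico, not_forall,
    not_and_or, not_le, not_lt] at hm hn
  obtain ⟨i, hi⟩ := hn
  refine ⟨i, ?_⟩
  have := hm i
  rw [lt_abs]
  rcases hi with hi | hi
  · right; linarith
  · left; linarith

end Cubes

section CalderonZygmund

variable {d : ℕ} {E : Type*} [NormedAddCommGroup E]

/-- The average of `‖f‖` over the dyadic cube of side `2 ^ j` containing `n`. -/
noncomputable def cubeAvg (f : (Fin d → ℤ) →₀ E) (j : ℕ) (n : Fin d → ℤ) : ℝ :=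
  (∑ m ∈ dyadicCube j (dyadicKey j n), ‖f m‖) / (2 ^ j) ^ d

lemma cubeAvg_congr (f : (Fin d → ℤ) →₀ E) {j : ℕ} {m n : Fin d → ℤ}
    (h : dyadicKey j m = dyadicKey j n) : cubeAvg f j m = cubeAvg f j n := by
  simp only [cubeAvg, h]

lemma cubeAvg_zero (f : (Fin d → ℤ) →₀ E) (n : Fin d → ℤ) : cubeAvg f 0 n = ‖f n‖ := by
  have : dyadicCube 0 n = {n} := by
    ext m; simp [mem_dyadicCube, dyadicKey_zero]
  simp [cubeAvg, dyadicKey_zero, this]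

lemma exists_stoppingTime (hd : 1 ≤ d) (f : (Fin d → ℤ) →₀ E) {t : ℝ} (ht : 0 < t) :
    ∃ (J : (Fin d → ℤ) → ℕ) (Ω : Finset (Fin d → ℤ)),
      (∀ n ∈ Ω, t < cubeAvg f (J n) n) ∧ (∀ n ∈ Ω, cubeAvg f (J n + 1) n ≤ t) ∧
      (∀ n ∈ Ω, ∀ m, dyadicKey (J n) m = dyadicKey (J n) n → m ∈ Ω ∧ J m = J n) ∧
      ∀ n ∉ Ω, ‖f n‖ ≤ t := by
  classical
  set s : ℝ := ∑ m ∈ f.support, ‖f m‖ with hs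
  have hsum (j n) : ∑ m ∈ dyadicCube j (dyadicKey j n), ‖f m‖ ≤ s := by
    rw [hs, ← Finset.sum_filter_ne_zero]
    refine Finset.sum_le_sum_of_subset_of_nonneg (fun m hm => ?_) fun _ _ _ => norm_nonneg _
    simpa using (Finset.mem_filter.1 hm).2
  obtain ⟨J₀, hJ₀⟩ := pow_unbounded_of_one_lt (s / t) (one_lt_two : (1 : ℝ) < 2)
  have hlarge (j n) (hj : J₀ ≤ j) : cubeAvg f j n ≤ t := by
    rw [cubeAvg, div_le_iff₀ (by positivity)]
    have h1 : s / t ≤ (2 ^ j) ^ d := by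
      calc s / t ≤ 2 ^ J₀ := hJ₀.le
        _ ≤ 2 ^ j := pow_le_pow_right₀ one_le_two hj
        _ ≤ (2 ^ j) ^ d := le_self_pow₀ (one_le_pow₀ one_le_two) (by omega)
    rw [div_le_iff₀ ht] at h1
    linarith [hsum j n]
  let J (n : Fin d → ℤ) : ℕ := Nat.findGreatest (fun j => t < cubeAvg f j n) J₀
  have hbad {n j} (h : t < cubeAvg f j n) : j ≤ J₀ := by
    by_contra! hc; exact absurd (hlarge j n hc.le) (not_le.2 h)
  have hspec {n} (h : ∃ j, t < cubeAvg f j n) : t < cubeAvg f (J n) n := by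
    obtain ⟨j, hj⟩ := h
    exact Nat.findGreatest_spec (P := fun j => t < cubeAvg f j n) (hbad hj) hj
  have hafter {n j} (h : J n < j) : cubeAvg f j n ≤ t := by
    by_contra! hc
    exact absurd (Nat.le_findGreatest (P := fun j => t < cubeAvg f j n) (hbad hc) hc)
      (not_le.2 h)
  let Ω : Finset (Fin d → ℤ) :=
    (f.support.biUnion fun m => dyadicCube J₀ (dyadicKey J₀ m)).filter
      fun n => ∃ j, t < cubeAvg f j n
  have hΩ {n} : n ∈ Ω ↔ ∃ j, t < cubeAvg f j n := by
    refine ⟨fun h => (Finset.mem_filter.1 h).2, fun h => Finset.mem_filter.2 ⟨?_, h⟩⟩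
    obtain ⟨j, hj⟩ := h
    have hne : ∑ m ∈ dyadicCube j (dyadicKey j n), ‖f m‖ ≠ 0 := by
      intro h0
      rw [cubeAvg, h0, zero_div] at hj
      exact absurd hj (not_lt.2 ht.le)
    obtain ⟨m, hm, hm0⟩ := Finset.exists_ne_zero_of_sum_ne_zero hne
    refine Finset.mem_biUnion.2 ⟨m, by simpa using hm0, ?_⟩
    rw [mem_dyadicCube] at hm ⊢
    exact (dyadicKey_eq_of_le (hbad hj) hm).symm
  refine ⟨J, Ω, fun n hn => hspec (hΩ.1 hn), fun n _ => hafter (Nat.lt_succ_self _), ?_, ?_⟩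
  · intro n hn m hm
    have h1 : t < cubeAvg f (J n) m := by
      rw [cubeAvg_congr f hm]; exact hspec (hΩ.1 hn)
    refine ⟨hΩ.2 ⟨_, h1⟩, le_antisymm ?_ ?_⟩
    · by_contra! hc
      have := hspec (hΩ.1 (hΩ.2 ⟨_, h1⟩))
      rw [cubeAvg_congr f (dyadicKey_eq_of_le hc.le hm)] at this
      exact absurd (hafter hc) (not_le.2 this)
    · exact Nat.le_findGreatest (P := fun j => t < cubeAvg f j m) (hbad h1) h1
  · intro n hn
    by_contra! hc
    exact hn (hΩ.2 ⟨0, by rwa [cubeAvg_zero]⟩)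

/-- The Calderón–Zygmund decomposition of a finitely supported function on `ℤ^d`. -/
theorem exists_calderonZygmund [NormedSpace ℂ E] (hd : 1 ≤ d) (f : (Fin d → ℤ) →₀ E) {t : ℝ}
    (ht : 0 < t) :
    ∃ (g : (Fin d → ℤ) →₀ E) (S : Finset (ℕ × (Fin d → ℤ)))
      (b : ℕ × (Fin d → ℤ) → (Fin d → ℤ) →₀ E),
      f = g + ∑ s ∈ S, b s ∧
      (∀ s ∈ S, ∀ n, b s n ≠ 0 → n ∈ dyadicCube s.1 s.2) ∧
      (∀ s ∈ S, ∑ n ∈ dyadicCube s.1 s.2, b s n = 0) ∧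
      (∀ n, ‖g n‖ₑ ≤ ENNReal.ofReal (2 ^ d * t)) ∧
      ∑' n, ‖g n‖ₑ ≤ ∑' n, ‖f n‖ₑ ∧
      ∑ s ∈ S, ∑' n, ‖b s n‖ₑ ≤ 2 * ∑' n, ‖f n‖ₑ ∧
      ENNReal.ofReal t * ∑ s ∈ S, ((2 ^ s.1) ^ d : ℝ≥0∞) ≤ ∑' n, ‖f n‖ₑ := by
  classical
  obtain ⟨J, Ω, hJ1, hJ2, hJ3, hΩ⟩ := exists_stoppingTime hd f ht
  let Q (s : ℕ × (Fin d → ℤ)) := dyadicCube s.1 s.2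
  let cell (n : Fin d → ℤ) : ℕ × (Fin d → ℤ) := (J n, dyadicKey (J n) n)
  let S := Ω.image cell
  have hQ {s} (hs : s ∈ S) {n} : n ∈ Q s ↔ n ∈ Ω ∧ cell n = s := by
    obtain ⟨m, hm, rfl⟩ := Finset.mem_image.1 hs
    simp only [Q, mem_dyadicCube, cell, Prod.mk.injEq]
    refine ⟨fun h => ?_, fun h => ?_⟩
    · obtain ⟨h1, h2⟩ := hJ3 m hm n h
      exact ⟨h1, h2, by rw [h2, h]⟩
    · rw [h.2.1] at h; exact h.2.2
  let avg (s : ℕ × (Fin d → ℤ)) : E := (((2 ^ s.1) ^ d : ℂ))⁻¹ • ∑ m ∈ Q s, f m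
  let g : (Fin d → ℤ) →₀ E := Finsupp.onFinset (f.support ∪ Ω)
    (fun n => if n ∈ Ω then avg (cell n) else f n) (by
      intro n hn
      by_cases h : n ∈ Ω
      · simp [h]
      · simp only [h, if_false] at hn; simp [hn])
  have hg1 {n} (h : n ∈ Ω) : g n = avg (cell n) := by simp [g, h]
  have hg2 {n} (h : n ∉ Ω) : g n = f n := by simp [g, h]
  let b (s : ℕ × (Fin d → ℤ)) : (Fin d → ℤ) →₀ E := (f - g).filter (· ∈ Q s)
  have hb1 {s n} (h : n ∈ Q s) : b s n = f n - g n := by simp [b, h]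
  have hb2 {s n} (h : n ∉ Q s) : b s n = 0 := by simp [b, h]
  have hcellS {n} (h : n ∈ Ω) : cell n ∈ S := Finset.mem_image_of_mem _ h
  have havg {s} (hs : s ∈ S) {n} (hn : n ∈ Q s) : g n = avg s := by
    obtain ⟨h1, h2⟩ := (hQ hs).1 hn
    rw [hg1 h1, h2]
  have hcard (s) : (Q s).card = (2 ^ s.1) ^ d := card_dyadicCube _ _
  have hfib (u : (Fin d → ℤ) → ℝ≥0∞) : ∑ s ∈ S, ∑ n ∈ Q s, u n = ∑ n ∈ Ω, u n := by
    rw [← Finset.sum_fiberwise_of_maps_to (g := cell) (t := S) fun n hn => hcellS hn]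
    refine Finset.sum_congr rfl fun s hs => Finset.sum_congr ?_ fun _ _ => rfl
    ext n
    rw [hQ hs, Finset.mem_filter]
  have hsumavg {s} (hs : s ∈ S) : ∑ n ∈ Q s, g n = ∑ n ∈ Q s, f n := by
    rw [Finset.sum_congr rfl fun n hn => havg hs hn, Finset.sum_const, hcard]
    simp only [avg]
    rw [← Nat.cast_smul_eq_nsmul ℂ, smul_smul]
    push_cast
    rw [mul_inv_cancel₀ (by simp), one_smul]
  have hgQ {s} (hs : s ∈ S) : ∑ n ∈ Q s, ‖g n‖ₑ ≤ ∑ n ∈ Q s, ‖f n‖ₑ := by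
    have : ∑ n ∈ Q s, ‖g n‖ₑ = ‖∑ n ∈ Q s, g n‖ₑ := by
      have h1 : ∑ n ∈ Q s, ‖g n‖ₑ = (Q s).card • ‖avg s‖ₑ :=
        Finset.sum_eq_card_nsmul fun n hn => by rw [havg hs hn]
      have h2 : ∑ n ∈ Q s, g n = (Q s).card • avg s :=
        Finset.sum_eq_card_nsmul fun n hn => havg hs hn
      rw [h1, h2, ← Nat.cast_smul_eq_nsmul ℂ _ (avg s), nsmul_eq_mul,
        enorm_smul ((Q s).card : ℂ) (avg s)]
      congr 1
      rw [← ofReal_norm]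
      simp
    rw [this, hsumavg hs]
    exact enorm_sum_le _ _
  have hΩtsum : ∑ n ∈ Ω, ‖g n‖ₑ ≤ ∑ n ∈ Ω, ‖f n‖ₑ := by
    rw [← hfib, ← hfib]
    exact Finset.sum_le_sum fun s hs => hgQ hs
  refine ⟨g, S, b, ?_, ?_, ?_, ?_, ?_, ?_, ?_⟩
  · ext n
    rw [Finsupp.add_apply, Finsupp.finsetSum_apply]
    by_cases h : n ∈ Ω
    · rw [Finset.sum_eq_single (cell n)]
      · rw [hb1 ((hQ (hcellS h)).2 ⟨h, rfl⟩)]; abel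
      · intro s hs hne
        exact hb2 fun hn => hne ((hQ hs).1 hn).2.symm
      · intro hn; exact absurd (hcellS h) hn
    · rw [Finset.sum_eq_zero, hg2 h, add_zero]
      intro s hs
      exact hb2 fun hn => h ((hQ hs).1 hn).1
  · intro s hs n hn
    by_contra h
    exact hn (hb2 h)
  · intro s hs
    rw [Finset.sum_congr rfl fun n hn => hb1 (s := s) hn, Finset.sum_sub_distrib]
    exact sub_eq_zero.2 (hsumavg hs).symm
  · intro n
    rw [← ofReal_norm]
    refine ENNReal.ofReal_le_ofReal ?_
    by_cases h : n ∈ Ω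
    · have h2 := hJ2 n h
      rw [cubeAvg, div_le_iff₀ (by positivity)] at h2
      rw [hg1 h]
      simp only [avg, norm_smul, norm_inv, norm_pow, Complex.norm_ofNat]
      rw [inv_mul_le_iff₀ (by positivity)]
      calc ‖∑ m ∈ Q (cell n), f m‖ ≤ ∑ m ∈ Q (cell n), ‖f m‖ := norm_sum_le _ _
        _ ≤ ∑ m ∈ dyadicCube (J n + 1) (dyadicKey (J n + 1) n), ‖f m‖ := by
            refine Finset.sum_le_sum_of_subset_of_nonneg (fun m hm => ?_)
              fun _ _ _ => norm_nonneg _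
            simp only [Q, cell, mem_dyadicCube] at hm ⊢
            exact dyadicKey_eq_of_le (Nat.le_succ _) hm
        _ ≤ t * (2 ^ (J n + 1)) ^ d := h2
        _ = (2 ^ (cell n).1) ^ d * (2 ^ d * t) := by
            simp only [cell, pow_succ, mul_pow]; ring
    · rw [hg2 h]
      exact (hΩ n h).trans (le_mul_of_one_le_left ht.le (one_le_pow₀ one_le_two))
  · rw [tsum_eq_sum (s := f.support ∪ Ω), tsum_eq_sum (s := f.support ∪ Ω),
      ← Finset.sdiff_union_of_subset (Finset.subset_union_right (s₁ := f.support) (s₂ := Ω)),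
      Finset.sum_union Finset.sdiff_disjoint, Finset.sum_union Finset.sdiff_disjoint]
    · refine add_le_add (Finset.sum_le_sum fun n hn => ?_) hΩtsum
      rw [hg2 (Finset.mem_sdiff.1 hn).2]
    · intro n hn
      simp only [Finset.mem_union, not_or, Finsupp.mem_support_iff, not_not] at hn
      simp [hn.1]
    · intro n hn
      simp only [Finset.mem_union, not_or, Finsupp.mem_support_iff, not_not] at hn
      simp [hg2 hn.2, hn.1]
  · calc ∑ s ∈ S, ∑' n, ‖b s n‖ₑ ≤ ∑ s ∈ S, ∑ n ∈ Q s, (‖f n‖ₑ + ‖g n‖ₑ) := by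
          refine Finset.sum_le_sum fun s _ => ?_
          rw [tsum_eq_sum (s := Q s)]
          · refine Finset.sum_le_sum fun n hn => ?_
            rw [hb1 hn]; exact enorm_sub_le
          · intro n hn; rw [hb2 hn, enorm_zero]
      _ = ∑ n ∈ Ω, ‖f n‖ₑ + ∑ n ∈ Ω, ‖g n‖ₑ := by rw [hfib, Finset.sum_add_distrib]
      _ ≤ ∑ n ∈ Ω, ‖f n‖ₑ + ∑ n ∈ Ω, ‖f n‖ₑ := by gcongr
      _ = 2 * ∑ n ∈ Ω, ‖f n‖ₑ := (two_mul _).symm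
      _ ≤ 2 * ∑' n, ‖f n‖ₑ := by gcongr; exact ENNReal.sum_le_tsum _
  · rw [Finset.mul_sum]
    refine le_trans ?_ (ENNReal.sum_le_tsum Ω)
    rw [← hfib]
    refine Finset.sum_le_sum fun s hs => ?_
    obtain ⟨n, hn, rfl⟩ := Finset.mem_image.1 hs
    have h1 := hJ1 n hn
    rw [cubeAvg, lt_div_iff₀ (by positivity)] at h1
    have h2 : ∑ m ∈ Q (cell n), ‖f m‖ₑ = ENNReal.ofReal (∑ m ∈ Q (cell n), ‖f m‖) := by
      rw [ENNReal.ofReal_sum_of_nonneg fun _ _ => norm_nonneg _]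
      simp
    rw [h2]
    have h3 : ((2 ^ (cell n).1) ^ d : ℝ≥0∞) = ENNReal.ofReal ((2 ^ (cell n).1) ^ d) := by
      rw [ENNReal.ofReal_pow (by positivity), ENNReal.ofReal_pow (by positivity)]; simp
    rw [h3, ← ENNReal.ofReal_mul ht.le]
    exact ENNReal.ofReal_le_ofReal h1.le

end CalderonZygmund

section WeakType

lemma sq_mul_count_le {ι F : Type*} [MeasurableSpace ι] [DiscreteMeasurableSpace ι]
    [NormedAddCommGroup F] (u : ι → F) (τ : ℝ≥0∞) :
    τ ^ 2 * Measure.count {n | τ ≤ ‖u n‖ₑ} ≤ ∑' n, ‖u n‖ₑ ^ 2 := by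
  rw [← lintegral_count]
  refine le_trans (mul_le_mul_right (measure_mono fun n (hn : τ ≤ _) => ?_) _)
    (mul_meas_ge_le_lintegral (μ := Measure.count) Measurable.of_discrete (τ ^ 2))
  exact pow_le_pow_left' hn 2

variable {d : ℕ} {E F : Type*} [NormedAddCommGroup E] [NormedSpace ℂ E] [NormedAddCommGroup F]
  [NormedSpace ℂ F]

/-- Calderón–Zygmund theory: an `ℓ²` bounded operator which is well localised on mean-zero functions
supported in dyadic cubes is of weak type `(1, 1)`. -/
theorem weakType_one (hd : 1 ≤ d) (T : ((Fin d → ℤ) →₀ E) →ₗ[ℂ] ((Fin d → ℤ) → F)) (A B : ℝ≥0∞)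
    (hL2 : ∀ f, ∑' n, ‖T f n‖ₑ ^ 2 ≤ B * ∑' n, ‖f n‖ₑ ^ 2)
    (hH : ∀ (j : ℕ) (q : Fin d → ℤ) (b : (Fin d → ℤ) →₀ E),
      (∀ n, b n ≠ 0 → n ∈ dyadicCube j q) → ∑ n ∈ dyadicCube j q, b n = 0 →
      ∑' n, (if n ∈ dyadicCubeStar j q then 0 else ‖T b n‖ₑ) ≤ A * ∑' n, ‖b n‖ₑ)
    (f : (Fin d → ℤ) →₀ E) {t : ℝ} (ht : 0 < t) :
    ENNReal.ofReal t * Measure.count {n | ENNReal.ofReal t ≤ ‖T f n‖ₑ} ≤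
      (4 * B * 2 ^ d + 3 ^ d + 4 * A) * ∑' n, ‖f n‖ₑ := by
  classical
  obtain ⟨g, S, b, hf, hbQ, hb0, hg, hg1, hb1, hS⟩ := exists_calderonZygmund hd f ht
  set N := ∑' n, ‖f n‖ₑ
  set τ := ENNReal.ofReal t with hτ
  have hτ0 : τ ≠ 0 := by simpa [hτ] using ht
  have hτt : τ ≠ ∞ := ENNReal.ofReal_ne_top
  have hττ : τ = 2 * (τ / 2) := (ENNReal.mul_div_cancel two_ne_zero ENNReal.ofNat_ne_top).symm
  let U : Finset (Fin d → ℤ) := S.biUnion fun s => dyadicCubeStar s.1 s.2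
  let h (n : Fin d → ℤ) : ℝ≥0∞ := if n ∈ U then 0 else ∑ s ∈ S, ‖T (b s) n‖ₑ
  have hsub : {n | τ ≤ ‖T f n‖ₑ} ⊆ ({n | τ / 2 ≤ ‖T g n‖ₑ} ∪ U) ∪ {n | τ / 2 ≤ h n} := by
    intro n hn
    by_contra hc
    simp only [Set.mem_union, Set.mem_ofPred_eq, not_or, not_le, Finset.mem_coe] at hc hn
    obtain ⟨⟨h1, h2⟩, h3⟩ := hc
    simp only [h, h2, if_false] at h3
    refine absurd hn (not_le.2 ?_)
    calc ‖T f n‖ₑ = ‖T g n + ∑ s ∈ S, T (b s) n‖ₑ := by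
          rw [hf, map_add, map_sum]; simp
      _ ≤ ‖T g n‖ₑ + ∑ s ∈ S, ‖T (b s) n‖ₑ :=
          (enorm_add_le _ _).trans (by gcongr; exact enorm_sum_le _ _)
      _ < τ / 2 + τ / 2 := ENNReal.add_lt_add h1 h3
      _ = τ := ENNReal.add_halves τ
  have key1 : τ * Measure.count {n | τ / 2 ≤ ‖T g n‖ₑ} ≤ 4 * B * 2 ^ d * N := by
    have e1 := sq_mul_count_le (T g) (τ / 2)
    have e2 : ∑' n, ‖g n‖ₑ ^ 2 ≤ 2 ^ d * τ * N := by
      calc ∑' n, ‖g n‖ₑ ^ 2 ≤ ∑' n, 2 ^ d * τ * ‖g n‖ₑ := by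
            refine ENNReal.tsum_le_tsum fun n => ?_
            rw [sq]
            gcongr
            refine (hg n).trans (le_of_eq ?_)
            rw [ENNReal.ofReal_mul (by positivity), ENNReal.ofReal_pow (by positivity)]
            simp [hτ]
        _ = 2 ^ d * τ * ∑' n, ‖g n‖ₑ := ENNReal.tsum_mul_left
        _ ≤ _ := by gcongr
    have e3 : τ * (τ * Measure.count {n | τ / 2 ≤ ‖T g n‖ₑ}) ≤ τ * (4 * B * 2 ^ d * N) := by
      calc τ * (τ * Measure.count {n | τ / 2 ≤ ‖T g n‖ₑ})
          = 4 * ((τ / 2) ^ 2 * Measure.count {n | τ / 2 ≤ ‖T g n‖ₑ}) := by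
            nth_rewrite 1 [hττ]; nth_rewrite 2 [hττ]; ring
        _ ≤ 4 * (B * (2 ^ d * τ * N)) := by
            exact mul_le_mul_right (e1.trans ((hL2 g).trans (mul_le_mul_right e2 _))) _
        _ = _ := by ring
    exact (ENNReal.mul_le_mul_iff_right hτ0 hτt).1 e3
  have key2 : τ * Measure.count (U : Set (Fin d → ℤ)) ≤ 3 ^ d * N := by
    calc τ * Measure.count (U : Set (Fin d → ℤ))
        ≤ τ * ∑ s ∈ S, (3 ^ d * (2 ^ s.1) ^ d : ℝ≥0∞) := by
          gcongr
          rw [Measure.count_apply_finset]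
          have : U.card ≤ ∑ s ∈ S, 3 ^ d * (2 ^ s.1) ^ d := by
            refine Finset.card_biUnion_le.trans (Finset.sum_le_sum fun s _ => ?_)
            rw [card_dyadicCubeStar]
          exact_mod_cast this
      _ = 3 ^ d * (τ * ∑ s ∈ S, ((2 ^ s.1) ^ d : ℝ≥0∞)) := by
          rw [← Finset.mul_sum]; ring
      _ ≤ _ := by gcongr
  have key3 : τ * Measure.count {n | τ / 2 ≤ h n} ≤ 4 * A * N := by
    have e1 : τ / 2 * Measure.count {n | τ / 2 ≤ h n} ≤ A * (2 * N) := by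
      calc τ / 2 * Measure.count {n | τ / 2 ≤ h n} ≤ ∑' n, h n := by
            rw [← lintegral_count]
            exact mul_meas_ge_le_lintegral Measurable.of_discrete _
        _ ≤ ∑' n, ∑ s ∈ S, (if n ∈ dyadicCubeStar s.1 s.2 then 0 else ‖T (b s) n‖ₑ) := by
            refine ENNReal.tsum_le_tsum fun n => ?_
            by_cases hn : n ∈ U
            · simp [h, hn]
            · simp only [h, hn, if_false]
              refine Finset.sum_le_sum fun s hs => ?_
              rw [if_neg fun hc => hn (Finset.mem_biUnion.2 ⟨s, hs, hc⟩)]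
        _ = ∑ s ∈ S, ∑' n, (if n ∈ dyadicCubeStar s.1 s.2 then 0 else ‖T (b s) n‖ₑ) :=
            Summable.tsum_finsetSum fun _ _ => ENNReal.summable
        _ ≤ ∑ s ∈ S, A * ∑' n, ‖b s n‖ₑ :=
            Finset.sum_le_sum fun s hs => hH _ _ _ (hbQ s hs) (hb0 s hs)
        _ = A * ∑ s ∈ S, ∑' n, ‖b s n‖ₑ := by rw [Finset.mul_sum]
        _ ≤ A * (2 * N) := by gcongr
    calc τ * Measure.count {n | τ / 2 ≤ h n} = 2 * (τ / 2 * Measure.count {n | τ / 2 ≤ h n}) := by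
          nth_rewrite 1 [hττ]; ring
      _ ≤ 2 * (A * (2 * N)) := by gcongr
      _ = _ := by ring
  calc τ * Measure.count {n | τ ≤ ‖T f n‖ₑ}
      ≤ τ * (Measure.count {n | τ / 2 ≤ ‖T g n‖ₑ} + Measure.count (U : Set (Fin d → ℤ)) +
          Measure.count {n | τ / 2 ≤ h n}) := by
        gcongr
        exact (measure_mono hsub).trans ((measure_union_le _ _).trans
          (by gcongr; exact measure_union_le _ _))
    _ ≤ 4 * B * 2 ^ d * N + 3 ^ d * N + 4 * A * N := by
        rw [mul_add, mul_add]; gcongr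
    _ = _ := by ring

end WeakType

section Interpolation

lemma lintegral_rpow_Iio {p : ℝ} (hp : 1 < p) {a : ℝ} (ha : 0 ≤ a) :
    ∫⁻ t in Set.Ioi (0 : ℝ), (if t < a then ENNReal.ofReal (t ^ (p - 2)) else 0) =
      ENNReal.ofReal (a ^ (p - 1) / (p - 1)) := by
  have h1 : (fun t : ℝ => if t < a then ENNReal.ofReal (t ^ (p - 2)) else 0) =
      (Set.Iio a).indicator fun t => ENNReal.ofReal (t ^ (p - 2)) := by
    ext t; simp [Set.indicator_apply]
  rw [h1, lintegral_indicator measurableSet_Iio, Measure.restrict_restrict measurableSet_Iio,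
    Set.inter_comm, Set.Ioi_inter_Iio, restrict_Ioo_eq_restrict_Ioc,
    ← ofReal_integral_eq_lintegral_ofReal]
  · rw [← intervalIntegral.integral_of_le ha, integral_rpow (Or.inl (by linarith)),
      show p - 2 + 1 = p - 1 by ring, zero_rpow (by linarith), sub_zero]
  · exact (intervalIntegrable_iff_integrableOn_Ioc_of_le ha).1
      (intervalIntegral.intervalIntegrable_rpow' (by linarith))
  · filter_upwards [ae_restrict_mem measurableSet_Ioc] with t ht
    exact rpow_nonneg ht.1.le _

lemma lintegral_rpow_Ici {p : ℝ} (hp : p < 2) {a : ℝ} (ha : 0 < a) :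
    ∫⁻ t in Set.Ioi (0 : ℝ), (if a ≤ t then ENNReal.ofReal (t ^ (p - 3)) else 0) =
      ENNReal.ofReal (a ^ (p - 2) / (2 - p)) := by
  have h1 : (fun t : ℝ => if a ≤ t then ENNReal.ofReal (t ^ (p - 3)) else 0) =
      (Set.Ici a).indicator fun t => ENNReal.ofReal (t ^ (p - 3)) := by
    ext t; simp [Set.indicator_apply]
  have h2 : Set.Ici a ∩ Set.Ioi 0 = Set.Ici a :=
    Set.inter_eq_left.2 fun t ht => lt_of_lt_of_le ha ht
  rw [h1, lintegral_indicator measurableSet_Ici, Measure.restrict_restrict measurableSet_Ici,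
    h2, ← restrict_Ioi_eq_restrict_Ici, ← ofReal_integral_eq_lintegral_ofReal]
  · rw [integral_Ioi_rpow_of_lt (by linarith) ha, show p - 3 + 1 = p - 2 by ring,
      ← neg_sub p 2, div_neg, neg_div]
  · exact integrableOn_Ioi_rpow_of_lt (by linarith) ha
  · filter_upwards [ae_restrict_mem measurableSet_Ioi] with t ht
    exact rpow_nonneg (ha.le.trans (le_of_lt ht)) _

variable {ι E F : Type*} [Countable ι] [MeasurableSpace ι]
  [DiscreteMeasurableSpace ι] [NormedAddCommGroup E] [NormedSpace ℂ E]
  [NormedAddCommGroup F] [NormedSpace ℂ F]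

/-- Marcinkiewicz interpolation between weak type `(1, 1)` and strong type `(2, 2)`, for operators
on finitely supported functions. -/
theorem strongType_of_weakType (T : (ι →₀ E) →ₗ[ℂ] (ι → F)) (A B : ℝ≥0∞)
    (hL2 : ∀ f, ∑' n, ‖T f n‖ₑ ^ 2 ≤ B * ∑' n, ‖f n‖ₑ ^ 2)
    (hA : ∀ f : ι →₀ E, ∀ t : ℝ, 0 < t →
      ENNReal.ofReal t * Measure.count {n | ENNReal.ofReal t ≤ ‖T f n‖ₑ} ≤
        A * ∑' n, ‖f n‖ₑ)
    {p : ℝ} (hp1 : 1 < p) (hp2 : p < 2) (f : ι →₀ E) :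
    ∑' n, ‖T f n‖ₑ ^ p ≤ ENNReal.ofReal p * (2 * A * ENNReal.ofReal (1 / (p - 1)) +
      4 * B * ENNReal.ofReal (1 / (2 - p))) * ∑' n, ‖f n‖ₑ ^ p := by
  classical
  have hkey (t : ℝ) (ht : 0 < t) :
      Measure.count {n | t ≤ ‖T f n‖} * ENNReal.ofReal (t ^ (p - 1)) ≤
        2 * A * ∑' n, ‖f n‖ₑ * (if t < ‖f n‖ then ENNReal.ofReal (t ^ (p - 2)) else 0) +
        4 * B * ∑' n, ‖f n‖ₑ ^ 2 * (if ‖f n‖ ≤ t then ENNReal.ofReal (t ^ (p - 3)) else 0) := by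
    let f₁ := f.filter fun n => t < ‖f n‖
    let f₂ := f.filter fun n => ¬ t < ‖f n‖
    have hf : f = f₁ + f₂ := (Finsupp.filter_add_filter_not f _).symm
    set τ := ENNReal.ofReal (t / 2) with hτ
    have hsub : {n | t ≤ ‖T f n‖} ⊆ {n | τ ≤ ‖T f₁ n‖ₑ} ∪ {n | τ ≤ ‖T f₂ n‖ₑ} := by
      intro n (hn : t ≤ ‖T f n‖)
      by_contra hc
      simp only [Set.mem_union, Set.mem_ofPred_eq, not_or, not_le, hτ, ← ofReal_norm,
        ENNReal.ofReal_lt_ofReal_iff (half_pos ht)] at hc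
      have : ‖T f n‖ ≤ ‖T f₁ n‖ + ‖T f₂ n‖ := by
        rw [hf, map_add]; exact norm_add_le _ _
      linarith [hc.1, hc.2]
    have e1 : τ * Measure.count {n | τ ≤ ‖T f₁ n‖ₑ} ≤ A * ∑' n, ‖f₁ n‖ₑ :=
      hA f₁ (t / 2) (half_pos ht)
    have e2 : τ ^ 2 * Measure.count {n | τ ≤ ‖T f₂ n‖ₑ} ≤ B * ∑' n, ‖f₂ n‖ₑ ^ 2 :=
      (sq_mul_count_le _ _).trans (hL2 f₂)
    have p1 : ENNReal.ofReal (t ^ (p - 1)) = 2 * τ * ENNReal.ofReal (t ^ (p - 2)) := by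
      rw [hτ, ← ENNReal.ofReal_ofNat 2, ← ENNReal.ofReal_mul (by positivity),
        ← ENNReal.ofReal_mul (by positivity)]
      congr 1
      rw [show p - 1 = p - 2 + 1 by ring, rpow_add_one ht.ne']; ring
    have p2 : ENNReal.ofReal (t ^ (p - 1)) = 4 * τ ^ 2 * ENNReal.ofReal (t ^ (p - 3)) := by
      rw [hτ, ← ENNReal.ofReal_ofNat 4, ← ENNReal.ofReal_pow (by positivity),
        ← ENNReal.ofReal_mul (by positivity), ← ENNReal.ofReal_mul (by positivity)]
      congr 1
      rw [show p - 1 = p - 3 + 2 by ring, rpow_add ht, rpow_ofNat]; ring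
    have s1 : (∑' n, ‖f₁ n‖ₑ) * ENNReal.ofReal (t ^ (p - 2)) =
        ∑' n, ‖f n‖ₑ * (if t < ‖f n‖ then ENNReal.ofReal (t ^ (p - 2)) else 0) := by
      rw [← ENNReal.tsum_mul_right]
      refine tsum_congr fun n => ?_
      by_cases h : t < ‖f n‖ <;> simp [f₁, h]
    have s2 : (∑' n, ‖f₂ n‖ₑ ^ 2) * ENNReal.ofReal (t ^ (p - 3)) =
        ∑' n, ‖f n‖ₑ ^ 2 * (if ‖f n‖ ≤ t then ENNReal.ofReal (t ^ (p - 3)) else 0) := by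
      rw [← ENNReal.tsum_mul_right]
      refine tsum_congr fun n => ?_
      by_cases h : ‖f n‖ ≤ t
      · simp [f₂, h]
      · simp [f₂, h]
    calc Measure.count {n | t ≤ ‖T f n‖} * ENNReal.ofReal (t ^ (p - 1))
        ≤ (Measure.count {n | τ ≤ ‖T f₁ n‖ₑ} + Measure.count {n | τ ≤ ‖T f₂ n‖ₑ}) *
            ENNReal.ofReal (t ^ (p - 1)) :=
          mul_le_mul_left ((measure_mono hsub).trans (measure_union_le _ _)) _
      _ = 2 * ((τ * Measure.count {n | τ ≤ ‖T f₁ n‖ₑ}) * ENNReal.ofReal (t ^ (p - 2))) +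
          4 * ((τ ^ 2 * Measure.count {n | τ ≤ ‖T f₂ n‖ₑ}) * ENNReal.ofReal (t ^ (p - 3))) := by
          rw [add_mul]; nth_rewrite 1 [p1]; rw [p2]; ring
      _ ≤ 2 * ((A * ∑' n, ‖f₁ n‖ₑ) * ENNReal.ofReal (t ^ (p - 2))) +
          4 * ((B * ∑' n, ‖f₂ n‖ₑ ^ 2) * ENNReal.ofReal (t ^ (p - 3))) := by gcongr
      _ = _ := by rw [← s1, ← s2]; ring
  have hp0 : 0 < p := by linarith
  calc ∑' n, ‖T f n‖ₑ ^ p = ∫⁻ n, ENNReal.ofReal (‖T f n‖ ^ p) ∂Measure.count := by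
        rw [lintegral_count]
        refine tsum_congr fun n => ?_
        rw [← ENNReal.ofReal_rpow_of_nonneg (norm_nonneg _) hp0.le, ofReal_norm]
    _ = ENNReal.ofReal p * ∫⁻ t in Set.Ioi 0,
          Measure.count {n | t ≤ ‖T f n‖} * ENNReal.ofReal (t ^ (p - 1)) :=
        lintegral_rpow_eq_lintegral_meas_le_mul _
          (Filter.Eventually.of_forall fun _ => norm_nonneg _)
          Measurable.of_discrete.aemeasurable hp0
    _ ≤ ENNReal.ofReal p * ∫⁻ t in Set.Ioi 0,
        (2 * A * ∑' n, ‖f n‖ₑ * (if t < ‖f n‖ then ENNReal.ofReal (t ^ (p - 2)) else 0) +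
        4 * B * ∑' n, ‖f n‖ₑ ^ 2 * (if ‖f n‖ ≤ t then ENNReal.ofReal (t ^ (p - 3)) else 0)) := by
        exact mul_le_mul_right (setLIntegral_mono' measurableSet_Ioi fun t ht => hkey t ht) _
    _ = ENNReal.ofReal p * (2 * A * ∑' n, ‖f n‖ₑ * ENNReal.ofReal (‖f n‖ ^ (p - 1) / (p - 1)) +
        4 * B * ∑' n, ‖f n‖ₑ ^ 2 * ∫⁻ t in Set.Ioi (0 : ℝ),
          (if ‖f n‖ ≤ t then ENNReal.ofReal (t ^ (p - 3)) else 0)) := by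
        have m1 (n : ι) : Measurable fun t : ℝ => 
            if t < ‖f n‖ then ENNReal.ofReal (t ^ (p - 2)) else 0 :=
          Measurable.ite measurableSet_Iio (by fun_prop) measurable_const
        have m2 (n : ι) : Measurable fun t : ℝ => 
            if ‖f n‖ ≤ t then ENNReal.ofReal (t ^ (p - 3)) else 0 :=
          Measurable.ite measurableSet_Ici (by fun_prop) measurable_const
        rw [lintegral_add_left, lintegral_const_mul, lintegral_const_mul, lintegral_tsum,
          lintegral_tsum]
        · congr 4
          · funext n
            rw [lintegral_const_mul _ (m1 n), lintegral_rpow_Iio hp1 (norm_nonneg _)]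
          · funext n
            rw [lintegral_const_mul _ (m2 n)]
        · exact fun n => ((m2 n).const_mul _).aemeasurable
        · exact fun n => ((m1 n).const_mul _).aemeasurable
        · exact Measurable.tsum fun n => (m2 n).const_mul _
        · exact Measurable.tsum fun n => (m1 n).const_mul _
        · exact (Measurable.tsum fun n => (m1 n).const_mul _).const_mul _
    _ = ENNReal.ofReal p * (2 * A * ∑' n, ENNReal.ofReal (1 / (p - 1)) * ‖f n‖ₑ ^ p +
        4 * B * ∑' n, ENNReal.ofReal (1 / (2 - p)) * ‖f n‖ₑ ^ p) := by
        congr 4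
        · funext n
          rw [← ofReal_norm, ENNReal.ofReal_rpow_of_nonneg (norm_nonneg _) hp0.le,
            ← ENNReal.ofReal_mul (norm_nonneg _), ← ENNReal.ofReal_mul (by simp; linarith)]
          congr 1
          rcases (norm_nonneg (f n)).eq_or_lt with h | h
          · rw [← h, zero_rpow hp0.ne']; simp
          · rw [rpow_sub_one h.ne']; field_simp
        · funext n
          rcases (norm_nonneg (f n)).eq_or_lt with h | h
          · rw [← ofReal_norm, ← h]; simp [hp0]
          · rw [lintegral_rpow_Ici hp2 h, ← ofReal_norm,
              ENNReal.ofReal_rpow_of_nonneg (norm_nonneg _) hp0.le,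
              ← ENNReal.ofReal_pow (norm_nonneg _),
              ← ENNReal.ofReal_mul (by positivity), ← ENNReal.ofReal_mul (by simp; linarith)]
            congr 1
            rw [rpow_sub h, rpow_ofNat]; field_simp
    _ = _ := by
        rw [ENNReal.tsum_mul_left, ENNReal.tsum_mul_left]; ring

end Interpolation

section Duality

variable {ι E F : Type*} [NormedAddCommGroup E] [InnerProductSpace ℂ E]
  [NormedAddCommGroup F] [InnerProductSpace ℂ F]

/-- If the formal adjoint `T'` of `T` is bounded on `ℓ^p`, then `T` is bounded on `ℓ^q`, where `q`
is the dual exponent. -/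
theorem strongType_of_adjoint (T : (ι →₀ E) → ι → F) (T' : (ι →₀ F) → ι → E)
    (hT : ∀ f g, ∑ n ∈ g.support, inner ℂ (g n) (T f n) = ∑ m ∈ f.support, inner ℂ (T' g m) (f m))
    {p q : ℝ} (hpq : p.HolderConjugate q) (C : ℝ≥0∞)
    (h : ∀ g : ι →₀ F, ∑' m, ‖T' g m‖ₑ ^ p ≤ C * ∑' n, ‖g n‖ₑ ^ p) (f : ι →₀ E) :
    ∑' n, ‖T f n‖ₑ ^ q ≤ C ^ (q - 1) * ∑' n, ‖f n‖ₑ ^ q := by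
  classical
  have hq0 : 0 < q := hpq.symm.pos
  have hp0 : 0 < p := hpq.pos
  rw [ENNReal.tsum_eq_iSup_sum]
  refine iSup_le fun N => ?_
  set X := ∑ n ∈ N, ‖T f n‖ₑ ^ q with hX
  set Y := ∑' n, ‖f n‖ₑ ^ q with hY
  have hXtop : X ≠ ∞ := by
    rw [hX]
    exact ENNReal.sum_ne_top.2 fun n _ => ENNReal.rpow_ne_top_of_nonneg hq0.le enorm_ne_top
  let g : ι →₀ F := Finsupp.onFinset N
    (fun n => if n ∈ N then ((‖T f n‖ ^ (q - 2) : ℝ) : ℂ) • T f n else 0) (by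
      intro n hn; by_contra hc; simp [hc] at hn)
  have hg {n} (hn : n ∈ N) : g n = ((‖T f n‖ ^ (q - 2) : ℝ) : ℂ) • T f n := by simp [g, hn]
  have hg0 {n} (hn : n ∉ N) : g n = 0 := by simp [g, hn]
  have hgnorm {n} (hn : n ∈ N) : ‖g n‖ₑ ^ p = ‖T f n‖ₑ ^ q := by
    rw [hg hn, ← ofReal_norm, ← ofReal_norm, ENNReal.ofReal_rpow_of_nonneg (norm_nonneg _) hp0.le,
      ENNReal.ofReal_rpow_of_nonneg (norm_nonneg _) hq0.le, norm_smul, Complex.norm_real,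
      Real.norm_of_nonneg (rpow_nonneg (norm_nonneg _) _)]
    congr 1
    rcases (norm_nonneg (T f n)).eq_or_lt with h0 | h0
    · rw [← h0, mul_zero, zero_rpow hp0.ne', zero_rpow hq0.ne']
    · rw [← rpow_add_one h0.ne', ← rpow_mul h0.le]
      congr 1
      have := hpq.mul_eq_add
      linarith
  have hgsum : ∑' n, ‖g n‖ₑ ^ p = X := by
    rw [tsum_eq_sum (s := N) fun n hn => by simp [hg0 hn, hp0]]
    exact Finset.sum_congr rfl fun n hn => hgnorm hn
  have hpair : ∑ n ∈ g.support, inner ℂ (g n) (T f n) = ((∑ n ∈ N, ‖T f n‖ ^ q : ℝ) : ℂ) := by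
    rw [Finset.sum_subset (s₂ := N)]
    · push_cast
      refine Finset.sum_congr rfl fun n hn => ?_
      rw [hg hn, inner_smul_left, inner_self_eq_norm_sq_to_K, Complex.conj_ofReal]
      norm_cast
      rcases (norm_nonneg (T f n)).eq_or_lt with h0 | h0
      · rw [← h0, zero_rpow hq0.ne']; simp
      · have h1 : ‖T f n‖ ^ (q - 2) * ‖T f n‖ ^ 2 = ‖T f n‖ ^ q := by
          rw [rpow_sub h0, rpow_ofNat]; field_simp
        exact congrArg Complex.ofReal h1 ▸ (Complex.ofReal_mul _ _).symm
    · intro n hn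
      by_contra hc
      exact (Finsupp.mem_support_iff.1 hn) (hg0 hc)
    · intro n _ hn
      rw [Finsupp.notMem_support_iff.1 hn, inner_zero_left]
  have hXeq : X = ‖∑ n ∈ g.support, inner ℂ (g n) (T f n)‖ₑ := by
    have h0 : 0 ≤ ∑ n ∈ N, ‖T f n‖ ^ q :=
      Finset.sum_nonneg fun _ _ => rpow_nonneg (norm_nonneg _) _
    rw [hpair, ← ofReal_norm, Complex.norm_real, Real.norm_of_nonneg h0,
      ENNReal.ofReal_sum_of_nonneg fun _ _ => rpow_nonneg (norm_nonneg _) _]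
    refine Finset.sum_congr rfl fun n _ => ?_
    rw [← ENNReal.ofReal_rpow_of_nonneg (norm_nonneg _) hq0.le, ofReal_norm]
  have hmain : X ≤ (C * X) ^ (1 / p) * Y ^ (1 / q) := by
    calc X ≤ ∑ m ∈ f.support, ‖T' g m‖ₑ * ‖f m‖ₑ := by
          rw [hXeq, hT]
          refine (enorm_sum_le _ _).trans (Finset.sum_le_sum fun m _ => ?_)
          rw [← ofReal_norm, ← ofReal_norm, ← ofReal_norm, ← ENNReal.ofReal_mul (norm_nonneg _)]
          exact ENNReal.ofReal_le_ofReal (norm_inner_le_norm _ _)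
      _ ≤ (∑ m ∈ f.support, ‖T' g m‖ₑ ^ p) ^ (1 / p) *
          (∑ m ∈ f.support, ‖f m‖ₑ ^ q) ^ (1 / q) := ENNReal.inner_le_Lp_mul_Lq _ _ _ hpq
      _ ≤ (C * X) ^ (1 / p) * Y ^ (1 / q) := by
          gcongr
          · rw [← hgsum]
            exact (ENNReal.sum_le_tsum _).trans (h g)
          · exact ENNReal.sum_le_tsum _
  rcases eq_or_ne X 0 with h0 | h0
  · rw [h0]; exact zero_le
  have hpq1 : 1 / p + 1 / q = 1 := by
    simpa using hpq.inv_add_inv_eq_one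
  have h1 : X ^ (1 / p) * X ^ (1 / q) ≤ X ^ (1 / p) * (C ^ (1 / p) * Y ^ (1 / q)) := by
    rw [← ENNReal.rpow_add _ _ h0 hXtop, hpq1, ENNReal.rpow_one]
    refine hmain.trans (le_of_eq ?_)
    rw [ENNReal.mul_rpow_of_nonneg _ _ (by positivity)]; ring
  have hXp0 : X ^ (1 / p) ≠ 0 := by simp [ENNReal.rpow_eq_zero_iff, h0, hXtop]
  have hXpt : X ^ (1 / p) ≠ ∞ := ENNReal.rpow_ne_top_of_nonneg (by positivity) hXtop
  have h2 := ENNReal.rpow_le_rpow ((ENNReal.mul_le_mul_iff_right hXp0 hXpt).1 h1) hq0.le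
  rw [ENNReal.mul_rpow_of_nonneg _ _ hq0.le, ← ENNReal.rpow_mul, ← ENNReal.rpow_mul,
    ← ENNReal.rpow_mul, one_div_mul_cancel hq0.ne', ENNReal.rpow_one, ENNReal.rpow_one] at h2
  refine h2.trans (le_of_eq ?_)
  congr 2
  have := hpq.symm.div_conj_eq_sub_one
  rw [← this]; ring

end Duality

section KernelOperator

variable {ι E F : Type*} [NormedAddCommGroup E] [InnerProductSpace ℂ E]
  [NormedAddCommGroup F] [InnerProductSpace ℂ F]

/-- The operator with kernel `K`, acting on finitely supported functions. -/
noncomputable def kernelOp (K : ι → ι → E →L[ℂ] F) : (ι →₀ E) →ₗ[ℂ] (ι → F) :=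
  LinearMap.pi fun n => Finsupp.lsum ℂ fun m => (K n m : E →ₗ[ℂ] F)

lemma kernelOp_apply (K : ι → ι → E →L[ℂ] F) (f : ι →₀ E) (n : ι) :
    kernelOp K f n = ∑ m ∈ f.support, K n m (f m) := rfl

lemma inner_kernelOp [CompleteSpace E] [CompleteSpace F] (K : ι → ι → E →L[ℂ] F) (f : ι →₀ E)
    (g : ι →₀ F) :
    ∑ n ∈ g.support, inner ℂ (g n) (kernelOp K f n) =
      ∑ m ∈ f.support, inner ℂ (kernelOp (fun m n => (K n m).adjoint) g m) (f m) := by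
  simp_rw [kernelOp_apply, inner_sum, sum_inner, ContinuousLinearMap.adjoint_inner_left]
  exact Finset.sum_comm

end KernelOperator

section CZ
variable {d : ℕ} {E F : Type*} [NormedAddCommGroup E] [InnerProductSpace ℂ E]
  [NormedAddCommGroup F] [InnerProductSpace ℂ F]

/-- The `ℓ^p` bound, `1 < p ≤ 2`, for a Calderón–Zygmund operator with Hörmander constant `A` and
`ℓ²` bound `B`. -/
noncomputable def czConst (d : ℕ) (A B : ℝ≥0) (p : ℝ) : ℝ≥0∞ :=
  if p = 2 then B else
    ENNReal.ofReal p * (2 * (4 * B * 2 ^ d + 3 ^ d + 4 * A : ℝ≥0) * ENNReal.ofReal (1 / (p - 1)) +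
      4 * B * ENNReal.ofReal (1 / (2 - p)))

lemma czConst_ne_top (d : ℕ) (A B : ℝ≥0) (p : ℝ) : czConst d A B p ≠ ∞ := by
  unfold czConst
  split_ifs
  · exact ENNReal.coe_ne_top
  · exact ENNReal.mul_ne_top ENNReal.ofReal_ne_top (ENNReal.add_ne_top.2
      ⟨ENNReal.mul_ne_top (ENNReal.mul_ne_top (by simp) ENNReal.coe_ne_top) ENNReal.ofReal_ne_top,
      ENNReal.mul_ne_top (ENNReal.mul_ne_top (by simp) ENNReal.coe_ne_top) ENNReal.ofReal_ne_top⟩)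

/-- Hörmander's condition on a kernel, in terms of dyadic cubes. -/
def HormanderCond (K : (Fin d → ℤ) → (Fin d → ℤ) → E →L[ℂ] F) (A : ℝ≥0) : Prop :=
  ∀ j q, ∀ m ∈ dyadicCube j q, ∀ c ∈ dyadicCube j q,
    ∑' n, (if n ∈ dyadicCubeStar j q then 0 else ‖K n m - K n c‖ₑ) ≤ A

lemma HormanderCond.kernelOp_le {K : (Fin d → ℤ) → (Fin d → ℤ) → E →L[ℂ] F} {A : ℝ≥0}
    (hK : HormanderCond K A) (j : ℕ) (q : Fin d → ℤ) (b : (Fin d → ℤ) →₀ E)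
    (hb : ∀ n, b n ≠ 0 → n ∈ dyadicCube j q) (hb0 : ∑ n ∈ dyadicCube j q, b n = 0) :
    ∑' n, (if n ∈ dyadicCubeStar j q then 0 else ‖kernelOp K b n‖ₑ) ≤ A * ∑' n, ‖b n‖ₑ := by
  classical
  rcases (dyadicCube j q).eq_empty_or_nonempty with he | ⟨c, hc⟩
  · have : b = 0 := by
      ext n; by_contra h; simpa [he] using hb n h
    simp [this]
  have hsub : b.support ⊆ dyadicCube j q := fun n hn => hb n (Finsupp.mem_support_iff.1 hn)
  have hrep (n) : kernelOp K b n = ∑ m ∈ dyadicCube j q, (K n m - K n c) (b m) := by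
    rw [kernelOp_apply, Finset.sum_subset hsub fun m _ hm => by
      rw [Finsupp.notMem_support_iff.1 hm, map_zero]]
    simp_rw [sub_apply, Finset.sum_sub_distrib, ← map_sum, hb0, map_zero,
      sub_zero]
  calc ∑' n, (if n ∈ dyadicCubeStar j q then 0 else ‖kernelOp K b n‖ₑ)
      ≤ ∑' n, ∑ m ∈ dyadicCube j q,
          (if n ∈ dyadicCubeStar j q then 0 else ‖K n m - K n c‖ₑ) * ‖b m‖ₑ := by
        refine ENNReal.tsum_le_tsum fun n => ?_
        split_ifs
        · exact zero_le
        · rw [hrep]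
          exact (enorm_sum_le _ _).trans
            (Finset.sum_le_sum fun m _ => ContinuousLinearMap.le_opENorm _ _)
    _ = ∑ m ∈ dyadicCube j q,
          (∑' n, (if n ∈ dyadicCubeStar j q then 0 else ‖K n m - K n c‖ₑ)) * ‖b m‖ₑ := by
        rw [Summable.tsum_finsetSum fun _ _ => ENNReal.summable]
        simp_rw [ENNReal.tsum_mul_right]
    _ ≤ ∑ m ∈ dyadicCube j q, A * ‖b m‖ₑ := by
        gcongr with m hm
        exact hK j q m hm c hc
    _ ≤ A * ∑' n, ‖b n‖ₑ := by
        rw [← Finset.mul_sum]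
        gcongr
        exact ENNReal.sum_le_tsum _

lemma kernelOp_strongType_of_le_two (hd : 1 ≤ d) (K : (Fin d → ℤ) → (Fin d → ℤ) → E →L[ℂ] F)
    (A B : ℝ≥0) (hL2 : ∀ f, ∑' n, ‖kernelOp K f n‖ₑ ^ 2 ≤ B * ∑' n, ‖f n‖ₑ ^ 2)
    (hK : HormanderCond K A) {p : ℝ} (hp : 1 < p) (hp2 : p ≤ 2) (f : (Fin d → ℤ) →₀ E) :
    ∑' n, ‖kernelOp K f n‖ₑ ^ p ≤ czConst d A B p * ∑' n, ‖f n‖ₑ ^ p := by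
  unfold czConst
  split_ifs with h2
  · simpa [h2] using hL2 f
  · refine strongType_of_weakType (kernelOp K) _ B hL2 (fun f t ht => ?_) hp
      (lt_of_le_of_ne hp2 h2) f
    simpa using weakType_one hd (kernelOp K) A B hL2 hK.kernelOp_le f ht

/-- The `ℓ^p` bound for a Calderón–Zygmund operator with Hörmander constant `A` and
`ℓ²` bound `B`. -/
noncomputable def czConst' (d : ℕ) (A B : ℝ≥0) (p : ℝ) : ℝ≥0∞ :=
  if p ≤ 2 then czConst d A B p else czConst d A B (p / (p - 1)) ^ (p - 1)

lemma czConst'_ne_top (d : ℕ) (A B : ℝ≥0) {p : ℝ} (hp : 1 ≤ p) : czConst' d A B p ≠ ∞ := by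
  unfold czConst'
  split_ifs
  · exact czConst_ne_top d A B p
  · exact ENNReal.rpow_ne_top_of_nonneg (sub_nonneg.2 hp) (czConst_ne_top d A B _)

/-- **Calderón–Zygmund theorem** on `ℤ^d`. -/
theorem kernelOp_strongType [CompleteSpace E] [CompleteSpace F] (hd : 1 ≤ d)
    (K : (Fin d → ℤ) → (Fin d → ℤ) → E →L[ℂ] F)
    (A B : ℝ≥0) (hL2 : ∀ f, ∑' n, ‖kernelOp K f n‖ₑ ^ 2 ≤ B * ∑' n, ‖f n‖ₑ ^ 2)
    (hK : HormanderCond K A) (hK' : HormanderCond (fun m n => (K n m).adjoint) A)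
    {p : ℝ} (hp : 1 < p) (f : (Fin d → ℤ) →₀ E) :
    ∑' n, ‖kernelOp K f n‖ₑ ^ p ≤ czConst' d A B p * ∑' n, ‖f n‖ₑ ^ p := by
  unfold czConst'
  split_ifs with hp2
  · exact kernelOp_strongType_of_le_two hd K A B hL2 hK hp hp2 f
  have hpq : (p / (p - 1)).HolderConjugate p := (Real.HolderConjugate.conjExponent hp).symm
  refine strongType_of_adjoint (kernelOp K) (kernelOp fun m n => (K n m).adjoint)
    (inner_kernelOp K) hpq _ (fun g => ?_) f
  refine kernelOp_strongType_of_le_two hd _ A B (fun g => ?_) hK' hpq.lt ?_ g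
  · have := strongType_of_adjoint (kernelOp fun m n => (K n m).adjoint) (kernelOp K)
      (fun f g => by simpa using inner_kernelOp (fun m n => (K n m).adjoint) f g)
      Real.HolderConjugate.two_two B (fun g => by simpa using hL2 g) g
    norm_num at this
    exact this
  · rw [div_le_iff₀ (by linarith)]; linarith

end CZ

section OneVariable

/-- Iterated finite differences are controlled by derivatives. -/
lemma norm_fwdDiff_iter_le {E : Type*} [NormedAddCommGroup E] [NormedSpace ℝ E] {n : ℕ} {h D : ℝ}
    (hh : 0 ≤ h) {F : ℝ → E} (hF : ContDiff ℝ n F) (hD : ∀ x, ‖iteratedDeriv n F x‖ ≤ D) (x : ℝ) :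
    ‖(fwdDiff h)^[n] F x‖ ≤ h ^ n * D := by
  induction n generalizing F D with
  | zero => simpa using hD x
  | succ n ih =>
    have hF' : ContDiff ℝ n F := hF.of_le (by exact_mod_cast n.le_succ)
    have hFh : ContDiff ℝ n fun x => F (x + h) := hF'.comp (contDiff_id.add contDiff_const)
    rw [Function.iterate_succ_apply, pow_succ, mul_assoc]
    refine ih (hFh.sub hF') fun y => ?_
    have hdiff : Differentiable ℝ (iteratedDeriv n F) :=
      hF.differentiable_iteratedDeriv n (by exact_mod_cast n.lt_succ_self)
    have h1 : iteratedDeriv n (fwdDiff h F) y =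
        iteratedDeriv n F (y + h) - iteratedDeriv n F y := by
      rw [show fwdDiff h F = fun x => F (x + h) - F x from rfl,
        iteratedDeriv_fun_sub hFh.contDiffAt hF'.contDiffAt, iteratedDeriv_comp_add_const]
    rw [h1, mul_comm]
    have h2 := convex_univ.norm_image_sub_le_of_norm_deriv_le (f := iteratedDeriv n F) (C := D)
      (fun x _ => hdiff x) (fun x _ => by rw [← iteratedDeriv_succ]; exact hD x)
      (Set.mem_univ y) (Set.mem_univ (y + h))
    simpa [abs_of_nonneg hh] using h2

lemma abs_iteratedDeriv_cos_two_pi_le (i : ℕ) (y x : ℝ) :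
    |iteratedDeriv i (fun x => cos (2 * π * (y + x))) x| ≤ (2 * π) ^ i := by
  have := iteratedDeriv_comp_const_add i (fun x => cos (2 * π * x)) y
  rw [congrFun this x, iteratedDeriv_comp_const_mul contDiff_cos]
  simp only [abs_mul]
  rw [abs_of_nonneg (by positivity)]
  exact mul_le_of_le_one_right (by positivity) (abs_iteratedDeriv_cos_le_one _ _)

/-- The square of the symbol of `√(-Δ)`, dilated by `l`, along a coordinate line. -/
noncomputable def lineSymbol (l s y x : ℝ) : ℝ := l ^ 2 * (s + 2 - 2 * cos (2 * π * (y + x)))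

lemma contDiff_lineSymbol (l s y : ℝ) {n : WithTop ℕ∞} : ContDiff ℝ n (lineSymbol l s y) := by
  unfold lineSymbol; fun_prop

lemma mul_abs_sin_le_of_lineSymbol_le {l b s y x : ℝ} (hl : 0 < l) (hb : 1 ≤ b) (hs : 0 ≤ s)
    (hx : lineSymbol l s y x ≤ b ^ 2) : l * |sin (π * (y + x))| ≤ b / 2 := by
  have h1 : lineSymbol l s y x = l ^ 2 * s + (2 * (l * |sin (π * (y + x))|)) ^ 2 := by
    have : cos (2 * π * (y + x)) = 1 - 2 * sin (π * (y + x)) ^ 2 := by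
      rw [mul_assoc, cos_two_mul, cos_sq']; ring
    rw [lineSymbol, this, mul_pow, mul_pow, sq_abs]; ring
  have h2 : 2 * (l * |sin (π * (y + x))|) ≤ b := by
    refine (pow_le_pow_iff_left₀ (by positivity) (by linarith) two_ne_zero).1 ?_
    nlinarith [mul_nonneg (sq_nonneg l) hs]
  linarith

lemma norm_iteratedFDeriv_lineSymbol_le {l l₀ b s y x : ℝ} (hl₀ : 0 < l₀) (hl₁ : l₀ ≤ 1)
    (hl : l₀ ≤ l) (hb : 1 ≤ b) (hs : 0 ≤ s) (hx : lineSymbol l s y x ≤ b ^ 2) {i : ℕ} (hi : 1 ≤ i) :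
    ‖iteratedFDeriv ℝ i (lineSymbol l s y) x‖ ≤ (4 * π * b / l₀ * l) ^ i := by
  have hl' : 0 < l := hl₀.trans_le hl
  have hπ := pi_pos
  rw [norm_iteratedFDeriv_eq_norm_iteratedDeriv]
  rcases hi.eq_or_lt with rfl | hi
  · have hd : HasDerivAt (lineSymbol l s y)
        (l ^ 2 * (0 - 2 * (-sin (2 * π * (y + x)) * (2 * π * 1)))) x := by
      unfold lineSymbol
      exact ((hasDerivAt_const x (s + 2)).sub ((((hasDerivAt_id x).const_add y).const_mul
        (2 * π)).cos.const_mul 2)).const_mul _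
    rw [iteratedDeriv_one, hd.deriv, pow_one, Real.norm_eq_abs]
    have hsin := mul_abs_sin_le_of_lineSymbol_le hl' hb hs hx
    have h3 : l ^ 2 * (0 - 2 * (-sin (2 * π * (y + x)) * (2 * π * 1))) =
        8 * π * l * (l * sin (π * (y + x))) * cos (π * (y + x)) := by
      rw [mul_assoc 2 π, sin_two_mul]; ring
    rw [h3, abs_mul, abs_mul, abs_mul l, abs_of_pos hl', abs_of_pos (by positivity)]
    calc 8 * π * l * (l * |sin (π * (y + x))|) * |cos (π * (y + x))|
        ≤ 8 * π * l * (b / 2) * 1 := by gcongr; exact abs_cos_le_one _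
      _ = 4 * π * b / 1 * l := by ring
      _ ≤ 4 * π * b / l₀ * l := by gcongr
  · have h1 : iteratedDeriv i (lineSymbol l s y) x =
        l ^ 2 * (-2 * iteratedDeriv i (fun x => cos (2 * π * (y + x))) x) := by
      unfold lineSymbol
      rw [iteratedDeriv_const_mul_field]
      congr 1
      rw [show (fun x => s + 2 - 2 * cos (2 * π * (y + x))) =
        fun x => s + 2 + (-2) * cos (2 * π * (y + x)) by ext; ring,
        iteratedDeriv_const_add (by omega), iteratedDeriv_const_mul_field]
    rw [h1, Real.norm_eq_abs, abs_mul, abs_mul, abs_of_pos (by positivity : 0 < l ^ 2)]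
    have h2 := abs_iteratedDeriv_cos_two_pi_le i y x
    have h3 : l₀ ^ i * l ^ 2 ≤ l ^ i := by
      obtain ⟨m, rfl⟩ := Nat.exists_eq_add_of_lt hi
      calc l₀ ^ (1 + m + 1) * l ^ 2 = l₀ ^ m * l₀ ^ 2 * l ^ 2 := by ring
        _ ≤ l ^ m * 1 * l ^ 2 := by
            gcongr
            exact pow_le_one₀ hl₀.le hl₁
        _ = _ := by ring
    calc l ^ 2 * (|(-2)| * |iteratedDeriv i (fun x => cos (2 * π * (y + x))) x|)
        ≤ l ^ 2 * (2 ^ i * (2 * π) ^ i) := by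
          gcongr
          rw [abs_neg, abs_two]
          exact le_self_pow₀ one_le_two (by omega)
      _ = (4 * π) ^ i * l ^ 2 := by rw [← mul_pow]; ring
      _ ≤ (4 * π) ^ i * (l ^ i / l₀ ^ i) := by
          gcongr
          rw [le_div_iff₀ (by positivity), mul_comm]; exact h3
      _ ≤ (4 * π) ^ i * (l ^ i / l₀ ^ i) * b ^ i :=
          le_mul_of_one_le_right (by positivity) (one_le_pow₀ hb)
      _ = (4 * π * b / l₀ * l) ^ i := by simp only [mul_pow, div_pow]; ring

/-- Uniform control of the derivatives of a dilated multiplier along a coordinate line. -/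
lemma norm_iteratedDeriv_multiplier_le {l l₀ b s y a G : ℝ} (hl₀ : 0 < l₀) (hl₁ : l₀ ≤ 1)
    (hl : l₀ ≤ l) (hb : 1 ≤ b) (hs : 0 ≤ s) (hG0 : 0 ≤ G) (ha : 0 ≤ a) {r : ℕ} {g : ℝ → ℂ}
    (hg : ContDiff ℝ r g) (hgsupp : ∀ t, b ^ 2 < t → g t = 0)
    (hG : ∀ i ≤ r, ∀ t, ‖iteratedFDeriv ℝ i g t‖ ≤ G) {w : ℝ → ℂ} (hw : ContDiff ℝ r w)
    (hwa : ∀ x, lineSymbol l s y x ≤ b ^ 2 → ∀ i ≤ r,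
      ‖iteratedFDeriv ℝ i w x‖ ≤ a * (4 * π * b / l₀ * l) ^ i) (x : ℝ) :
    ‖iteratedDeriv r (fun x => g (lineSymbol l s y x) * w x) x‖ ≤
      a * (2 ^ r * r.factorial * G) * (4 * π * b / l₀ * l) ^ r := by
  have hl' : 0 < l := hl₀.trans_le hl
  set D := 4 * π * b / l₀ * l with hD
  have hD0 : 0 ≤ D := by positivity
  rw [← norm_iteratedFDeriv_eq_norm_iteratedDeriv]
  rcases le_or_gt (lineSymbol l s y x) (b ^ 2) with hx | hx
  · have hcomp (i) (hi : i ≤ r) :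
        ‖iteratedFDeriv ℝ i (fun x => g (lineSymbol l s y x)) x‖ ≤ r.factorial * G * D ^ i := by
      refine (norm_iteratedFDeriv_comp_le hg (contDiff_lineSymbol l s y) (by exact_mod_cast hi) x
        (fun j hj => hG j (hj.trans hi) _)
        (fun j hj _ => norm_iteratedFDeriv_lineSymbol_le hl₀ hl₁ hl hb hs hx hj)).trans ?_
      gcongr
    refine (norm_iteratedFDeriv_mul_le (hg.comp (contDiff_lineSymbol l s y)) hw x le_rfl).trans ?_
    calc _ ≤ ∑ i ∈ Finset.range (r + 1), (r.choose i : ℝ) * (r.factorial * G * D ^ i) *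
          (a * D ^ (r - i)) := by
          refine Finset.sum_le_sum fun i hi => ?_
          have hi' : i ≤ r := Nat.lt_succ_iff.1 (Finset.mem_range.1 hi)
          gcongr
          · exact hcomp i hi'
          · exact hwa x hx _ (Nat.sub_le _ _)
      _ = ∑ i ∈ Finset.range (r + 1), (r.choose i : ℝ) * (a * (r.factorial * G) * D ^ r) := by
          refine Finset.sum_congr rfl fun i hi => ?_
          have hi' : i ≤ r := Nat.lt_succ_iff.1 (Finset.mem_range.1 hi)
          rw [← pow_mul_pow_sub D hi']; ring
      _ = _ := by
          rw [← Finset.sum_mul]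
          have := Nat.sum_range_choose r
          rw [← Nat.cast_sum, this]; push_cast; ring
  · have h0 : (fun x => g (lineSymbol l s y x) * w x) =ᶠ[nhds x] fun _ => 0 := by
      have : ∀ᶠ z in nhds x, b ^ 2 < lineSymbol l s y z :=
        (contDiff_lineSymbol (n := 0) l s y).continuous.continuousAt.eventually (lt_mem_nhds hx)
      filter_upwards [this] with z hz
      rw [hgsupp _ hz, zero_mul]
    rw [(h0.iteratedFDeriv ℝ r).eq_of_nhds]
    have : iteratedFDeriv ℝ r (fun _ : ℝ => (0 : ℂ)) x = 0 := by simp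
    rw [this, norm_zero]
    positivity

lemma norm_cexp_two_pi_sub_one (x : ℝ) :
    ‖Complex.exp (2 * π * Complex.I * x) - 1‖ = 2 * |sin (π * x)| := by
  have h := Complex.norm_exp_I_mul_ofReal_sub_one (2 * π * x)
  rw [show Complex.I * ((2 * π * x : ℝ) : ℂ) = 2 * π * Complex.I * x by push_cast; ring] at h
  rw [h, show 2 * π * x / 2 = π * x by ring, Real.norm_eq_abs, abs_mul, abs_two]

lemma norm_iteratedFDeriv_cexp_sub_one_le {l l₀ b s y x : ℝ} (hl₀ : 0 < l₀) (hl₁ : l₀ ≤ 1)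
    (hl : l₀ ≤ l) (hb : 1 ≤ b) (hs : 0 ≤ s) (hx : lineSymbol l s y x ≤ b ^ 2) (i : ℕ) :
    ‖iteratedFDeriv ℝ i (fun x : ℝ => Complex.exp (2 * π * Complex.I * (y + x : ℝ)) - 1) x‖ ≤
      b / l * (4 * π * b / l₀ * l) ^ i := by
  have hl' : 0 < l := hl₀.trans_le hl
  have hπ := pi_pos
  rw [norm_iteratedFDeriv_eq_norm_iteratedDeriv]
  rcases Nat.eq_zero_or_pos i with rfl | hi
  · rw [iteratedDeriv_zero, norm_cexp_two_pi_sub_one, pow_zero, mul_one, le_div_iff₀ hl']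
    linarith [mul_abs_sin_le_of_lineSymbol_le hl' hb hs hx]
  · have hderiv (j : ℕ) :
        iteratedDeriv j (fun x : ℝ => Complex.exp (2 * π * Complex.I * (y + x : ℝ))) =
          fun x => (2 * π * Complex.I) ^ j * Complex.exp (2 * π * Complex.I * (y + x : ℝ)) := by
      induction j with
      | zero => simp
      | succ j ih =>
        rw [iteratedDeriv_succ, ih]
        ext x
        have h1 : HasDerivAt (fun x : ℝ => ((y + x : ℝ) : ℂ)) 1 x := by
          simpa using ((hasDerivAt_id x).const_add y).ofReal_comp
        rw [((h1.const_mul (2 * π * Complex.I)).cexp.const_mul _).deriv]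
        ring
    have h1 : iteratedDeriv i (fun x : ℝ => Complex.exp (2 * π * Complex.I * (y + x : ℝ)) - 1) x =
        iteratedDeriv i (fun x : ℝ => Complex.exp (2 * π * Complex.I * (y + x : ℝ))) x := by
      simp_rw [sub_eq_neg_add]
      exact iteratedDeriv_const_add hi _
    rw [h1, hderiv, norm_mul, norm_pow]
    have h2 : ‖(2 * π * Complex.I : ℂ)‖ = 2 * π := by simp [abs_of_pos hπ]
    have h3 : ‖Complex.exp (2 * π * Complex.I * (y + x : ℝ))‖ = 1 := by
      rw [show (2 * π * Complex.I * (y + x : ℝ) : ℂ) = (2 * π * (y + x) : ℝ) * Complex.I by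
        push_cast; ring]
      exact Complex.norm_exp_ofReal_mul_I _
    have h4 : l ≤ (l / l₀) ^ i := by
      have : 1 ≤ l / l₀ := (one_le_div hl₀).2 hl
      calc l ≤ l / l₀ := le_div_self hl'.le hl₀ hl₁
        _ ≤ (l / l₀) ^ i := le_self_pow₀ this hi.ne'
    rw [h2, h3, mul_one]
    calc (2 * π) ^ i ≤ (4 * π) ^ i := by gcongr; norm_num
      _ = 1 / l * ((4 * π * 1) ^ i * l) := by field_simp
      _ ≤ b / l * ((4 * π * b) ^ i * (l / l₀) ^ i) := by gcongr
      _ = _ := by rw [← mul_pow]; congr 2; ring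

/-- The function `t ↦ ψ (√t)` for `ψ` supported away from the origin. -/
lemma contDiff_comp_sqrt {ε : ℝ} (hε0 : 0 < ε) {ψ : ℝ → ℂ} {r : ℕ}
    (hψ : ContDiffOn ℝ r ψ (Set.Ici 0)) (hψsupp : ∀ t : ℝ, t ∉ Set.Icc ε ε⁻¹ → ψ t = 0) :
    ContDiff ℝ r fun t => ψ (√t) := by
  rw [contDiff_iff_contDiffAt]
  intro t
  rcases lt_or_ge t (ε ^ 2) with ht | ht
  · refine (contDiffAt_const (c := (0 : ℂ))).congr_of_eventuallyEq ?_
    filter_upwards [gt_mem_nhds ht] with z hz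
    refine hψsupp _ fun h => absurd h.1 (not_le.2 ?_)
    rw [sqrt_lt' hε0]; exact hz
  · have ht0 : 0 < t := lt_of_lt_of_le (by positivity) ht
    have h1 : ContDiffAt ℝ r ψ (√t) := hψ.contDiffAt (Ici_mem_nhds (sqrt_pos.2 ht0))
    exact h1.comp t (contDiffAt_id.sqrt ht0.ne')

lemma exists_iteratedFDeriv_le {g : ℝ → ℂ} {r : ℕ} (hg : ContDiff ℝ r g)
    (hc : HasCompactSupport g) : ∃ G, 0 ≤ G ∧ ∀ i ≤ r, ∀ t, ‖iteratedFDeriv ℝ i g t‖ ≤ G := by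
  have h (i : ℕ) : ∃ G, i ≤ r → ∀ t, ‖iteratedFDeriv ℝ i g t‖ ≤ G := by
    by_cases hi : i ≤ r
    · obtain ⟨G, hG⟩ := (hc.iteratedFDeriv i).exists_bound_of_continuous
        (hg.continuous_iteratedFDeriv (by exact_mod_cast hi) (𝕜 := ℝ))
      exact ⟨G, fun _ => hG⟩
    · exact ⟨0, fun h => absurd h hi⟩
  choose G hG using h
  refine ⟨∑ i ∈ Finset.range (r + 1), |G i|, Finset.sum_nonneg fun _ _ => abs_nonneg _,
    fun i hi t => ?_⟩
  exact (hG i hi t).trans ((le_abs_self _).trans (Finset.single_le_sum (f := fun i => |G i|)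
    (fun _ _ => abs_nonneg _) (Finset.mem_range.2 (by omega))))

lemma sum_geometric_sqrt_two_le (m : ℕ) : ∑ i ∈ Finset.range m, (1 / √2) ^ i ≤ 4 := by
  have h2 : (4 / 3 : ℝ) ≤ √2 := le_sqrt_of_sq_le (by norm_num)
  have h1 : 1 / √2 ≤ 3 / 4 := by
    rw [div_le_div_iff₀ (by positivity) (by norm_num)]; linarith
  calc ∑ i ∈ Finset.range m, (1 / √2) ^ i ≤ ∑ i ∈ Finset.range m, (3 / 4 : ℝ) ^ i := by gcongr
    _ ≤ (1 - 3 / 4)⁻¹ := by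
      have h := summable_geometric_of_lt_one (r := (3 / 4 : ℝ)) (by norm_num) (by norm_num)
      rw [← tsum_geometric_of_lt_one (by norm_num) (by norm_num)]
      exact h.sum_le_tsum _ fun _ _ => by positivity
    _ = 4 := by norm_num

end OneVariable

section ShiftDiff

variable {d : ℕ}

/-- The `ℓ¹` norm of the difference between a function on `ℤ^d` and its translate by `v`. -/
noncomputable def shiftDiff (Q : (Fin d → ℤ) → ℂ) (v : Fin d → ℤ) : ℝ≥0∞ :=
  ∑' n, ‖Q (n + v) - Q n‖ₑ

variable (Q : (Fin d → ℤ) → ℂ)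

lemma shiftDiff_zero : shiftDiff Q 0 = 0 := by simp [shiftDiff]

lemma shiftDiff_add_le (v w : Fin d → ℤ) :
    shiftDiff Q (v + w) ≤ shiftDiff Q v + shiftDiff Q w := by
  have h : shiftDiff Q v = ∑' n, ‖Q (n + w + v) - Q (n + w)‖ₑ :=
    ((Equiv.addRight w).tsum_eq fun n => ‖Q (n + v) - Q n‖ₑ).symm
  rw [h, shiftDiff, shiftDiff, ← ENNReal.tsum_add]
  refine ENNReal.tsum_le_tsum fun n => ?_
  refine le_trans (le_of_eq ?_) (enorm_add_le _ _)
  rw [show n + w + v = n + (v + w) by abel, sub_add_sub_cancel]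

lemma shiftDiff_neg (v : Fin d → ℤ) : shiftDiff Q (-v) = shiftDiff Q v := by
  rw [shiftDiff, ← (Equiv.addRight v).tsum_eq]
  refine tsum_congr fun n => ?_
  simp only [Equiv.coe_addRight, add_neg_cancel_right]
  exact enorm_sub_rev _ _

lemma shiftDiff_nsmul_le (k : ℕ) (v : Fin d → ℤ) : shiftDiff Q (k • v) ≤ k * shiftDiff Q v := by
  induction k with
  | zero => simp [shiftDiff_zero]
  | succ k ih =>
    rw [add_smul, one_smul, Nat.cast_succ, add_mul, one_mul]
    exact (shiftDiff_add_le Q _ _).trans (add_le_add_left ih _)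

lemma shiftDiff_single_le (i : Fin d) (z : ℤ) :
    shiftDiff Q (Pi.single i z) ≤ z.natAbs * shiftDiff Q (Pi.single i 1) := by
  have h : shiftDiff Q (Pi.single i z) = shiftDiff Q (z.natAbs • Pi.single i 1) := by
    rw [← Pi.single_smul, nsmul_eq_mul, mul_one]
    rcases Int.natAbs_eq z with h | h
    · rw [← h]
    · rw [h, Pi.single_neg, shiftDiff_neg]; simp
  rw [h]
  exact shiftDiff_nsmul_le Q _ _

lemma shiftDiff_sum_le (s : Finset (Fin d)) (v : Fin d → Fin d → ℤ) :
    shiftDiff Q (∑ i ∈ s, v i) ≤ ∑ i ∈ s, shiftDiff Q (v i) := by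
  classical
  induction s using Finset.induction_on with
  | empty => simp [shiftDiff_zero]
  | insert i s hi ih =>
    rw [Finset.sum_insert hi, Finset.sum_insert hi]
    exact (shiftDiff_add_le Q _ _).trans (add_le_add_right ih _)

lemma shiftDiff_le {D : ℝ≥0∞} (hD : ∀ i, shiftDiff Q (Pi.single i 1) ≤ D) {N : ℕ}
    {v : Fin d → ℤ} (hv : ∀ i, (v i).natAbs ≤ N) : shiftDiff Q v ≤ d * (N * D) := by
  rw [← Finset.univ_sum_single v]
  refine (shiftDiff_sum_le Q _ _).trans ?_
  calc ∑ i, shiftDiff Q (Pi.single i (v i)) ≤ ∑ _i : Fin d, N * D := by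
        refine Finset.sum_le_sum fun i _ => (shiftDiff_single_le Q i _).trans ?_
        gcongr
        · exact_mod_cast hv i
        · exact hD i
    _ = d * (N * D) := by simp

end ShiftDiff

section LittlewoodPaley

variable {d : ℕ}

/-- The open cube of side `2 N` centred at the origin of `ℤ^d`. -/
noncomputable def centredBox (d N : ℕ) : Finset (Fin d → ℤ) :=
  Fintype.piFinset fun _ => Finset.Ioo (-(N : ℤ)) N

lemma mem_centredBox {N : ℕ} {n : Fin d → ℤ} : n ∈ centredBox d N ↔ ∀ i, |n i| < N := by
  simp [centredBox, abs_lt]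

lemma card_centredBox_le (d N : ℕ) : ((centredBox d N).card : ℝ) ≤ (2 * N) ^ d := by
  have : (centredBox d N).card ≤ (2 * N) ^ d := by
    rw [centredBox, Fintype.card_piFinset]
    simp only [Int.card_Ioo, Finset.prod_const, Finset.card_univ, Fintype.card_fin]
    exact Nat.pow_le_pow_left (by omega) d
  exact_mod_cast this

/-- Size and regularity of the kernels of a Littlewood–Paley decomposition on `ℤ^d`. -/
structure IsLPKernel (C : ℝ) (Q : ℤ → (Fin d → ℤ) → ℂ) : Prop where
  nonneg : 0 ≤ C
  tail : ∀ (k : ℤ) (N : ℕ), (2 : ℝ) ^ (-k) ≤ N →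
    ∑' n, (if n ∈ centredBox d N then 0 else ‖Q k n‖ₑ) ≤ ENNReal.ofReal (C * √(2 ^ (-k) / N))
  step : ∀ k i, shiftDiff (Q k) (Pi.single i 1) ≤ ENNReal.ofReal (C * 2 ^ k)

variable {C : ℝ} {Q : ℤ → (Fin d → ℤ) → ℂ}

lemma neg_mem_centredBox {N : ℕ} {n : Fin d → ℤ} : -n ∈ centredBox d N ↔ n ∈ centredBox d N := by
  simp [mem_centredBox]

lemma IsLPKernel.neg (h : IsLPKernel C Q) : IsLPKernel C fun k n => Q k (-n) := by
  refine ⟨h.nonneg, fun k N hN => ?_, fun k i => ?_⟩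
  · refine le_trans (le_of_eq ?_) (h.tail k N hN)
    rw [← (Equiv.neg _).tsum_eq fun n => if n ∈ centredBox d N then 0 else ‖Q k n‖ₑ]
    simp only [Equiv.neg_apply, neg_mem_centredBox]
  · refine le_trans (le_of_eq ?_) (h.step k i)
    rw [← shiftDiff_neg, shiftDiff, shiftDiff, ← (Equiv.neg _).tsum_eq]
    simp only [Equiv.neg_apply, neg_add, neg_neg]

/-- The part of Hörmander's condition at scale `2 ^ j` coming from a single kernel. -/
lemma IsLPKernel.tsum_sub_le (h : IsLPKernel C Q) (k : ℤ) {j : ℕ} {q m c : Fin d → ℤ}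
    (hm : m ∈ dyadicCube j q) (hc : c ∈ dyadicCube j q) :
    ∑' n, (if n ∈ dyadicCubeStar j q then 0 else ‖Q k (n - m) - Q k (n - c)‖ₑ) ≤
      ENNReal.ofReal ((d + 2) * C * (1 / √2) ^ (k + j).natAbs) := by
  have hC := h.nonneg
  have h2 : (0 : ℝ) < √2 := by positivity
  rcases lt_or_ge (k + j) 0 with hkj | hkj
  · have h1 : ∑' n, (if n ∈ dyadicCubeStar j q then 0 else ‖Q k (n - m) - Q k (n - c)‖ₑ) ≤
        shiftDiff (Q k) (c - m) := by
      rw [shiftDiff, ← (Equiv.subRight c).tsum_eq fun n => ‖Q k (n + (c - m)) - Q k n‖ₑ]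
      refine ENNReal.tsum_le_tsum fun n => ?_
      split_ifs
      · exact zero_le
      · simp
    refine h1.trans ((shiftDiff_le (Q k) (h.step k) (N := 2 ^ j) fun i => ?_).trans ?_)
    · have := abs_sub_lt_of_mem_dyadicCube hc hm i
      rw [Int.abs_eq_natAbs] at this
      have h3 : ((c - m) i).natAbs < 2 ^ j := by exact_mod_cast this
      exact h3.le
    · rw [← ENNReal.ofReal_natCast, ← ENNReal.ofReal_natCast,
        ← ENNReal.ofReal_mul (by positivity), ← ENNReal.ofReal_mul (by positivity)]
      refine ENNReal.ofReal_le_ofReal ?_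
      have h3 : (2 : ℝ) ^ j * 2 ^ k = (1 / 2) ^ (k + j).natAbs := by
        rw [← zpow_natCast, ← zpow_natCast, Int.natCast_natAbs, abs_of_neg hkj, one_div, inv_zpow',
          neg_neg, ← zpow_add₀ two_ne_zero, add_comm]
      have h4 : (1 / 2 : ℝ) ^ (k + j).natAbs ≤ (1 / √2) ^ (k + j).natAbs := by
        gcongr
        exact sqrt_le_iff.2 ⟨by norm_num, by norm_num⟩
      push_cast
      calc (d : ℝ) * (2 ^ j * (C * 2 ^ k)) = d * C * (2 ^ j * 2 ^ k) := by ring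
        _ ≤ d * C * (1 / √2) ^ (k + j).natAbs := by rw [h3]; gcongr
        _ ≤ _ := by gcongr; linarith
  · have hl : (2 : ℝ) ^ (-k) ≤ (2 ^ j : ℕ) := by
      rw [Nat.cast_pow, Nat.cast_two, ← zpow_natCast]
      exact zpow_le_zpow_right₀ one_le_two (by linarith)
    have htail (c : Fin d → ℤ) (hc : c ∈ dyadicCube j q) :
        ∑' n, (if n ∈ dyadicCubeStar j q then 0 else ‖Q k (n - c)‖ₑ) ≤
          ENNReal.ofReal (C * (1 / √2) ^ (k + j).natAbs) := by
      have h3 : √((2 : ℝ) ^ (-k) / (2 ^ j : ℕ)) = (1 / √2) ^ (k + j).natAbs := by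
        rw [Real.sqrt_eq_iff_mul_self_eq (by positivity) (by positivity), ← mul_pow,
          div_mul_div_comm, mul_self_sqrt (by norm_num), one_mul, ← zpow_natCast (1 / 2 : ℝ),
          Int.natCast_natAbs, abs_of_nonneg hkj, one_div, inv_zpow', Nat.cast_pow, Nat.cast_two,
          ← zpow_natCast, ← zpow_sub₀ two_ne_zero]
        congr 1; ring
      have h4 := h.tail k _ hl
      rw [h3] at h4
      refine le_trans ?_ h4
      rw [← (Equiv.subRight c).tsum_eq fun n => if n ∈ centredBox d (2 ^ j) then 0 else ‖Q k n‖ₑ]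
      refine ENNReal.tsum_le_tsum fun n => ?_
      split_ifs with hn hn' hn'
      · exact zero_le
      · exact zero_le
      · obtain ⟨i, hi⟩ := exists_lt_abs_sub_of_notMem_dyadicCubeStar hc hn
        have := mem_centredBox.1 hn' i
        simp only [Equiv.subRight_apply, Pi.sub_apply, Nat.cast_pow, Nat.cast_ofNat] at this
        linarith
      · exact le_rfl
    calc ∑' n, (if n ∈ dyadicCubeStar j q then 0 else ‖Q k (n - m) - Q k (n - c)‖ₑ)
        ≤ ∑' n, ((if n ∈ dyadicCubeStar j q then 0 else ‖Q k (n - m)‖ₑ) +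
            if n ∈ dyadicCubeStar j q then 0 else ‖Q k (n - c)‖ₑ) := by
          refine ENNReal.tsum_le_tsum fun n => ?_
          split_ifs
          · simp
          · exact enorm_sub_le
      _ ≤ ENNReal.ofReal (C * (1 / √2) ^ (k + j).natAbs) +
            ENNReal.ofReal (C * (1 / √2) ^ (k + j).natAbs) := by
          rw [ENNReal.tsum_add]
          exact add_le_add (htail m hm) (htail c hc)
      _ = ENNReal.ofReal (2 * C * (1 / √2) ^ (k + j).natAbs) := by
          rw [← ENNReal.ofReal_add (by positivity) (by positivity)]; ring_nf
      _ ≤ _ := by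
          refine ENNReal.ofReal_le_ofReal ?_
          gcongr
          linarith [Nat.cast_nonneg (α := ℝ) d]

lemma sum_inv_sqrt_two_pow_natAbs_le (S : Finset ℤ) : ∑ u ∈ S, (1 / √2) ^ u.natAbs ≤ 8 := by
  have h2 : (1 : ℝ) < √2 := lt_sqrt_of_sq_lt (by norm_num)
  have h0 : 0 ≤ 1 / √2 := by positivity
  have h1 : 1 / √2 < 1 := by rw [div_lt_one (by positivity)]; exact h2
  have hs := summable_geometric_of_lt_one h0 h1
  have h4 : ∑' n : ℕ, (1 / √2) ^ n ≤ 4 :=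
    hs.tsum_le_of_sum_range_le sum_geometric_sqrt_two_le
  have h5 : HasSum (fun n : ℕ => (1 / √2) ^ (-((n : ℤ) + 1)).natAbs)
      (1 / √2 * ∑' n : ℕ, (1 / √2) ^ n) := by
    refine (hs.hasSum.mul_left (1 / √2)).congr_fun fun n => ?_
    rw [Int.natAbs_neg, ← pow_succ']
    rfl
  have h6 : HasSum (fun n : ℕ => (1 / √2) ^ (n : ℤ).natAbs) (∑' n : ℕ, (1 / √2) ^ n) := by
    simpa using hs.hasSum
  refine (sum_le_hasSum S (fun _ _ => by positivity)
    (h6.of_nat_of_neg_add_one (f := fun u : ℤ => (1 / √2) ^ u.natAbs) h5)).trans ?_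
  have h7 : 0 ≤ ∑' n : ℕ, (1 / √2) ^ n := tsum_nonneg fun _ => by positivity
  nlinarith

/-- The vector-valued convolution kernel of a finite family of kernels on `ℤ^d`. -/
noncomputable def vectorKernel (Q : ℤ → (Fin d → ℤ) → ℂ) (κ : Finset ℤ) (n m : Fin d → ℤ) :
    ℂ →L[ℂ] EuclideanSpace ℂ κ :=
  ContinuousLinearMap.toSpanSingleton ℂ (WithLp.toLp 2 fun k : κ => Q k (n - m))

lemma enorm_vectorKernel_sub_le (Q : ℤ → (Fin d → ℤ) → ℂ) (κ : Finset ℤ) (n m n' m' : Fin d → ℤ) :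
    ‖vectorKernel Q κ n m - vectorKernel Q κ n' m'‖ₑ ≤
      ∑ k ∈ κ, ‖Q k (n - m) - Q k (n' - m')‖ₑ := by
  classical
  have h1 : vectorKernel Q κ n m - vectorKernel Q κ n' m' =
      ContinuousLinearMap.toSpanSingleton ℂ
        (∑ k : κ, EuclideanSpace.single k (Q k (n - m) - Q k (n' - m'))) := by
    ext k
    simp [vectorKernel]
  have h2 : ‖vectorKernel Q κ n m - vectorKernel Q κ n' m'‖ ≤
      ∑ k ∈ κ, ‖Q k (n - m) - Q k (n' - m')‖ := by
    rw [h1, ContinuousLinearMap.norm_toSpanSingleton]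
    refine (norm_sum_le _ _).trans (le_of_eq ?_)
    simp only [PiLp.norm_single]
    exact Finset.sum_coe_sort κ fun k => ‖Q k (n - m) - Q k (n' - m')‖
  simp only [← ofReal_norm]
  rw [← ENNReal.ofReal_sum_of_nonneg fun _ _ => norm_nonneg _]
  exact ENNReal.ofReal_le_ofReal h2

/-- The constant in Hörmander's condition for the kernels of a Littlewood–Paley decomposition. -/
noncomputable def lpHormanderConst (d : ℕ) (C : ℝ) : ℝ≥0 := ((d + 2) * C * 8).toNNReal

lemma IsLPKernel.tsum_sum_sub_le (h : IsLPKernel C Q) (κ : Finset ℤ) {j : ℕ} {q m c : Fin d → ℤ}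
    (hm : m ∈ dyadicCube j q) (hc : c ∈ dyadicCube j q) :
    ∑' n, (if n ∈ dyadicCubeStar j q then 0 else ∑ k ∈ κ, ‖Q k (n - m) - Q k (n - c)‖ₑ) ≤
      lpHormanderConst d C := by
  have hC := h.nonneg
  calc ∑' n, (if n ∈ dyadicCubeStar j q then 0 else ∑ k ∈ κ, ‖Q k (n - m) - Q k (n - c)‖ₑ)
      = ∑' n, ∑ k ∈ κ, (if n ∈ dyadicCubeStar j q then 0 else ‖Q k (n - m) - Q k (n - c)‖ₑ) := by
        refine tsum_congr fun n => ?_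
        split_ifs <;> simp
    _ = ∑ k ∈ κ, ∑' n, (if n ∈ dyadicCubeStar j q then 0 else ‖Q k (n - m) - Q k (n - c)‖ₑ) :=
        Summable.tsum_finsetSum fun _ _ => ENNReal.summable
    _ ≤ ∑ k ∈ κ, ENNReal.ofReal ((d + 2) * C * (1 / √2) ^ (k + j).natAbs) :=
        Finset.sum_le_sum fun k _ => h.tsum_sub_le k hm hc
    _ = ENNReal.ofReal ((d + 2) * C * ∑ u ∈ κ.map (addRightEmbedding (j : ℤ)),
          (1 / √2) ^ u.natAbs) := by
        rw [← ENNReal.ofReal_sum_of_nonneg fun _ _ => by positivity, Finset.sum_map,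
          Finset.mul_sum]
        rfl
    _ ≤ ENNReal.ofReal ((d + 2) * C * 8) := by
        refine ENNReal.ofReal_le_ofReal ?_
        gcongr
        exact sum_inv_sqrt_two_pow_natAbs_le _

lemma IsLPKernel.hormanderCond (h : IsLPKernel C Q) (κ : Finset ℤ) :
    HormanderCond (vectorKernel Q κ) (lpHormanderConst d C) := by
  refine fun j q m hm c hc => le_trans (ENNReal.tsum_le_tsum fun n => ?_)
    (h.tsum_sum_sub_le κ hm hc)
  split_ifs
  · exact le_rfl
  · exact enorm_vectorKernel_sub_le Q κ n m n c

lemma IsLPKernel.hormanderCond_adjoint (h : IsLPKernel C Q) (κ : Finset ℤ) :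
    HormanderCond (fun m n => (vectorKernel Q κ n m).adjoint) (lpHormanderConst d C) := by
  refine fun j q m hm c hc => le_trans (ENNReal.tsum_le_tsum fun n => ?_)
    (h.neg.tsum_sum_sub_le κ hm hc)
  split_ifs
  · exact le_rfl
  · rw [← map_sub, ← ofReal_norm, LinearIsometryEquiv.norm_map, ofReal_norm]
    simpa only [neg_sub] using enorm_vectorKernel_sub_le Q κ m n c n

end LittlewoodPaley

section Torus

open UnitAddTorus

noncomputable local instance : MeasureSpace UnitAddCircle := ⟨AddCircle.haarAddCircle⟩

local instance : Measure.IsAddHaarMeasure (volume : Measure UnitAddCircle) :=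
  inferInstanceAs (Measure.IsAddHaarMeasure AddCircle.haarAddCircle)

local instance : IsProbabilityMeasure (volume : Measure UnitAddCircle) :=
  inferInstanceAs (IsProbabilityMeasure AddCircle.haarAddCircle)

variable {d : ℕ}

lemma hasSum_sq_mFourierCoeff_of_continuous {M : UnitAddTorus (Fin d) → ℂ} (hM : Continuous M) :
    HasSum (fun n => ‖mFourierCoeff M n‖ ^ 2) (∫ t, ‖M t‖ ^ 2) := by
  let f : C(UnitAddTorus (Fin d), ℂ) := ⟨M, hM⟩
  have h := hasSum_sq_mFourierCoeff (f.toLp 2 volume ℂ)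
  simp only [mFourierCoeff_toLp] at h
  have h1 : ∫ t, ‖M t‖ ^ 2 = ∫ t, ‖f.toLp 2 volume ℂ t‖ ^ 2 := by
    refine integral_congr_ae ?_
    filter_upwards [ContinuousMap.coeFn_toLp (p := 2) (𝕜 := ℂ) volume f] with t ht
    rw [ht]; rfl
  rw [h1]
  exact h

lemma sum_sq_mFourierCoeff_le {M : UnitAddTorus (Fin d) → ℂ} (hM : Continuous M) {A : ℝ}
    (hA : ∀ t, ‖M t‖ ≤ A) {s : Set (UnitAddTorus (Fin d))} (hs : ∀ t, M t ≠ 0 → t ∈ s)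
    (S : Finset (Fin d → ℤ)) :
    ∑ n ∈ S, ‖mFourierCoeff M n‖ ^ 2 ≤ A ^ 2 * volume.real s := by
  refine (sum_le_hasSum S (fun _ _ => sq_nonneg _)
    (hasSum_sq_mFourierCoeff_of_continuous hM)).trans ?_
  have hcont : Continuous fun t => ‖M t‖ ^ 2 := by fun_prop
  have hopen : MeasurableSet {t | M t ≠ 0} := (isOpen_ne_fun hM continuous_const).measurableSet
  have h1 : ∫ t, ‖M t‖ ^ 2 = ∫ t in {t | M t ≠ 0}, ‖M t‖ ^ 2 := by
    rw [setIntegral_eq_integral_of_forall_compl_eq_zero]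
    intro t ht
    have : M t = 0 := by simpa using ht
    simp [this]
  rw [h1]
  calc ∫ t in {t | M t ≠ 0}, ‖M t‖ ^ 2 ≤ ∫ t in {t | M t ≠ 0}, A ^ 2 := by
        refine setIntegral_mono ?_ ?_ fun t => ?_
        · exact (hcont.integrable_of_hasCompactSupport
            (HasCompactSupport.of_compactSpace _)).integrableOn
        · exact integrableOn_const
        · exact pow_le_pow_left₀ (norm_nonneg _) (hA t) 2
    _ = A ^ 2 * volume.real {t | M t ≠ 0} := by simp [mul_comm]
    _ ≤ A ^ 2 * volume.real s :=
        mul_le_mul_of_nonneg_left (measureReal_mono hs (measure_ne_top _ _)) (sq_nonneg A)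

lemma integrable_mFourier_smul {M : UnitAddTorus (Fin d) → ℂ} (hM : Continuous M)
    (n : Fin d → ℤ) : Integrable fun t => mFourier (-n) t • M t :=
  Continuous.integrable_of_hasCompactSupport (by fun_prop) (HasCompactSupport.of_compactSpace _)

lemma mFourier_add_apply (n : Fin d → ℤ) (s t : UnitAddTorus (Fin d)) :
    mFourier n (s + t) = mFourier n s * mFourier n t := by
  simp [mFourier, Finset.prod_mul_distrib, fourier_apply, smul_add, AddCircle.toCircle_add]

lemma mFourierCoeff_translate (M : UnitAddTorus (Fin d) → ℂ) (v : UnitAddTorus (Fin d))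
    (n : Fin d → ℤ) :
    mFourierCoeff (fun t => M (t + v)) n = mFourier n v * mFourierCoeff M n := by
  unfold mFourierCoeff
  rw [← integral_const_mul, ← integral_add_right_eq_self
    (fun t => mFourier n v * (mFourier (-n) t • M t)) v]
  refine integral_congr_ae (Filter.Eventually.of_forall fun t => ?_)
  simp only [mFourier_add_apply, smul_eq_mul]
  have : mFourier n v * mFourier (-n) v = 1 := by
    rw [← mFourier_add, add_neg_cancel, mFourier_zero]; rfl
  linear_combination -(mFourier (-n) t * M (t + v)) * this

lemma Continuous.fwdDiff_iter {M : UnitAddTorus (Fin d) → ℂ} (hM : Continuous M)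
    (v : UnitAddTorus (Fin d)) (r : ℕ) : Continuous ((fwdDiff v)^[r] M) := by
  induction r with
  | zero => exact hM
  | succ r ih =>
    rw [Function.iterate_succ_apply']
    exact (ih.comp (continuous_add_const v)).sub ih

lemma mFourierCoeff_fwdDiff_iter {M : UnitAddTorus (Fin d) → ℂ} (hM : Continuous M)
    (v : UnitAddTorus (Fin d)) (r : ℕ) (n : Fin d → ℤ) :
    mFourierCoeff ((fwdDiff v)^[r] M) n = (mFourier n v - 1) ^ r * mFourierCoeff M n := by
  induction r with
  | zero => simp
  | succ r ih =>
    have hc := hM.fwdDiff_iter v r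
    rw [Function.iterate_succ_apply', pow_succ', mul_assoc, ← ih, sub_mul, one_mul,
      ← mFourierCoeff_translate]
    unfold mFourierCoeff
    have h1 := integrable_mFourier_smul (hc.comp (continuous_add_const v)) n
    refine Eq.trans ?_ (integral_sub h1 (integrable_mFourier_smul hc n))
    simp only [fwdDiff, smul_eq_mul, mul_sub]

/-- The restriction of a function on the torus to a coordinate line. -/
def lineMap (M : UnitAddTorus (Fin d) → ℂ) (t : UnitAddTorus (Fin d)) (i : Fin d) (x : ℝ) : ℂ :=
  M (t + Pi.single i (x : UnitAddCircle))

lemma fwdDiff_iter_lineMap (M : UnitAddTorus (Fin d) → ℂ) (t : UnitAddTorus (Fin d)) (i : Fin d)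
    (h : ℝ) (r : ℕ) (x : ℝ) :
    (fwdDiff h)^[r] (lineMap M t i) x =
      lineMap ((fwdDiff (Pi.single i (h : UnitAddCircle)))^[r] M) t i x := by
  induction r generalizing x with
  | zero => rfl
  | succ r ih =>
    rw [Function.iterate_succ_apply', Function.iterate_succ_apply', fwdDiff, ih, ih]
    simp only [lineMap, fwdDiff, AddCircle.coe_add, Pi.single_add, add_assoc]

/-- Quantitative control of a multiplier on the torus at frequency scale `1 / l`. -/
structure IsMultiplierAt (r : ℕ) (V A l : ℝ) (M : UnitAddTorus (Fin d) → ℂ) : Prop where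
  continuous : Continuous M
  norm_le : ∀ t, ‖M t‖ ≤ A
  contDiff : ∀ t i, ContDiff ℝ r (lineMap M t i)
  norm_deriv_le : ∀ t i x, ‖iteratedDeriv r (lineMap M t i) x‖ ≤ A * l ^ r
  volume_le : volume.real {t | M t ≠ 0} ≤ V / l ^ d

variable {r : ℕ} {V A l : ℝ} {M : UnitAddTorus (Fin d) → ℂ}

lemma measureReal_fwdDiff_iter_ne_zero_le (M : UnitAddTorus (Fin d) → ℂ)
    (v : UnitAddTorus (Fin d)) (r : ℕ) :
    volume.real (⋃ k ∈ Finset.range (r + 1), {t | M (t + k • v) ≠ 0}) ≤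
      (r + 1) * volume.real {t | M t ≠ 0} := by
  refine (measureReal_biUnion_finset_le _ _).trans (le_of_eq ?_)
  have (k : ℕ) : volume.real {t | M (t + k • v) ≠ 0} = volume.real {t | M t ≠ 0} := by
    rw [measureReal_def, measureReal_def]
    congr 1
    exact measure_preimage_add_right volume (k • v) {t | M t ≠ 0}
  simp [this]

lemma one_le_norm_mFourier_single_sub_one {N : ℝ} (hN : 0 < N) {n : Fin d → ℤ} {i : Fin d}
    (h1 : N ≤ |(n i : ℝ)|) (h2 : |(n i : ℝ)| ≤ 2 * N) :
    1 ≤ ‖mFourier n (Pi.single i ((1 / (4 * N) : ℝ) : UnitAddCircle)) - 1‖ := by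
  have hπ := pi_pos
  have h0 : mFourier n (Pi.single i ((1 / (4 * N) : ℝ) : UnitAddCircle)) =
      fourier (n i) ((1 / (4 * N) : ℝ) : UnitAddCircle) := by
    rw [mFourier, ContinuousMap.coe_mk, Finset.prod_eq_single i]
    · rw [Pi.single_eq_same]
    · intro j _ hj
      rw [Pi.single_eq_of_ne hj, fourier_eval_zero]
    · simp
  have hx : |π * (n i * (1 / (4 * N)))| = π * |(n i : ℝ)| / (4 * N) := by
    rw [abs_mul, abs_mul, abs_of_pos hπ, abs_of_pos (by positivity : 0 < 1 / (4 * N))]; ring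
  have h2' : π * |(n i : ℝ)| / (4 * N) ≤ π / 2 := by
    rw [div_le_div_iff₀ (by positivity) (by norm_num)]; nlinarith
  rw [h0, fourier_coe_apply,
    show 2 * π * Complex.I * (n i : ℂ) * ((1 / (4 * N) : ℝ) : ℂ) / (1 : ℝ) =
    2 * π * Complex.I * ((n i * (1 / (4 * N)) : ℝ) : ℂ) by push_cast; ring,
    norm_cexp_two_pi_sub_one]
  have h3 := mul_abs_le_abs_sin (hx.trans_le h2')
  have h4 : 2 / π * (π * |(n i : ℝ)| / (4 * N)) = |(n i : ℝ)| / N / 2 := by field_simp; ring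
  rw [hx, h4] at h3
  linarith [(one_le_div hN).2 h1]

lemma IsMultiplierAt.sum_sq_le (h : IsMultiplierAt r V A l M) {N : ℝ} (hN : 0 < N) (i : Fin d)
    (S : Finset (Fin d → ℤ)) (hS : ∀ n ∈ S, N ≤ |(n i : ℝ)| ∧ |(n i : ℝ)| ≤ 2 * N) :
    ∑ n ∈ S, ‖mFourierCoeff M n‖ ^ 2 ≤
      (A * (l / (4 * N)) ^ r) ^ 2 * ((r + 1) * (V / l ^ d)) := by
  set v : UnitAddTorus (Fin d) := Pi.single i ((1 / (4 * N) : ℝ) : UnitAddCircle) with hv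
  have hbound (t) : ‖(fwdDiff v)^[r] M t‖ ≤ A * (l / (4 * N)) ^ r := by
    have h1 := norm_fwdDiff_iter_le (h := 1 / (4 * N)) (by positivity) (h.contDiff t i)
      (h.norm_deriv_le t i) 0
    rw [fwdDiff_iter_lineMap] at h1
    simp only [lineMap, AddCircle.coe_zero, Pi.single_zero, add_zero] at h1
    refine h1.trans (le_of_eq ?_)
    rw [div_pow, div_pow, one_pow]; ring
  have hsupp (t) (ht : (fwdDiff v)^[r] M t ≠ 0) :
      t ∈ ⋃ k ∈ Finset.range (r + 1), {t | M (t + k • v) ≠ 0} := by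
    rw [fwdDiff_iter_eq_sum_shift] at ht
    obtain ⟨k, hk, hk'⟩ := Finset.exists_ne_zero_of_sum_ne_zero ht
    simp only [Set.mem_iUnion]
    exact ⟨k, hk, fun h0 => hk' (by rw [h0, smul_zero])⟩
  calc ∑ n ∈ S, ‖mFourierCoeff M n‖ ^ 2
      ≤ ∑ n ∈ S, ‖mFourierCoeff ((fwdDiff v)^[r] M) n‖ ^ 2 := by
        refine Finset.sum_le_sum fun n hn => ?_
        rw [mFourierCoeff_fwdDiff_iter h.continuous, norm_mul, norm_pow]
        gcongr
        exact le_mul_of_one_le_left (norm_nonneg _)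
          (one_le_pow₀ (one_le_norm_mFourier_single_sub_one hN (hS n hn).1 (hS n hn).2))
    _ ≤ _ := (sum_sq_mFourierCoeff_le (h.continuous.fwdDiff_iter v r) hbound hsupp S)
    _ ≤ _ := by
        gcongr
        refine (measureReal_fwdDiff_iter_ne_zero_le M v r).trans ?_
        gcongr
        exact h.volume_le

lemma IsMultiplierAt.amplitude_nonneg (h : IsMultiplierAt r V A l M) : 0 ≤ A :=
  (norm_nonneg _).trans (h.norm_le 0)

lemma sum_norm_le_of_sq_le {S : Finset (Fin d → ℤ)} {u : (Fin d → ℤ) → ℂ} {A K X : ℝ} (hA : 0 ≤ A)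
    (hK : (S.card : ℝ) ≤ K) (hX : K * ∑ n ∈ S, ‖u n‖ ^ 2 ≤ A ^ 2 * X) :
    ∑ n ∈ S, ‖u n‖ ≤ A * √X := by
  have h1 : (∑ n ∈ S, ‖u n‖) ^ 2 ≤ A ^ 2 * X := by
    refine (sq_sum_le_card_mul_sum_sq).trans (le_trans ?_ hX)
    gcongr
  rw [← sqrt_sq hA, ← sqrt_mul (sq_nonneg A)]
  exact le_sqrt_of_sq_le h1

lemma IsMultiplierAt.sum_block_le (h : IsMultiplierAt r V A l M) (hr : d + 1 ≤ 2 * r) (hV : 0 ≤ V)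
    (hl : 0 < l) {N : ℕ} (hlN : l ≤ N) :
    ∑ n ∈ centredBox d (2 * N) \ centredBox d N, ‖mFourierCoeff M n‖ ≤
      A * √(d * (r + 1) * V * (l / N)) := by
  have hN : (0 : ℝ) < N := hl.trans_le hlN
  refine sum_norm_le_of_sq_le (K := (4 * N) ^ d) h.amplitude_nonneg ?_ ?_
  · calc ((centredBox d (2 * N) \ centredBox d N).card : ℝ) ≤ (centredBox d (2 * N)).card := by
          exact_mod_cast Finset.card_le_card Finset.sdiff_subset
      _ ≤ (2 * (2 * N : ℕ)) ^ d := card_centredBox_le d _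
      _ = (4 * N) ^ d := by push_cast; ring
  set S := centredBox d (2 * N) \ centredBox d N with hS
  have hsq : ∑ n ∈ S, ‖mFourierCoeff M n‖ ^ 2 ≤
      d * ((A * (l / (4 * N)) ^ r) ^ 2 * ((r + 1) * (V / l ^ d))) := by
    calc ∑ n ∈ S, ‖mFourierCoeff M n‖ ^ 2
        ≤ ∑ n ∈ S, ∑ i : Fin d, if (N : ℤ) ≤ |n i| then ‖mFourierCoeff M n‖ ^ 2 else 0 := by
          refine Finset.sum_le_sum fun n hn => ?_
          have hn2 := (Finset.mem_sdiff.1 hn).2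
          rw [mem_centredBox] at hn2
          push Not at hn2
          obtain ⟨i, hi⟩ := hn2
          have h1 := Finset.single_le_sum
            (f := fun i => if (N : ℤ) ≤ |n i| then ‖mFourierCoeff M n‖ ^ 2 else 0)
            (fun i _ => by positivity) (Finset.mem_univ i)
          simpa [hi] using h1
      _ = ∑ i : Fin d, ∑ n ∈ S.filter fun n => (N : ℤ) ≤ |n i|, ‖mFourierCoeff M n‖ ^ 2 := by
          simp only [Finset.sum_filter]
          exact Finset.sum_comm
      _ ≤ ∑ i : Fin d, (A * (l / (4 * N)) ^ r) ^ 2 * ((r + 1) * (V / l ^ d)) := by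
          refine Finset.sum_le_sum fun i _ => h.sum_sq_le hN i _ fun n hn => ?_
          obtain ⟨hn, hi⟩ := Finset.mem_filter.1 hn
          have h2 := mem_centredBox.1 (Finset.mem_sdiff.1 hn).1 i
          exact ⟨by exact_mod_cast hi, by exact_mod_cast h2.le⟩
      _ = _ := by simp
  set y := l / (4 * N) with hy
  have hy0 : 0 < y := by positivity
  have hy1 : y ≤ 1 := by rw [hy, div_le_one (by positivity)]; linarith
  have hyr : (y ^ r) ^ 2 ≤ y ^ d * (l / N) := by
    calc (y ^ r) ^ 2 = y ^ (2 * r) := by ring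
      _ ≤ y ^ (d + 1) := pow_le_pow_of_le_one hy0.le hy1 hr
      _ = y ^ d * y := pow_succ _ _
      _ ≤ y ^ d * (l / N) := by
          gcongr
          exact div_le_div_of_nonneg_left hl.le hN (by linarith)
  calc (4 * N : ℝ) ^ d * ∑ n ∈ S, ‖mFourierCoeff M n‖ ^ 2
      ≤ (4 * N : ℝ) ^ d * (d * ((A * y ^ r) ^ 2 * ((r + 1) * (V / l ^ d)))) := by gcongr
    _ = (4 * N : ℝ) ^ d * (d * (A ^ 2 * (y ^ r) ^ 2 * ((r + 1) * (V / l ^ d)))) := by ring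
    _ ≤ (4 * N : ℝ) ^ d * (d * (A ^ 2 * (y ^ d * (l / N)) * ((r + 1) * (V / l ^ d)))) := by gcongr
    _ = A ^ 2 * (d * (r + 1) * V * (l / N)) := by
        rw [hy, div_pow]; field_simp

lemma IsMultiplierAt.sum_box_le (h : IsMultiplierAt r V A l M) (N : ℕ) :
    ∑ n ∈ centredBox d N, ‖mFourierCoeff M n‖ ≤ A * √((2 * (N / l)) ^ d * V) := by
  refine sum_norm_le_of_sq_le h.amplitude_nonneg (card_centredBox_le d N) ?_
  have h1 := sum_sq_mFourierCoeff_le h.continuous h.norm_le (s := {t | M t ≠ 0}) (fun _ ht => ht)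
    (centredBox d N)
  calc (2 * N : ℝ) ^ d * ∑ n ∈ centredBox d N, ‖mFourierCoeff M n‖ ^ 2
      ≤ (2 * N : ℝ) ^ d * (A ^ 2 * (V / l ^ d)) := by
        gcongr
        refine h1.trans ?_
        gcongr
        exact h.volume_le
    _ = _ := by rw [← mul_div_assoc 2, div_pow]; ring

lemma IsMultiplierAt.sum_shell_le (h : IsMultiplierAt r V A l M) (hr : d + 1 ≤ 2 * r) (hV : 0 ≤ V)
    (hl : 0 < l) {N : ℕ} (hlN : l ≤ N) (m : ℕ) :
    ∑ n ∈ centredBox d (2 ^ m * N) \ centredBox d N, ‖mFourierCoeff M n‖ ≤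
      ∑ i ∈ Finset.range m, A * √(d * (r + 1) * V * (l / N)) * (1 / √2) ^ i := by
  classical
  induction m with
  | zero => simp
  | succ m ih =>
    rw [Finset.sum_range_succ]
    have hsub : centredBox d (2 ^ (m + 1) * N) \ centredBox d N ⊆
        (centredBox d (2 ^ m * N) \ centredBox d N) ∪
          (centredBox d (2 * (2 ^ m * N)) \ centredBox d (2 ^ m * N)) := by
      intro n hn
      rw [Finset.mem_sdiff] at hn
      rw [Finset.mem_union, Finset.mem_sdiff, Finset.mem_sdiff,
        show 2 * (2 ^ m * N) = 2 ^ (m + 1) * N by ring]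
      tauto
    refine (Finset.sum_le_sum_of_subset_of_nonneg hsub fun _ _ _ => norm_nonneg _).trans ?_
    rw [Finset.sum_union (Finset.disjoint_left.2 fun n hn hn' =>
      (Finset.mem_sdiff.1 hn').2 (Finset.mem_sdiff.1 hn).1)]
    refine add_le_add ih ?_
    have h1 : (1 : ℝ) ≤ 2 ^ m := one_le_pow₀ one_le_two
    refine (h.sum_block_le hr hV hl (N := 2 ^ m * N) ?_).trans (le_of_eq ?_)
    · push_cast; nlinarith
    · have h2 : (1 / √2) ^ m = √((1 / 2) ^ m) := by
        rw [eq_comm, Real.sqrt_eq_iff_mul_self_eq (by positivity) (by positivity), ← mul_pow,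
          div_mul_div_comm, mul_self_sqrt (by norm_num), one_mul]
      rw [h2, mul_assoc A, ← sqrt_mul (by positivity)]
      congr 2
      push_cast
      field_simp
      simp

lemma exists_subset_centredBox {N : ℕ} (hN : 1 ≤ N) (S : Finset (Fin d → ℤ)) :
    ∃ m, S ⊆ centredBox d (2 ^ m * N) := by
  let B := S.sup fun n => ∑ i, (n i).natAbs
  refine ⟨B, fun n hn => mem_centredBox.2 fun i => ?_⟩
  have h1 : (n i).natAbs ≤ B :=
    (Finset.single_le_sum (f := fun i => (n i).natAbs) (fun _ _ => Nat.zero_le _)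
      (Finset.mem_univ i)).trans (Finset.le_sup (f := fun n : Fin d → ℤ => ∑ i, (n i).natAbs) hn)
  have h2 : (n i).natAbs < 2 ^ B * N :=
    (h1.trans_lt Nat.lt_two_pow_self).trans_le (Nat.le_mul_of_pos_right _ hN)
  rw [Int.abs_eq_natAbs]
  exact_mod_cast h2

lemma IsMultiplierAt.sum_tail_le (h : IsMultiplierAt r V A l M) (hr : d + 1 ≤ 2 * r) (hV : 0 ≤ V)
    (hl : 0 < l) {N : ℕ} (hlN : l ≤ N) (S : Finset (Fin d → ℤ)) (hS : Disjoint S (centredBox d N)) :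
    ∑ n ∈ S, ‖mFourierCoeff M n‖ ≤ A * (4 * √(d * (r + 1) * V)) * √(l / N) := by
  have hN : 1 ≤ N := by
    have : (0 : ℝ) < N := hl.trans_le hlN
    exact_mod_cast this
  obtain ⟨m, hm⟩ := exists_subset_centredBox hN S
  have hA := h.amplitude_nonneg
  calc ∑ n ∈ S, ‖mFourierCoeff M n‖
      ≤ ∑ n ∈ centredBox d (2 ^ m * N) \ centredBox d N, ‖mFourierCoeff M n‖ := by
        refine Finset.sum_le_sum_of_subset_of_nonneg (fun n hn => ?_) fun _ _ _ => norm_nonneg _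
        exact Finset.mem_sdiff.2 ⟨hm hn, Finset.disjoint_left.1 hS hn⟩
    _ ≤ A * √(d * (r + 1) * V * (l / N)) * ∑ i ∈ Finset.range m, (1 / √2) ^ i := by
        rw [Finset.mul_sum]; exact h.sum_shell_le hr hV hl hlN m
    _ ≤ A * √(d * (r + 1) * V * (l / N)) * 4 := by
        gcongr; exact sum_geometric_sqrt_two_le m
    _ = _ := by rw [sqrt_mul (by positivity)]; ring

lemma IsMultiplierAt.tsum_tail_le (h : IsMultiplierAt r V A l M) (hr : d + 1 ≤ 2 * r) (hV : 0 ≤ V)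
    (hl : 0 < l) {N : ℕ} (hlN : l ≤ N) :
    ∑' n, (if n ∈ centredBox d N then 0 else ‖mFourierCoeff M n‖ₑ) ≤
      ENNReal.ofReal (A * (4 * √(d * (r + 1) * V)) * √(l / N)) := by
  classical
  rw [ENNReal.tsum_eq_iSup_sum]
  refine iSup_le fun S => ?_
  have h1 := h.sum_tail_le hr hV hl hlN (S \ centredBox d N) Finset.sdiff_disjoint
  refine le_trans (le_of_eq ?_) (ENNReal.ofReal_le_ofReal h1)
  rw [ENNReal.ofReal_sum_of_nonneg fun _ _ => norm_nonneg _, Finset.sdiff_eq_filter,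
    Finset.sum_filter]
  refine Finset.sum_congr rfl fun n _ => ?_
  split_ifs <;> simp_all

/-- The `ℓ¹` norm of the kernel of a multiplier. -/
lemma IsMultiplierAt.tsum_le (h : IsMultiplierAt r V A l M) (hr : d + 1 ≤ 2 * r) (hV : 0 ≤ V)
    {l₀ : ℝ} (hl₀ : 0 < l₀) (hl : l₀ ≤ l) :
    ∑' n, ‖mFourierCoeff M n‖ₑ ≤
      ENNReal.ofReal (A * (√((2 * (1 + 1 / l₀)) ^ d * V) + 4 * √(d * (r + 1) * V))) := by
  classical
  have hl' : 0 < l := hl₀.trans_le hl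
  have hA := h.amplitude_nonneg
  have hlN : l ≤ ⌈l⌉₊ := Nat.le_ceil l
  have hNl : ⌈l⌉₊ / l ≤ 1 + 1 / l₀ := by
    rw [div_le_iff₀ hl', add_mul, one_mul]
    have h1 : 1 ≤ 1 / l₀ * l := by rw [one_div_mul_eq_div]; exact (one_le_div hl₀).2 hl
    linarith [Nat.ceil_lt_add_one hl'.le]
  have hlN1 : l / ⌈l⌉₊ ≤ 1 := div_le_one_of_le₀ hlN (by positivity)
  rw [ENNReal.tsum_eq_iSup_sum]
  refine iSup_le fun S => ?_
  have h1 := h.sum_tail_le hr hV hl' hlN (S \ centredBox d ⌈l⌉₊) Finset.sdiff_disjoint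
  have h2 := h.sum_box_le ⌈l⌉₊
  have h3 : ∑ n ∈ S, ‖mFourierCoeff M n‖ ≤
      A * (√((2 * (1 + 1 / l₀)) ^ d * V) + 4 * √(d * (r + 1) * V)) := by
    calc ∑ n ∈ S, ‖mFourierCoeff M n‖
        ≤ ∑ n ∈ centredBox d ⌈l⌉₊ ∪ (S \ centredBox d ⌈l⌉₊), ‖mFourierCoeff M n‖ := by
          refine Finset.sum_le_sum_of_subset_of_nonneg ?_ fun _ _ _ => norm_nonneg _
          rw [Finset.union_sdiff_self_eq_union]
          exact Finset.subset_union_right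
      _ = _ := Finset.sum_union Finset.disjoint_sdiff
      _ ≤ A * √((2 * (⌈l⌉₊ / l)) ^ d * V) +
          A * (4 * √(d * (r + 1) * V)) * √(l / ⌈l⌉₊) := add_le_add h2 h1
      _ ≤ A * √((2 * (1 + 1 / l₀)) ^ d * V) + A * (4 * √(d * (r + 1) * V)) * √1 := by gcongr
      _ = _ := by rw [sqrt_one]; ring
  refine le_trans (le_of_eq ?_) (ENNReal.ofReal_le_ofReal h3)
  rw [ENNReal.ofReal_sum_of_nonneg fun _ _ => norm_nonneg _]
  simp

lemma fourier_one_coe (x : ℝ) :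
    fourier 1 (x : UnitAddCircle) = Complex.exp (2 * π * Complex.I * x) := by
  rw [fourier_coe_apply]; simp

lemma norm_fourier_one_sub_one_sq (x : ℝ) :
    ‖fourier 1 (x : UnitAddCircle) - 1‖ ^ 2 = 2 - 2 * cos (2 * π * x) := by
  rw [fourier_one_coe, norm_cexp_two_pi_sub_one, mul_pow, sq_abs, sin_sq_eq_half_sub]
  ring_nf

lemma four_mul_norm_le (x : UnitAddCircle) : 4 * ‖x‖ ≤ ‖fourier 1 x - 1‖ := by
  obtain ⟨y, rfl⟩ := QuotientAddGroup.mk_surjective x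
  change 4 * ‖(y : UnitAddCircle)‖ ≤ ‖fourier 1 (y : UnitAddCircle) - 1‖
  have hπ := pi_pos
  have h0 : ((y - round y : ℝ) : UnitAddCircle) = y := by
    rw [AddCircle.coe_sub, sub_eq_self, AddCircle.coe_eq_zero_iff]
    exact ⟨round y, by simp⟩
  have h1 : ‖(y : UnitAddCircle)‖ = |y - round y| := UnitAddCircle.norm_eq
  rw [h1, ← h0, fourier_one_coe, norm_cexp_two_pi_sub_one]
  have h2 := abs_sub_round y
  set z := y - round y
  have h3 := mul_abs_le_abs_sin (x := π * z) (by
    rw [abs_mul, abs_of_pos hπ]; nlinarith)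
  rw [abs_mul, abs_of_pos hπ, ← mul_assoc, div_mul_cancel₀ _ hπ.ne'] at h3
  linarith

/-- The symbol of the discrete Laplacian on the torus. -/
noncomputable def torusSymbol (θ : UnitAddTorus (Fin d)) : ℝ := ∑ j, ‖fourier 1 (θ j) - 1‖ ^ 2

lemma continuous_torusSymbol : Continuous (torusSymbol (d := d)) := by
  unfold torusSymbol; fun_prop

lemma torusSymbol_nonneg (θ : UnitAddTorus (Fin d)) : 0 ≤ torusSymbol θ :=
  Finset.sum_nonneg fun _ _ => sq_nonneg _

lemma torusSymbol_le (θ : UnitAddTorus (Fin d)) : torusSymbol θ ≤ 4 * d := by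
  have h (x : UnitAddCircle) : ‖fourier 1 x - 1‖ ^ 2 ≤ 4 := by
    have h1 : ‖fourier 1 x - 1‖ ≤ 2 := by
      refine (norm_sub_le _ _).trans (le_of_eq ?_)
      rw [fourier_apply, Circle.norm_coe, norm_one]; norm_num
    nlinarith [norm_nonneg (fourier 1 x - 1)]
  refine (Finset.sum_le_sum fun j _ => h (θ j)).trans (le_of_eq ?_)
  simp [mul_comm]

lemma exists_sq_mul_torusSymbol_eq (l : ℝ) (t : UnitAddTorus (Fin d)) (i : Fin d) :
    ∃ s y : ℝ, 0 ≤ s ∧ (y : UnitAddCircle) = t i ∧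
      ∀ x : ℝ, l ^ 2 * torusSymbol (t + Pi.single i (x : UnitAddCircle)) = lineSymbol l s y x := by
  obtain ⟨y, hy⟩ := QuotientAddGroup.mk_surjective (t i)
  refine ⟨∑ j ∈ Finset.univ.erase i, ‖fourier 1 (t j) - 1‖ ^ 2, y,
    Finset.sum_nonneg fun _ _ => sq_nonneg _, hy, fun x => ?_⟩
  rw [lineSymbol, torusSymbol, ← Finset.sum_erase_add _ _ (Finset.mem_univ i)]
  have h1 : (t + Pi.single i (x : UnitAddCircle) : UnitAddTorus (Fin d)) i =
      ((y + x : ℝ) : UnitAddCircle) := by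
    rw [Pi.add_apply, Pi.single_eq_same, ← hy]; rfl
  rw [h1, norm_fourier_one_sub_one_sq]
  have h2 : ∑ j ∈ Finset.univ.erase i,
      ‖fourier 1 ((t + Pi.single i (x : UnitAddCircle) : UnitAddTorus (Fin d)) j) - 1‖ ^ 2
      = ∑ j ∈ Finset.univ.erase i, ‖fourier 1 (t j) - 1‖ ^ 2 := by
    refine Finset.sum_congr rfl fun j hj => ?_
    rw [Pi.add_apply, Pi.single_eq_of_ne (Finset.ne_of_mem_erase hj), add_zero]
  rw [h2]; ring

lemma measureReal_torusSymbol_le {b : ℝ} (hl : 0 < l) (hb : 0 ≤ b) :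
    volume.real {θ : UnitAddTorus (Fin d) | l ^ 2 * torusSymbol θ ≤ b ^ 2} ≤
      (b / 2) ^ d / l ^ d := by
  have hsub : {θ : UnitAddTorus (Fin d) | l ^ 2 * torusSymbol θ ≤ b ^ 2} ⊆
      Set.univ.pi fun _ => Metric.closedBall (0 : UnitAddCircle) (b / (4 * l)) := by
    intro θ hθ j _
    rw [Metric.mem_closedBall, dist_zero_right, le_div_iff₀ (by positivity)]
    have h1 : ‖fourier 1 (θ j) - 1‖ ^ 2 ≤ torusSymbol θ :=
      Finset.single_le_sum (f := fun j => ‖fourier 1 (θ j) - 1‖ ^ 2) (fun _ _ => sq_nonneg _)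
        (Finset.mem_univ j)
    have h2 : (l * ‖fourier 1 (θ j) - 1‖) ^ 2 ≤ b ^ 2 := by
      rw [mul_pow]
      exact (mul_le_mul_of_nonneg_left h1 (sq_nonneg l)).trans hθ
    have h3 := (pow_le_pow_iff_left₀ (by positivity) hb two_ne_zero).1 h2
    nlinarith [four_mul_norm_le (θ j)]
  have hball : volume (Metric.closedBall (0 : UnitAddCircle) (b / (4 * l))) ≤
      ENNReal.ofReal (b / 2 / l) := by
    have h0 : (AddCircle.haarAddCircle : Measure UnitAddCircle)
        (Metric.closedBall (0 : UnitAddCircle) (b / (4 * l))) =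
        (AddCircle.measureSpace 1).volume (Metric.closedBall (0 : UnitAddCircle) (b / (4 * l))) := by
      rw [AddCircle.volume_eq_smul_haarAddCircle]; simp
    change (AddCircle.haarAddCircle : Measure UnitAddCircle) _ ≤ _
    rw [h0, AddCircle.volume_closedBall]
    refine ENNReal.ofReal_le_ofReal ((min_le_right _ _).trans (le_of_eq ?_))
    field_simp
    ring
  rw [measureReal_def]
  refine ENNReal.toReal_le_of_le_ofReal (by positivity) ((measure_mono hsub).trans ?_)
  rw [volume_pi_pi, Finset.prod_const, Finset.card_univ, Fintype.card_fin, ← div_pow,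
    ENNReal.ofReal_pow (by positivity)]
  gcongr

lemma isMultiplierAt_mul {l₀ b a G : ℝ} (hl₀ : 0 < l₀) (hl₁ : l₀ ≤ 1)
    (hl : l₀ ≤ l) (hb : 1 ≤ b) (hG0 : 0 ≤ G) (ha : 0 ≤ a) {g : ℝ → ℂ}
    (hg : ContDiff ℝ r g) (hgsupp : ∀ t, b ^ 2 < t → g t = 0)
    (hG : ∀ i ≤ r, ∀ t, ‖iteratedFDeriv ℝ i g t‖ ≤ G) {W : UnitAddTorus (Fin d) → ℂ}
    (hW : Continuous W) (hW0 : ∀ t, l ^ 2 * torusSymbol t ≤ b ^ 2 → ‖W t‖ ≤ a)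
    (hW1 : ∀ t i, ContDiff ℝ r (lineMap W t i))
    (hWa : ∀ t i (x : ℝ),
      l ^ 2 * torusSymbol (t + Pi.single i (x : UnitAddCircle)) ≤ b ^ 2 → ∀ k ≤ r,
      ‖iteratedFDeriv ℝ k (lineMap W t i) x‖ ≤ a * (4 * π * b / l₀ * l) ^ k) :
    IsMultiplierAt r ((b / 2) ^ d) (a * (2 ^ r * r.factorial * G * (4 * π * b / l₀) ^ r)) l
      (fun t => g (l ^ 2 * torusSymbol t) * W t) := by
  have hl' : 0 < l := hl₀.trans_le hl
  have hπ := pi_pos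
  have hsupp (t : UnitAddTorus (Fin d)) (ht : g (l ^ 2 * torusSymbol t) ≠ 0) :
      l ^ 2 * torusSymbol t ≤ b ^ 2 :=
    not_lt.1 fun h => ht (hgsupp _ h)
  refine ⟨(hg.continuous.comp (continuous_const.mul continuous_torusSymbol)).mul hW, fun t => ?_,
    fun t i => ?_, fun t i x => ?_, ?_⟩
  · by_cases ht : g (l ^ 2 * torusSymbol t) = 0
    · rw [ht, zero_mul, norm_zero]; positivity
    have h1 := hW0 t (hsupp t ht)
    have h2 : ‖g (l ^ 2 * torusSymbol t)‖ ≤ G := by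
      have := hG 0 (Nat.zero_le _) (l ^ 2 * torusSymbol t)
      rwa [norm_iteratedFDeriv_zero] at this
    have h3 : (1 : ℝ) ≤ 4 * π * b / l₀ := by
      rw [le_div_iff₀ hl₀]; nlinarith [pi_gt_three]
    have h4 : (1 : ℝ) ≤ 2 ^ r * r.factorial * (4 * π * b / l₀) ^ r :=
      one_le_mul_of_one_le_of_one_le
        (one_le_mul_of_one_le_of_one_le (one_le_pow₀ one_le_two)
          (by exact_mod_cast r.factorial_pos)) (one_le_pow₀ h3)
    rw [norm_mul]
    calc _ ≤ G * a := by gcongr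
      _ ≤ G * a * (2 ^ r * r.factorial * (4 * π * b / l₀) ^ r) :=
        le_mul_of_one_le_right (by positivity) h4
      _ = _ := by ring
  · obtain ⟨s, y, -, -, h⟩ := exists_sq_mul_torusSymbol_eq l t i
    have h1 : lineMap (fun t => g (l ^ 2 * torusSymbol t) * W t) t i =
        fun x => g (lineSymbol l s y x) * lineMap W t i x := by
      funext x; rw [← h x, lineMap, lineMap]
    rw [h1]
    exact (hg.comp (contDiff_lineSymbol l s y)).mul (hW1 t i)
  · obtain ⟨s, y, hs, -, h⟩ := exists_sq_mul_torusSymbol_eq l t i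
    have h1 : lineMap (fun t => g (l ^ 2 * torusSymbol t) * W t) t i =
        fun x => g (lineSymbol l s y x) * lineMap W t i x := by
      funext x; rw [← h x, lineMap, lineMap]
    rw [h1]
    refine (norm_iteratedDeriv_multiplier_le hl₀ hl₁ hl hb hs hG0 ha hg hgsupp hG (hW1 t i)
      (fun x hx => hWa t i x (by rwa [h x])) x).trans (le_of_eq ?_)
    rw [mul_pow]; ring
  · refine le_trans (measureReal_mono (fun t ht => ?_) (measure_ne_top _ _))
      (measureReal_torusSymbol_le hl' (b := b) (by linarith))
    exact hsupp t fun h => ht (by simp [h])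

lemma isMultiplierAt_torusSymbol {l₀ b G : ℝ} (hl₀ : 0 < l₀) (hl₁ : l₀ ≤ 1)
    (hl : l₀ ≤ l) (hb : 1 ≤ b) (hG0 : 0 ≤ G) {g : ℝ → ℂ}
    (hg : ContDiff ℝ r g) (hgsupp : ∀ t, b ^ 2 < t → g t = 0)
    (hG : ∀ i ≤ r, ∀ t, ‖iteratedFDeriv ℝ i g t‖ ≤ G) :
    IsMultiplierAt r ((b / 2) ^ d) (2 ^ r * r.factorial * G * (4 * π * b / l₀) ^ r) l
      (fun t : UnitAddTorus (Fin d) => g (l ^ 2 * torusSymbol t)) := by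
  have hl' : 0 < l := hl₀.trans_le hl
  have hπ := pi_pos
  have h := isMultiplierAt_mul (d := d) hl₀ hl₁ hl hb hG0 zero_le_one hg hgsupp hG
    (W := fun _ => 1) continuous_const (by simp) (fun _ _ => contDiff_const) (by
      intro t i x _ k _
      change ‖iteratedFDeriv ℝ k (fun _ : ℝ => (1 : ℂ)) x‖ ≤ _
      rcases Nat.eq_zero_or_pos k with rfl | hk
      · simp
      · rw [iteratedFDeriv_const_of_ne hk.ne']
        simp only [Pi.zero_apply, norm_zero]
        positivity)
  simpa using h

lemma isMultiplierAt_torusSymbol_mul_sub_one {l₀ b G : ℝ} (hl₀ : 0 < l₀) (hl₁ : l₀ ≤ 1)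
    (hl : l₀ ≤ l) (hb : 1 ≤ b) (hG0 : 0 ≤ G) {g : ℝ → ℂ}
    (hg : ContDiff ℝ r g) (hgsupp : ∀ t, b ^ 2 < t → g t = 0)
    (hG : ∀ i ≤ r, ∀ t, ‖iteratedFDeriv ℝ i g t‖ ≤ G) (j : Fin d) :
    IsMultiplierAt r ((b / 2) ^ d) (b / l * (2 ^ r * r.factorial * G * (4 * π * b / l₀) ^ r)) l
      (fun t : UnitAddTorus (Fin d) => g (l ^ 2 * torusSymbol t) * (fourier 1 (t j) - 1)) := by
  have hl' : 0 < l := hl₀.trans_le hl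
  have hπ := pi_pos
  have hline (t : UnitAddTorus (Fin d)) (i : Fin d) (hij : j ≠ i) :
      lineMap (fun t => fourier 1 (t j) - 1) t i = fun _ => fourier 1 (t j) - 1 := by
    funext x
    rw [lineMap, Pi.add_apply, Pi.single_eq_of_ne hij, add_zero]
  have hline' (t : UnitAddTorus (Fin d)) (y : ℝ) (hy : (y : UnitAddCircle) = t j) :
      lineMap (fun t => fourier 1 (t j) - 1) t j =
        fun x : ℝ => Complex.exp (2 * π * Complex.I * (y + x : ℝ)) - 1 := by
    funext x
    rw [lineMap, Pi.add_apply, Pi.single_eq_same, ← hy, ← AddCircle.coe_add, fourier_one_coe]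
  have hbase (t : UnitAddTorus (Fin d)) (ht : l ^ 2 * torusSymbol t ≤ b ^ 2) :
      ‖fourier 1 (t j) - 1‖ ≤ b / l := by
    have h1 : ‖fourier 1 (t j) - 1‖ ^ 2 ≤ torusSymbol t :=
      Finset.single_le_sum (f := fun j => ‖fourier 1 (t j) - 1‖ ^ 2) (fun _ _ => sq_nonneg _)
        (Finset.mem_univ j)
    have h2 : (l * ‖fourier 1 (t j) - 1‖) ^ 2 ≤ b ^ 2 := by
      rw [mul_pow]
      exact (mul_le_mul_of_nonneg_left h1 (sq_nonneg l)).trans ht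
    rw [le_div_iff₀ hl', mul_comm]
    exact (pow_le_pow_iff_left₀ (by positivity) (by positivity) two_ne_zero).1 h2
  refine isMultiplierAt_mul (d := d) hl₀ hl₁ hl hb hG0 (by positivity) hg hgsupp hG
    (by fun_prop) hbase (fun t i => ?_) fun t i x hx k _ => ?_
  · by_cases hij : j = i
    · subst hij
      obtain ⟨s, y, -, hy, -⟩ := exists_sq_mul_torusSymbol_eq l t j
      rw [hline' t y hy]
      have h1 : ContDiff ℝ r fun x : ℝ => ((y + x : ℝ) : ℂ) :=
        Complex.ofRealCLM.contDiff.comp (contDiff_const.add contDiff_id)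
      fun_prop
    · rw [hline t i hij]; exact contDiff_const
  · by_cases hij : j = i
    · subst hij
      obtain ⟨s, y, hs, hy, h⟩ := exists_sq_mul_torusSymbol_eq l t j
      rw [hline' t y hy]
      exact norm_iteratedFDeriv_cexp_sub_one_le hl₀ hl₁ hl hb hs (by rwa [← h]) k
    · rw [hline t i hij]
      rcases Nat.eq_zero_or_pos k with rfl | hk
      · rw [norm_iteratedFDeriv_zero, pow_zero, mul_one]
        have := hbase _ hx
        rwa [Pi.add_apply, Pi.single_eq_of_ne hij, add_zero] at this
      · rw [iteratedFDeriv_const_of_ne hk.ne']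
        simp only [Pi.zero_apply, norm_zero]
        positivity

/-- The Littlewood–Paley multiplier `g(4^{-k} σ)`, where `σ` is the symbol of the discrete
Laplacian. -/
noncomputable def lpMultiplier (g : ℝ → ℂ) (k : ℤ) (t : UnitAddTorus (Fin d)) : ℂ :=
  g (((2 : ℝ) ^ (-k)) ^ 2 * torusSymbol t)

/-- The convolution kernel of a Littlewood–Paley multiplier. -/
noncomputable def lpKernel (g : ℝ → ℂ) (k : ℤ) (n : Fin d → ℤ) : ℂ :=
  mFourierCoeff (lpMultiplier g k) n

lemma mFourierCoeff_mul_mFourier (M : UnitAddTorus (Fin d) → ℂ) (m n : Fin d → ℤ) :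
    mFourierCoeff (fun t => M t * mFourier m t) n = mFourierCoeff M (n - m) := by
  refine integral_congr_ae (Filter.Eventually.of_forall fun t => ?_)
  simp only [smul_eq_mul]
  rw [neg_sub, sub_eq_add_neg, mFourier_add]
  ring

lemma isLPKernel_lpKernel {r : ℕ} (hd : 1 ≤ d) (hr : d + 1 ≤ 2 * r) {ε : ℝ} (hε0 : 0 < ε)
    (hε1 : ε < 1) {g : ℝ → ℂ} (hg : ContDiff ℝ r g)
    (hgsupp : ∀ t, t ∉ Set.Icc (ε ^ 2) (ε⁻¹ ^ 2) → g t = 0) :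
    ∃ C, IsLPKernel C (lpKernel (d := d) g) := by
  obtain ⟨G, hG0, hG⟩ := exists_iteratedFDeriv_le hg
    (HasCompactSupport.intro isCompact_Icc fun t ht => hgsupp t ht)
  have hd0 : (1 : ℝ) ≤ d := by exact_mod_cast hd
  set b := ε⁻¹ with hb_def
  have hb : 1 ≤ b := (one_le_inv₀ hε0).2 hε1.le
  have hsupp (t : ℝ) (ht : b ^ 2 < t) : g t = 0 := hgsupp t fun h => (h.2.trans_lt ht).false
  set l₀ := ε / (2 * d) with hl₀_def
  have hl₀ : 0 < l₀ := by positivity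
  have hl₁ : l₀ ≤ 1 := by rw [hl₀_def, div_le_one (by positivity)]; linarith
  set A := 2 ^ r * r.factorial * G * (4 * π * b / l₀) ^ r with hA_def
  have hπ := pi_pos
  have hA : 0 ≤ A := by positivity
  set V := (b / 2) ^ d with hV_def
  have hV : 0 ≤ V := by positivity
  set C₁ := A * (4 * √(d * (r + 1) * V)) with hC₁
  set C₂ := b * A * (√((2 * (1 + 1 / l₀)) ^ d * V) + 4 * √(d * (r + 1) * V)) with hC₂
  have hC₁0 : 0 ≤ C₁ := by positivity
  have hC₂0 : 0 ≤ C₂ := by positivity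
  have hzero (k : ℤ) (hk : (2 : ℝ) ^ (-k) < l₀) (n : Fin d → ℤ) : lpKernel g k n = 0 := by
    have h1 : lpMultiplier (d := d) g k = fun _ => 0 := by
      funext t
      refine hgsupp _ fun h => h.1.not_gt ?_
      have h2 : (0 : ℝ) < 2 ^ (-k) := by positivity
      calc ((2 : ℝ) ^ (-k)) ^ 2 * torusSymbol t ≤ ((2 : ℝ) ^ (-k)) ^ 2 * (4 * d) := by
            gcongr; exact torusSymbol_le t
        _ < l₀ ^ 2 * (4 * d) := by gcongr
        _ = ε ^ 2 / d := by rw [hl₀_def]; field_simp; ring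
        _ ≤ ε ^ 2 := div_le_self (by positivity) hd0
    rw [lpKernel, h1, mFourierCoeff]
    simp
  refine ⟨C₁ + C₂, by positivity, fun k N hN => ?_, fun k i => ?_⟩
  · rcases lt_or_ge ((2 : ℝ) ^ (-k)) l₀ with hk | hk
    · simp [hzero k hk]
    · have h := isMultiplierAt_torusSymbol (d := d) hl₀ hl₁ hk hb hG0 hg hsupp hG
      refine (h.tsum_tail_le hr hV (by positivity) hN).trans (ENNReal.ofReal_le_ofReal ?_)
      gcongr
      linarith
  · rcases lt_or_ge ((2 : ℝ) ^ (-k)) l₀ with hk | hk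
    · simp [shiftDiff, hzero k hk]
    · have h := isMultiplierAt_torusSymbol_mul_sub_one (d := d) hl₀ hl₁ hk hb hG0 hg hsupp hG i
      have h0 := isMultiplierAt_torusSymbol (d := d) hl₀ hl₁ hk hb hG0 hg hsupp hG
      have h1 (n : Fin d → ℤ) : mFourierCoeff (fun t : UnitAddTorus (Fin d) =>
          g (((2 : ℝ) ^ (-k)) ^ 2 * torusSymbol t) * (fourier 1 (t i) - 1)) n =
            lpKernel g k (n + -Pi.single i 1) - lpKernel g k n := by
        rw [← sub_eq_add_neg, lpKernel, ← mFourierCoeff_mul_mFourier]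
        refine Eq.trans (integral_congr_ae (Filter.Eventually.of_forall fun t => ?_)) (integral_sub
          (integrable_mFourier_smul (h0.continuous.mul (mFourier (Pi.single i 1)).continuous) n)
          (integrable_mFourier_smul h0.continuous n))
        simp only [mFourier_single, smul_eq_mul]
        rw [lpMultiplier]
        ring
      rw [← shiftDiff_neg, shiftDiff]
      simp only [← h1]
      refine (h.tsum_le hr hV hl₀ hk).trans (ENNReal.ofReal_le_ofReal ?_)
      calc _ = C₂ * 2 ^ k := by
            rw [hC₂, zpow_neg, div_inv_eq_mul]; ring
        _ ≤ _ := by gcongr; linarith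

/-- The trigonometric polynomial with finitely supported coefficients `f`. -/
noncomputable def trigPoly (f : (Fin d → ℤ) →₀ ℂ) (t : UnitAddTorus (Fin d)) : ℂ :=
  ∑ m ∈ f.support, f m * mFourier m t

lemma continuous_trigPoly (f : (Fin d → ℤ) →₀ ℂ) : Continuous (trigPoly f) := by
  unfold trigPoly; fun_prop

lemma mFourierCoeff_mul_trigPoly {M : UnitAddTorus (Fin d) → ℂ} (hM : Continuous M)
    (f : (Fin d → ℤ) →₀ ℂ) (n : Fin d → ℤ) :
    mFourierCoeff (fun t => M t * trigPoly f t) n =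
      ∑ m ∈ f.support, f m * mFourierCoeff M (n - m) := by
  simp_rw [← mFourierCoeff_mul_mFourier, mFourierCoeff, ← integral_const_mul]
  rw [← integral_finsetSum]
  · refine integral_congr_ae (Filter.Eventually.of_forall fun t => ?_)
    simp only [trigPoly, smul_eq_mul, Finset.mul_sum]
    exact Finset.sum_congr rfl fun m _ => by ring
  · exact fun m _ => (integrable_mFourier_smul (by fun_prop) n).const_mul _

lemma mFourierCoeff_one (n : Fin d → ℤ) :
    mFourierCoeff (fun _ : UnitAddTorus (Fin d) => (1 : ℂ)) n = if n = 0 then 1 else 0 := by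
  split_ifs with hn
  · simp [hn, mFourierCoeff, mFourier_zero]
  · obtain ⟨i, hi⟩ := Function.ne_iff.1 hn
    have hi' : (0 : ℝ) < |(n i : ℝ)| := by simpa using hi
    have h1 := one_le_norm_mFourier_single_sub_one hi' le_rfl (by linarith)
    set v : UnitAddTorus (Fin d) := Pi.single i ((1 / (4 * |(n i : ℝ)|) : ℝ) : UnitAddCircle)
    have h2 := mFourierCoeff_translate (fun _ : UnitAddTorus (Fin d) => (1 : ℂ)) v n
    have h3 : (mFourier n v - 1) *
        mFourierCoeff (fun _ : UnitAddTorus (Fin d) => (1 : ℂ)) n = 0 := by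
      rw [sub_mul, one_mul, sub_eq_zero]; exact h2.symm
    refine (mul_eq_zero.1 h3).resolve_left fun h4 => ?_
    rw [h4, norm_zero] at h1
    linarith

lemma integral_norm_trigPoly_sq (f : (Fin d → ℤ) →₀ ℂ) :
    HasSum (fun n => ‖f n‖ ^ 2) (∫ t, ‖trigPoly f t‖ ^ 2) := by
  have h := hasSum_sq_mFourierCoeff_of_continuous (continuous_trigPoly f)
  convert! h using 3 with n
  have h1 := mFourierCoeff_mul_trigPoly (d := d) (M := fun _ => 1) continuous_const f n
  simp only [one_mul] at h1
  change _ = ‖mFourierCoeff (fun t => trigPoly f t) n‖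
  rw [h1]
  simp only [mFourierCoeff_one, sub_eq_zero]
  by_cases hn : f n = 0 <;> simp [hn]

lemma continuous_lpMultiplier {g : ℝ → ℂ} (hg : Continuous g) (k : ℤ) :
    Continuous (lpMultiplier (d := d) g k) :=
  hg.comp (continuous_const.mul continuous_torusSymbol)

lemma vectorKernel_lpKernel_apply {g : ℝ → ℂ} (hg : Continuous g) (κ : Finset ℤ)
    (f : (Fin d → ℤ) →₀ ℂ) (n : Fin d → ℤ) :
    kernelOp (vectorKernel (lpKernel g) κ) f n =
      WithLp.toLp 2 fun k : κ => mFourierCoeff (fun t => lpMultiplier g k t * trigPoly f t) n := by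
  ext k
  rw [kernelOp_apply]
  simp [vectorKernel, mFourierCoeff_mul_trigPoly (continuous_lpMultiplier hg _), lpKernel]

/-- Only boundedly many Littlewood–Paley multipliers are nonzero at a given point. -/
lemma sum_sq_lpMultiplier_le {ε G : ℝ} (hε0 : 0 < ε) {g : ℝ → ℂ} (hG : ∀ t, ‖g t‖ ≤ G)
    (hgsupp : ∀ t, t ∉ Set.Icc (ε ^ 2) (ε⁻¹ ^ 2) → g t = 0) {N : ℕ} (hN : ε⁻¹ ^ 2 < 2 ^ N)
    (κ : Finset ℤ) (t : UnitAddTorus (Fin d)) :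
    ∑ k ∈ κ, ‖lpMultiplier g k t‖ ^ 2 ≤ N * G ^ 2 := by
  classical
  set s := κ.filter fun k => lpMultiplier g k t ≠ 0 with hs
  have h0 : ∑ k ∈ κ, ‖lpMultiplier g k t‖ ^ 2 = ∑ k ∈ s, ‖lpMultiplier g k t‖ ^ 2 := by
    rw [hs, Finset.sum_filter]
    refine Finset.sum_congr rfl fun k _ => ?_
    split_ifs with h
    · rfl
    · simp [not_not.1 h]
  have hclose (k k' : ℤ) (hk : k ∈ s) (hk' : k' ∈ s) : k' < k + N := by
    by_contra! hlt
    have h1 : ((2 : ℝ) ^ (-k)) ^ 2 * torusSymbol t ≤ ε⁻¹ ^ 2 := by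
      by_contra h; exact (Finset.mem_filter.1 hk).2 (hgsupp _ fun h' => h h'.2)
    have h2 : ε ^ 2 ≤ ((2 : ℝ) ^ (-k')) ^ 2 * torusSymbol t := by
      by_contra h; exact (Finset.mem_filter.1 hk').2 (hgsupp _ fun h' => h h'.1)
    have h3 : (2 : ℝ) ^ N * 2 ^ (-k') ≤ 2 ^ (-k) := by
      rw [← zpow_natCast, ← zpow_add₀ two_ne_zero]
      exact zpow_le_zpow_right₀ one_le_two (by linarith)
    have h4 : ((2 : ℝ) ^ N) ^ 2 * ε ^ 2 ≤ ε⁻¹ ^ 2 := by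
      calc ((2 : ℝ) ^ N) ^ 2 * ε ^ 2
          ≤ ((2 : ℝ) ^ N) ^ 2 * (((2 : ℝ) ^ (-k')) ^ 2 * torusSymbol t) := by gcongr
        _ = ((2 : ℝ) ^ N * 2 ^ (-k')) ^ 2 * torusSymbol t := by ring
        _ ≤ ((2 : ℝ) ^ (-k)) ^ 2 * torusSymbol t := by
            gcongr; exact torusSymbol_nonneg t
        _ ≤ _ := h1
    have h5 : (ε⁻¹ ^ 2) ^ 2 < ((2 : ℝ) ^ N) ^ 2 := by gcongr
    have h6 : (ε⁻¹ ^ 2) ^ 2 * ε ^ 2 = ε⁻¹ ^ 2 := by field_simp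
    nlinarith [mul_lt_mul_of_pos_right h5 (pow_pos hε0 2)]
  have hcard : s.card ≤ N := by
    rcases s.eq_empty_or_nonempty with h | h
    · simp [h]
    · have hsub : s ⊆ Finset.Ico (s.min' h) (s.min' h + N) := fun k hk =>
        Finset.mem_Ico.2 ⟨s.min'_le k hk, hclose _ _ (s.min'_mem h) hk⟩
      simpa using Finset.card_le_card hsub
  rw [h0]
  calc ∑ k ∈ s, ‖lpMultiplier g k t‖ ^ 2 ≤ ∑ k ∈ s, G ^ 2 :=
        Finset.sum_le_sum fun k _ => pow_le_pow_left₀ (norm_nonneg _) (hG _) 2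
    _ = s.card * G ^ 2 := by simp
    _ ≤ N * G ^ 2 := by gcongr

lemma tsum_enorm_sq_eq {ι E : Type*} [NormedAddCommGroup E] {u : ι → E} {a : ℝ}
    (h : HasSum (fun n => ‖u n‖ ^ 2) a) : ∑' n, ‖u n‖ₑ ^ 2 = ENNReal.ofReal a := by
  rw [← h.tsum_eq, ENNReal.ofReal_tsum_of_nonneg (fun _ => sq_nonneg _) h.summable]
  refine tsum_congr fun n => ?_
  rw [ENNReal.ofReal_pow (norm_nonneg _), ofReal_norm]

lemma kernelOp_lpKernel_sq_le {g : ℝ → ℂ} (hg : Continuous g) {B : ℝ≥0} {κ : Finset ℤ}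
    (hB : ∀ t : UnitAddTorus (Fin d), ∑ k ∈ κ, ‖lpMultiplier g k t‖ ^ 2 ≤ B)
    (f : (Fin d → ℤ) →₀ ℂ) :
    ∑' n, ‖kernelOp (vectorKernel (lpKernel g) κ) f n‖ₑ ^ 2 ≤ B * ∑' n, ‖f n‖ₑ ^ 2 := by
  have hP := continuous_trigPoly f
  have hcont_int (u : UnitAddTorus (Fin d) → ℝ) (hu : Continuous u) : Integrable u :=
    hu.integrable_of_hasCompactSupport (HasCompactSupport.of_compactSpace _)
  have hM := fun k => continuous_lpMultiplier (d := d) hg k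
  have h1 : HasSum (fun n => ‖kernelOp (vectorKernel (lpKernel g) κ) f n‖ ^ 2)
      (∑ k ∈ κ, ∫ t, ‖lpMultiplier g k t * trigPoly f t‖ ^ 2) := by
    have h2 : (fun n => ‖kernelOp (vectorKernel (lpKernel g) κ) f n‖ ^ 2) = fun n =>
        ∑ k ∈ κ, ‖mFourierCoeff (fun t => lpMultiplier g k t * trigPoly f t) n‖ ^ 2 := by
      funext n
      rw [vectorKernel_lpKernel_apply hg, EuclideanSpace.norm_sq_eq]
      exact Finset.sum_coe_sort κ fun k =>
        ‖mFourierCoeff (fun t => lpMultiplier g k t * trigPoly f t) n‖ ^ 2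
    rw [h2]
    exact hasSum_sum fun k _ => hasSum_sq_mFourierCoeff_of_continuous ((hM k).mul hP)
  rw [tsum_enorm_sq_eq h1, tsum_enorm_sq_eq (integral_norm_trigPoly_sq f),
    ← ENNReal.ofReal_coe_nnreal, ← ENNReal.ofReal_mul B.coe_nonneg]
  refine ENNReal.ofReal_le_ofReal ?_
  have h3 : ∀ k ∈ κ, Integrable fun t => ‖lpMultiplier g k t * trigPoly f t‖ ^ 2 :=
    fun k _ => hcont_int _ (((hM k).mul hP).norm.pow 2)
  rw [← integral_finsetSum _ h3, ← integral_const_mul]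
  refine integral_mono (hcont_int _ ?_) (hcont_int _ (by fun_prop)) fun t => ?_
  · exact continuous_finsetSum _ fun k _ => ((hM k).mul hP).norm.pow 2
  · simp only [norm_mul, mul_pow, ← Finset.sum_mul]
    gcongr
    exact hB t

lemma mFourier_coe (m : Fin d → ℤ) (ξ : Fin d → ℝ) :
    mFourier m (fun i => (ξ i : UnitAddCircle)) =
      Complex.exp (2 * π * Complex.I * ∑ j, (m j : ℂ) * (ξ j : ℂ)) := by
  rw [Finset.mul_sum, Complex.exp_sum]
  change ∏ j, fourier (m j) (ξ j : UnitAddCircle) = _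
  refine Finset.prod_congr rfl fun j _ => ?_
  rw [fourier_coe_apply]
  congr 1
  push_cast
  ring

lemma SinD_eq_sqrt_torusSymbol (ξ : Fin d → ℝ) :
    SinD d ξ = √(torusSymbol fun i => (ξ i : UnitAddCircle)) := by
  rw [SinD, torusSymbol, Finset.mul_sum]
  congr 1
  refine Finset.sum_congr rfl fun j _ => ?_
  rw [norm_fourier_one_sub_one_sq, sin_sq_eq_half_sub]
  ring_nf

lemma LPpieceZ_eq_mFourierCoeff (ψ : ℝ → ℂ) (k : ℤ) (f : (Fin d → ℤ) → ℂ) (n : Fin d → ℤ) :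
    LPpieceZ d ψ k f n = mFourierCoeff
      (fun t => lpMultiplier (fun x => ψ (√x)) k t * ∑' m, f m * mFourier m t) n := by
  rw [mFourierCoeff_eq_integral _ n fun _ => -1 / 2, LPpieceZ]
  have h : Td d =ᵐ[volume]
      {x : Fin d → ℝ | ∀ i, x i ∈ Set.Ioc (-1 / 2 : ℝ) (-1 / 2 + 1)} := by
    have h1 := Measure.univ_pi_Ioc_ae_eq_Icc (μ := fun _ : Fin d => (volume : Measure ℝ))
      (f := fun _ => -1 / 2) (g := fun _ => -1 / 2 + 1)
    rw [← Set.pi_univ_Icc] at h1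
    have h2 : {x : Fin d → ℝ | ∀ i, x i ∈ Set.Ioc (-1 / 2 : ℝ) (-1 / 2 + 1)} =
        Set.univ.pi fun _ => Set.Ioc (-1 / 2) (-1 / 2 + 1) := by ext x; simp
    have h3 : Td d = Set.univ.pi fun _ => Set.Icc (-1 / 2) (-1 / 2 + 1) := by norm_num [Td]
    rw [h2, h3]
    exact h1.symm
  rw [setIntegral_congr_set h]
  refine integral_congr_ae (Filter.Eventually.of_forall fun ξ => ?_)
  simp only [mFourier_coe, lpMultiplier, SinD_eq_sqrt_torusSymbol, Ftd, smul_eq_mul]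
  rw [sqrt_mul (sq_nonneg _), sqrt_sq (by positivity)]
  simp only [Pi.neg_apply, Int.cast_neg, neg_mul, Finset.sum_neg_distrib, mul_neg]
  ring

lemma hasSum_mul_lpKernel {ψ : ℝ → ℂ} (hg : Continuous fun x => ψ (√x)) {G : ℝ}
    (hG : ∀ t, ‖ψ (√t)‖ ≤ G) (k : ℤ) {f : (Fin d → ℤ) → ℂ} (hf : Summable fun n => ‖f n‖)
    (n : Fin d → ℤ) :
    HasSum (fun m => f m * lpKernel (fun x => ψ (√x)) k (n - m)) (LPpieceZ d ψ k f n) := by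
  have hM := continuous_lpMultiplier (d := d) hg k
  set M : UnitAddTorus (Fin d) → ℂ := lpMultiplier (fun x => ψ (√x)) k with hM_def
  set F : (Fin d → ℤ) → UnitAddTorus (Fin d) → ℂ := fun m t =>
    f m * (mFourier (-n) t • (M t * mFourier m t)) with hF
  have hnorm (m : Fin d → ℤ) (t : UnitAddTorus (Fin d)) : ‖mFourier m t‖ = 1 := by
    change ‖∏ i, fourier (m i) (t i)‖ = 1
    rw [norm_prod]
    exact Finset.prod_eq_one fun i _ => by rw [fourier_apply, Circle.norm_coe]
  have hFint (m : Fin d → ℤ) : Integrable (F m) :=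
    (integrable_mFourier_smul (hM.mul (mFourier m).continuous) n).const_mul _
  have hFnorm (m : Fin d → ℤ) (t : UnitAddTorus (Fin d)) : ‖F m t‖ ≤ ‖f m‖ * G := by
    simp only [hF, norm_mul, norm_smul, hnorm, one_mul, mul_one]
    gcongr
    exact hG _
  have hsum : Summable fun m => ∫ t, ‖F m t‖ := by
    refine Summable.of_nonneg_of_le (fun m => integral_nonneg fun t => norm_nonneg _)
      (fun m => ?_) (hf.mul_right G)
    refine (integral_mono (hFint m).norm (integrable_const _) (hFnorm m)).trans ?_
    simp
  have h := hasSum_integral_of_summable_integral_norm hFint hsum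
  convert! h using 1
  · funext m
    rw [lpKernel, ← mFourierCoeff_mul_mFourier, mFourierCoeff, integral_const_mul]
  · rw [LPpieceZ_eq_mFourierCoeff, mFourierCoeff]
    refine integral_congr_ae (Filter.Eventually.of_forall fun t => ?_)
    simp only [smul_eq_mul, hF, ← hM_def, ← tsum_mul_left]
    exact tsum_congr fun m => by ring

/-- The finitely supported truncation of `f` to `s`. -/
noncomputable def truncate {ι : Type*} (f : ι → ℂ) (s : Finset ι) : ι →₀ ℂ :=
  Finsupp.indicator s fun n _ => f n

lemma enorm_truncate_le {ι : Type*} (f : ι → ℂ) (s : Finset ι) (n : ι) :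
    ‖truncate f s n‖ₑ ≤ ‖f n‖ₑ := by
  classical
  rw [truncate, Finsupp.indicator_apply]
  split_ifs <;> simp

lemma enorm_toLp_two {κ : Finset ℤ} (u : ℤ → ℂ) :
    ‖(WithLp.toLp 2 fun k : κ => u k : EuclideanSpace ℂ κ)‖ₑ =
      (∑ k ∈ κ, ‖u k‖ₑ ^ 2) ^ ((1 : ℝ) / 2) := by
  rw [enorm_eq_nnnorm, EuclideanSpace.nnnorm_eq, NNReal.sqrt_eq_rpow,
    ENNReal.coe_rpow_of_nonneg _ (by norm_num)]
  congr 1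
  push_cast
  exact Finset.sum_coe_sort κ fun k => ‖u k‖ₑ ^ 2

lemma tendsto_kernelOp_truncate {ψ : ℝ → ℂ} (hg : Continuous fun x => ψ (√x)) {G : ℝ}
    (hG : ∀ t, ‖ψ (√t)‖ ≤ G) (κ : Finset ℤ) {f : (Fin d → ℤ) → ℂ}
    (hf : Summable fun n => ‖f n‖) (n : Fin d → ℤ) :
    Filter.Tendsto (fun s => kernelOp (vectorKernel (lpKernel fun x => ψ (√x)) κ) (truncate f s) n)
      Filter.atTop (nhds (WithLp.toLp 2 fun k : κ => LPpieceZ d ψ k f n)) := by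
  classical
  have h (s : Finset (Fin d → ℤ)) :
      kernelOp (vectorKernel (lpKernel fun x => ψ (√x)) κ) (truncate f s) n =
        WithLp.toLp 2 fun k : κ => ∑ m ∈ s, f m * lpKernel (fun x => ψ (√x)) k (n - m) := by
    ext k
    have hs : (truncate f s).support ⊆ s := fun m hm => Finsupp.support_indicator_subset _ _ hm
    rw [kernelOp_apply, Finset.sum_subset hs]
    · rw [WithLp.ofLp_sum, Finset.sum_apply]
      refine Finset.sum_congr rfl fun m hm => ?_
      simp [vectorKernel, truncate, Finsupp.indicator_apply, hm]
    · intro m _ hm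
      rw [Finsupp.notMem_support_iff.1 hm, map_zero]
  simp only [h]
  exact ((PiLp.continuous_toLp 2 _).tendsto _).comp
    (tendsto_pi_nhds.2 fun k => hasSum_mul_lpKernel hg hG k hf n)

lemma tsum_LPpieceZ_le {ψ : ℝ → ℂ} (hg : Continuous fun x => ψ (√x)) {G : ℝ}
    (hG : ∀ t, ‖ψ (√t)‖ ≤ G) {p : ℝ} (hp : 0 ≤ p) {c : ℝ≥0∞}
    (h : ∀ (κ : Finset ℤ) (f : (Fin d → ℤ) →₀ ℂ),
      ∑' n, ‖kernelOp (vectorKernel (lpKernel fun x => ψ (√x)) κ) f n‖ₑ ^ p ≤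
        c * ∑' n, ‖f n‖ₑ ^ p)
    {f : (Fin d → ℤ) → ℂ} (hf : Summable fun n => ‖f n‖) :
    ∑' n, ((∑' k : ℤ, ‖LPpieceZ d ψ k f n‖ₑ ^ 2) ^ ((1 : ℝ) / 2)) ^ p ≤
      c * ∑' n, ‖f n‖ₑ ^ p := by
  rw [ENNReal.tsum_eq_iSup_sum]
  refine iSup_le fun T => ?_
  have hκ (κ : Finset ℤ) :
      ∑ n ∈ T, ((∑ k ∈ κ, ‖LPpieceZ d ψ k f n‖ₑ ^ 2) ^ ((1 : ℝ) / 2)) ^ p ≤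
        c * ∑' n, ‖f n‖ₑ ^ p := by
    simp only [← enorm_toLp_two fun k => LPpieceZ d ψ k f _]
    refine le_of_tendsto' (tendsto_finsetSum T fun n _ =>
      ((ENNReal.continuous_rpow_const (y := p)).tendsto _).comp
        (tendsto_kernelOp_truncate hg hG κ hf n).enorm) fun s => ?_
    refine (ENNReal.sum_le_tsum T).trans ((h κ (truncate f s)).trans ?_)
    gcongr with n
    exact enorm_truncate_le f s n
  refine le_of_tendsto' (tendsto_finsetSum T fun n _ =>
    ((ENNReal.continuous_rpow_const (y := p)).tendsto _).comp
      (((ENNReal.continuous_rpow_const (y := (1 : ℝ) / 2)).tendsto _).comp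
        (ENNReal.summable (f := fun k => ‖LPpieceZ d ψ k f n‖ₑ ^ 2)).hasSum)) hκ

/-- The strong type `(p, p)` bound for the truncated vector-valued Littlewood–Paley operators,
uniformly in the truncation. -/
lemma exists_kernelOp_lpKernel_le (hd : 1 ≤ d) {r : ℕ} (hr : d + 1 ≤ 2 * r) {ε : ℝ} (hε0 : 0 < ε)
    (hε1 : ε < 1) {g : ℝ → ℂ} (hg : ContDiff ℝ r g) {G : ℝ} (hG : ∀ t, ‖g t‖ ≤ G)
    (hgsupp : ∀ t, t ∉ Set.Icc (ε ^ 2) (ε⁻¹ ^ 2) → g t = 0) {p : ℝ} (hp : 1 < p) :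
    ∃ c : ℝ≥0∞, c ≠ ∞ ∧ ∀ (κ : Finset ℤ) (f : (Fin d → ℤ) →₀ ℂ),
      ∑' n, ‖kernelOp (vectorKernel (lpKernel g) κ) f n‖ₑ ^ p ≤ c * ∑' n, ‖f n‖ₑ ^ p := by
  obtain ⟨C, hC⟩ := isLPKernel_lpKernel hd hr hε0 hε1 hg hgsupp
  obtain ⟨N, hN⟩ := pow_unbounded_of_one_lt (ε⁻¹ ^ 2) one_lt_two
  have hB (κ : Finset ℤ) (t : UnitAddTorus (Fin d)) :
      ∑ k ∈ κ, ‖lpMultiplier g k t‖ ^ 2 ≤ (N * G ^ 2).toNNReal :=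
    (sum_sq_lpMultiplier_le hε0 hG hgsupp hN κ t).trans (le_coe_toNNReal _)
  exact ⟨_, czConst'_ne_top d (lpHormanderConst d C) (N * G ^ 2).toNNReal hp.le, fun κ f =>
    kernelOp_strongType hd _ _ _ (kernelOp_lpKernel_sq_le hg.continuous (hB κ))
      (hC.hormanderCond κ) (hC.hormanderCond_adjoint κ) hp f⟩

end Torus

/-- **Littlewood–Paley square function estimate for the discrete Laplacian on `ℤ^d`**
(the paper's Proposition 2.2 for `L = (-Δ_{ℤ^d})^{1/2}`, with `ρ = ⌊d/2⌋ + 1`):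
if `ψ` is `C^ρ` on `[0,∞)` with support in `[ε, 1/ε]`, then for `1 < p < ∞`,
`‖(∑_k |S_k f|²)^{1/2}‖_{ℓ^p} ≤ C ‖f‖_{ℓ^p}` for `f ∈ ℓ¹(ℤ^d)`. -/
theorem stmt16 (d : ℕ) (hd : 1 ≤ d) (ε : ℝ) (hε0 : 0 < ε) (hε1 : ε < 1)
    (ψ : ℝ → ℂ) (hψ : ContDiffOn ℝ (d / 2 + 1 : ℕ) ψ (Set.Ici 0))
    (hψsupp : ∀ t : ℝ, t ∉ Set.Icc ε ε⁻¹ → ψ t = 0)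
    (p : ℝ) (hp : 1 < p) :
    ∃ C : ℝ, 0 < C ∧
      ∀ f : (Fin d → ℤ) → ℂ, Summable (fun n => ‖f n‖) →
        (∑' n : Fin d → ℤ,
            ((∑' k : ℤ, (‖LPpieceZ d ψ k f n‖₊ : ℝ≥0∞) ^ 2) ^ ((1 : ℝ) / 2)) ^ p)
            ^ (1 / p)
          ≤ ENNReal.ofReal C * lpN d p f := by
  have hg := contDiff_comp_sqrt hε0 hψ hψsupp
  have hgsupp : ∀ t, t ∉ Set.Icc (ε ^ 2) (ε⁻¹ ^ 2) → ψ (√t) = 0 := fun t ht =>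
    hψsupp _ fun h => ht ⟨(le_sqrt' hε0).1 h.1, (sqrt_le_left (by positivity)).1 h.2⟩
  obtain ⟨G, -, hG⟩ := exists_iteratedFDeriv_le hg
    (HasCompactSupport.intro isCompact_Icc fun t ht => hgsupp t ht)
  replace hG (t : ℝ) : ‖ψ (√t)‖ ≤ G := by simpa using hG 0 (Nat.zero_le _) t
  obtain ⟨c, hc, h⟩ := exists_kernelOp_lpKernel_le hd (by omega) hε0 hε1 hg hG hgsupp hp
  have hp0 : 0 ≤ 1 / p := by positivity
  refine ⟨(c ^ (1 / p)).toReal + 1, by positivity, fun f hf => ?_⟩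
  calc _ ≤ (c * ∑' n, ‖f n‖ₑ ^ p) ^ (1 / p) :=
        ENNReal.rpow_le_rpow (tsum_LPpieceZ_le hg.continuous hG (by linarith) h hf) hp0
    _ = c ^ (1 / p) * lpN d p f := ENNReal.mul_rpow_of_nonneg _ _ hp0
    _ ≤ _ := by
        gcongr
        rw [← ENNReal.ofReal_toReal (ENNReal.rpow_ne_top_of_nonneg hp0 hc)]
        exact ENNReal.ofReal_le_ofReal (by simp)
end
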